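/- The linked-twist map has polynomial decay of correlations of order 1/n for Hölder observables: for every α ∈ (0,1] and all functions φ, ψ : 𝕋 → ℝ that are α-Hölder continuous (i.e. there exist constants C_φ, C_ψ ≥ 0 with HolderWith C_φ α φ and HolderWith C_ψ α ψ) and such that ∫_R ψ dμ = 0, there exists a constant K > 0 such that for every n ≥ 1, |∫_R φ(H^[n] z) * ψ(z) dμ(z)| ≤ K / n. -/

import Mathlib

open MeasureTheory
open scoped NNReal ENNReal

noncomputable section

instance : Fact ((0:ℝ) < 2) := ⟨by norm_num⟩

/-- The torus, as a product of two circles of circumference 2. -/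
abbrev 𝕋 : Type := AddCircle (2:ℝ) × AddCircle (2:ℝ)

/-- The unique representative in `[0, 2)` of a point of the circle. -/
def θ (x : AddCircle (2:ℝ)) : ℝ := ((AddCircle.equivIco 2 0) x : ℝ)

def P : Set 𝕋 := {z | θ z.2 ≤ 1}
def Q : Set 𝕋 := {z | θ z.1 ≤ 1}
def R : Set 𝕋 := P ∪ Q
def S : Set 𝕋 := P ∩ Q

/-- The horizontal twist map. -/
def F (z : 𝕋) : 𝕋 :=
  if θ z.2 ≤ 1 then (z.1 + (((2 * θ z.2 : ℝ) : AddCircle (2:ℝ))), z.2) else z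

/-- The vertical twist map. -/
def G (z : 𝕋) : 𝕋 :=
  if θ z.1 ≤ 1 then (z.1, z.2 + (((2 * θ z.1 : ℝ) : AddCircle (2:ℝ)))) else z

/-- The linked-twist map. -/
def H : 𝕋 → 𝕋 := G ∘ F

/-- The first-return time of `T` to `S`. -/
def rtn (T : 𝕋 → 𝕋) (z : 𝕋) : ℕ := sInf {n : ℕ | 1 ≤ n ∧ T^[n] z ∈ S}

/-- The first-return map of `T` to `S`. -/
def retMap (T : 𝕋 → 𝕋) (z : 𝕋) : 𝕋 := T^[rtn T z] z

/-- The set of points of `S` with return time exactly `n`. -/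
def Sn (n : ℕ) : Set 𝕋 := {z | z ∈ S ∧ rtn H z = n}

namespace LTM

/-- Branch indices: a side and a (half) return time. -/
abbrev Br : Type := Bool × ℕ

/-- The segment `{(a + s y, y) : lo ≤ y ≤ hi}`. -/
structure Seg where
  a : ℝ
  s : ℝ
  lo : ℝ
  hi : ℝ

namespace Seg

variable (W : Seg)

def h (y : ℝ) : ℝ := W.a + W.s * y
def len : ℝ := W.hi - W.lo
def L1 : ℝ := 2 * (1 - W.h W.lo) + W.lo
def L2 : ℝ := 2 * W.h W.hi + 1 - W.hi

/-- The segment lies in the unit square, has slope at most `1/2`, and stays away from the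
two singular corners. -/
structure Valid : Prop where
  s0 : 0 ≤ W.s
  s1 : W.s ≤ 1 / 2
  lt : W.lo < W.hi
  lo0 : 0 ≤ W.lo
  hi1 : W.hi ≤ 1
  h0 : 0 ≤ W.h W.lo
  h1 : W.h W.hi ≤ 1
  L1pos : 0 < W.L1
  L2pos : 0 < W.L2

def eps : ℝ := min W.L1 W.L2
def chi : ℝ := 1 + (1 / 10) / √W.eps
def D : ℝ := W.chi / W.len
def V : ℝ := W.D ^ (9 / 10 : ℝ)

/-- The image under the central symmetry of the unit square. -/
def flip : Seg := ⟨1 - W.a - W.s, W.s, 1 - W.hi, 1 - W.lo⟩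

def cl (t : ℝ) : ℝ := max W.lo (min W.hi t)
def cc (k : ℕ) : ℝ := (2 - W.a) / (2 * k + W.s)
def dd (k : ℕ) : ℝ := (2 * k - 1 - W.a) / (2 * k + W.s)
def ee (k : ℕ) : ℝ := W.cl (max (W.cc k) (W.dd 1))
def ff (k : ℕ) : ℝ := W.cl (min (W.dd k) (W.cc 1))

/-- Lower end of the piece of `W` with branch index `i`. -/
def pl : Br → ℝ
  | (false, 1) => W.lo
  | (false, 2) => W.ee 2
  | (false, k + 3) => W.ee (k + 3)
  | (true, 1) => W.cl (W.cc 1)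
  | (true, k + 3) => W.ff (k + 2)
  | (_, _) => W.lo

/-- Upper end of the piece of `W` with branch index `i`. -/
def ph : Br → ℝ
  | (false, 1) => W.cl (W.dd 1)
  | (false, 2) => W.ff 2
  | (false, k + 3) => W.ee (k + 2)
  | (true, 1) => W.hi
  | (true, k + 3) => W.ff (k + 3)
  | (_, _) => W.lo

def Act (i : Br) : Prop := W.pl i < W.ph i

def lam (i : Br) : ℝ := 2 * i.2 + W.s

end Seg

/-- Number of turns made along a branch. -/
def jj : Br → ℕ
  | (false, 0) => 0
  | (false, 1) => 0
  | (false, _ + 2) => 1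
  | (true, 1) => 1
  | (true, k + 3) => k + 2
  | (true, _) => 0

/-- The region of the square belonging to a branch. -/
def InPiece (x y : ℝ) : Br → Prop
  | (false, 1) => x + 2 * y ≤ 1
  | (false, 2) => 1 ≤ x + 2 * y ∧ x + 2 * y ≤ 2 ∧ 2 ≤ x + 4 * y ∧ x + 4 * y ≤ 3
  | (false, k + 3) => 1 ≤ x + 2 * y ∧ x + 2 * ((k : ℝ) + 2) * y ≤ 2 ∧
      2 ≤ x + 2 * ((k : ℝ) + 3) * y
  | (true, 1) => 2 ≤ x + 2 * y
  | (true, k + 3) => x + 2 * y ≤ 2 ∧ 2 * (k : ℝ) + 3 ≤ x + 2 * ((k : ℝ) + 2) * y ∧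
      x + 2 * ((k : ℝ) + 3) * y ≤ 2 * (k : ℝ) + 5
  | (_, _) => False

/-- The action of the central symmetry on branches. -/
def fl : Br → Br
  | (b, 2) => (b, 2)
  | (b, k) => (!b, k)

namespace Seg

variable (W : Seg)

def Y (i : Br) (y : ℝ) : ℝ := W.h y + 2 * i.2 * y - 2 * jj i

/-- The image of a piece under the return map. -/
def child (i : Br) : Seg :=
  ⟨(2 * jj i - W.a) / W.lam i, 1 / W.lam i, W.Y i (W.pl i), W.Y i (W.ph i)⟩

def plen (i : Br) : ℝ := W.ph i - W.pl i

variable {W}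

lemma Valid.a_le (hW : W.Valid) : W.a ≤ 1 := by
  have := hW.s0; have := hW.h1; have := hW.lo0; have := hW.lt
  unfold h at *; nlinarith

lemma Valid.le_a (hW : W.Valid) : -W.s ≤ W.a := by
  have := hW.s0; have := hW.h0; have := hW.hi1; have := hW.lt
  unfold h at *; nlinarith

lemma h_mono (hW : W.Valid) {y z : ℝ} (hyz : y ≤ z) : W.h y ≤ W.h z := by
  have := hW.s0
  unfold h; nlinarith

lemma h_lip (hW : W.Valid) {y z : ℝ} (hyz : y ≤ z) : W.h z ≤ W.h y + (z - y) / 2 := by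
  have := hW.s1
  unfold h; nlinarith

lemma Valid.h_nonneg (hW : W.Valid) {y : ℝ} (hy : W.lo ≤ y) : 0 ≤ W.h y :=
  hW.h0.trans (h_mono hW hy)

lemma Valid.h_le (hW : W.Valid) {y : ℝ} (hy : y ≤ W.hi) : W.h y ≤ 1 :=
  (h_mono hW hy).trans hW.h1

lemma lam_pos (hW : W.Valid) {i : Br} (hi : 1 ≤ i.2) : 0 < W.lam i := by
  have := hW.s0
  have : (1:ℝ) ≤ i.2 := by exact_mod_cast hi
  unfold lam; linarith

lemma two_k_le_lam (hW : W.Valid) (i : Br) : 2 * (i.2 : ℝ) ≤ W.lam i := by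
  have := hW.s0
  unfold lam; linarith

lemma le_cc_iff (hW : W.Valid) {k : ℕ} (hk : 1 ≤ k) {y : ℝ} :
    y ≤ W.cc k ↔ W.h y + 2 * k * y ≤ 2 := by
  have := hW.s0
  have : (1:ℝ) ≤ k := by exact_mod_cast hk
  unfold cc h
  rw [le_div_iff₀ (by linarith)]
  constructor <;> intro h <;> nlinarith

lemma cc_le_iff (hW : W.Valid) {k : ℕ} (hk : 1 ≤ k) {y : ℝ} :
    W.cc k ≤ y ↔ 2 ≤ W.h y + 2 * k * y := by
  have := hW.s0
  have : (1:ℝ) ≤ k := by exact_mod_cast hk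
  unfold cc h
  rw [div_le_iff₀ (by linarith)]
  constructor <;> intro h <;> nlinarith

lemma le_dd_iff (hW : W.Valid) {k : ℕ} (hk : 1 ≤ k) {y : ℝ} :
    y ≤ W.dd k ↔ W.h y + 2 * k * y ≤ 2 * k - 1 := by
  have := hW.s0
  have : (1:ℝ) ≤ k := by exact_mod_cast hk
  unfold dd h
  rw [le_div_iff₀ (by linarith)]
  constructor <;> intro h <;> nlinarith

lemma dd_le_iff (hW : W.Valid) {k : ℕ} (hk : 1 ≤ k) {y : ℝ} :
    W.dd k ≤ y ↔ 2 * k - 1 ≤ W.h y + 2 * k * y := by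
  have := hW.s0
  have : (1:ℝ) ≤ k := by exact_mod_cast hk
  unfold dd h
  rw [div_le_iff₀ (by linarith)]
  constructor <;> intro h <;> nlinarith

lemma cl_mono {u v : ℝ} (huv : u ≤ v) : W.cl u ≤ W.cl v := by
  unfold cl; gcongr

lemma lo_le_cl (u : ℝ) : W.lo ≤ W.cl u := le_max_left _ _

lemma cl_le_hi (hW : W.Valid) (u : ℝ) : W.cl u ≤ W.hi :=
  max_le hW.lt.le (min_le_left _ _)

lemma of_cl_lt {u v y : ℝ} (hlt : W.cl u < W.cl v) (h1 : W.cl u ≤ y) (h2 : y ≤ W.cl v) :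
    u ≤ y ∧ y ≤ v := by
  unfold cl at *
  grind

lemma cc_anti (hW : W.Valid) {k l : ℕ} (hk : 1 ≤ k) (hkl : k ≤ l) : W.cc l ≤ W.cc k := by
  have := hW.s0; have := hW.a_le
  have h1 : (1:ℝ) ≤ k := by exact_mod_cast hk
  have h2 : (k:ℝ) ≤ l := by exact_mod_cast hkl
  unfold cc
  apply div_le_div_of_nonneg_left <;> linarith

lemma dd_eq_flip (hW : W.Valid) {k : ℕ} (hk : 1 ≤ k) : W.flip.cc k = 1 - W.dd k := by
  have := hW.s0
  have h1 : (1:ℝ) ≤ k := by exact_mod_cast hk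
  have : 2 * (k:ℝ) + W.s ≠ 0 := by linarith
  simp only [cc, dd, flip]
  field_simp
  ring

lemma cc_eq_flip (hW : W.Valid) {k : ℕ} (hk : 1 ≤ k) : W.flip.dd k = 1 - W.cc k := by
  have := hW.s0
  have h1 : (1:ℝ) ≤ k := by exact_mod_cast hk
  have : 2 * (k:ℝ) + W.s ≠ 0 := by linarith
  simp only [cc, dd, flip]
  field_simp
  ring

lemma cl_flip (hW : W.Valid) (t : ℝ) : W.flip.cl (1 - t) = 1 - W.cl t := by
  have := hW.lt
  simp only [cl, flip]
  grind

lemma ee_flip (hW : W.Valid) {k : ℕ} (hk : 1 ≤ k) : W.flip.ee k = 1 - W.ff k := by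
  unfold ee ff
  rw [dd_eq_flip hW hk, cc_eq_flip hW le_rfl, max_sub_sub_left, cl_flip hW]

lemma ff_flip (hW : W.Valid) {k : ℕ} (hk : 1 ≤ k) : W.flip.ff k = 1 - W.ee k := by
  unfold ee ff
  rw [dd_eq_flip hW le_rfl, cc_eq_flip hW hk, min_sub_sub_left, cl_flip hW]

lemma flip_flip : W.flip.flip = W := by
  cases W; simp [flip]; ring

lemma flip_h (y : ℝ) : W.flip.h (1 - y) = 1 - W.h y := by
  simp only [flip, h]; ring

lemma flip_L1 : W.flip.L1 = W.L2 := by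
  simp only [flip, L1, L2, h]; ring

lemma flip_L2 : W.flip.L2 = W.L1 := by
  simp only [flip, L1, L2, h]; ring

lemma flip_len : W.flip.len = W.len := by
  simp only [flip, len]; ring

lemma flip_eps : W.flip.eps = W.eps := by
  simp only [eps, flip_L1, flip_L2, min_comm]

lemma flip_chi : W.flip.chi = W.chi := by simp only [chi, flip_eps]

lemma Valid.flip (hW : W.Valid) : W.flip.Valid where
  s0 := hW.s0
  s1 := hW.s1
  lt := by have := hW.lt; simp only [Seg.flip]; linarith
  lo0 := by have := hW.hi1; simp only [Seg.flip]; linarith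
  hi1 := by have := hW.lo0; simp only [Seg.flip]; linarith
  h0 := by
    have := hW.h1; have := flip_h (W := W) W.hi
    simp only [Seg.flip] at *; linarith
  h1 := by
    have := hW.h0; have := flip_h (W := W) W.lo
    simp only [Seg.flip] at *; linarith
  L1pos := by rw [flip_L1]; exact hW.L2pos
  L2pos := by rw [flip_L2]; exact hW.L1pos

lemma pl_flip_ne (hW : W.Valid) : ∀ {i : Br}, 1 ≤ i.2 → i ≠ (true, 2) →
    W.flip.pl (fl i) = 1 - W.ph i ∧ W.flip.ph (fl i) = 1 - W.pl i
  | (false, 1), _, _ => by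
      simp only [fl, pl, ph, Bool.not_false, dd_eq_flip hW le_rfl, cl_flip hW]
      simp [flip]
  | (false, 2), _, _ => by
      simp only [fl, pl, ph]
      rw [ee_flip hW (by norm_num), ff_flip hW (by norm_num)]; simp
  | (false, k + 3), _, _ => by
      simp only [fl, pl, ph, Bool.not_false]
      rw [ff_flip hW (by omega), ff_flip hW (by omega)]; simp
  | (true, 1), _, _ => by
      simp only [fl, pl, ph, Bool.not_true, cc_eq_flip hW le_rfl, cl_flip hW]
      simp [flip]
  | (true, k + 3), _, _ => by
      simp only [fl, pl, ph, Bool.not_true]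
      rw [ee_flip hW (by omega), ee_flip hW (by omega)]; simp

lemma fl_snd : ∀ i : Br, (fl i).2 = i.2
  | (_, 0) => rfl
  | (_, 1) => rfl
  | (_, 2) => rfl
  | (_, _ + 3) => rfl

lemma fl_fl : ∀ i : Br, fl (fl i) = i
  | (_, 0) => by simp [fl]
  | (_, 1) => by simp [fl]
  | (_, 2) => rfl
  | (_, _ + 3) => by simp [fl]

lemma Act.one_le (i : Br) (hi : W.Act i) : 1 ≤ i.2 ∧ i ≠ (true, 2) := by
  rcases i with ⟨b, k⟩
  rcases k with _ | _ | _ | k <;> cases b <;> simp_all [Act, pl, ph]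

lemma Act.flip (hW : W.Valid) {i : Br} (hi : W.Act i) : W.flip.Act (fl i) := by
  obtain ⟨h1, h2⟩ := Act.one_le i hi
  obtain ⟨h3, h4⟩ := pl_flip_ne hW h1 h2
  unfold Act at *
  rw [h3, h4]; linarith

lemma plen_flip (hW : W.Valid) {i : Br} (hi : W.Act i) : W.flip.plen (fl i) = W.plen i := by
  obtain ⟨h1, h2⟩ := Act.one_le i hi
  obtain ⟨h3, h4⟩ := pl_flip_ne hW h1 h2
  unfold plen
  rw [h3, h4]; linarith

lemma lam_flip (i : Br) : W.flip.lam (fl i) = W.lam i := by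
  simp only [lam, fl_snd, flip]

lemma jj_fl {i : Br} (h1 : 1 ≤ i.2) (h2 : i ≠ (true, 2)) : (jj (fl i) : ℝ) = i.2 - jj i := by
  rcases i with ⟨b, k⟩
  rcases k with _ | _ | _ | k <;> cases b <;> simp_all [fl, jj] <;> ring

lemma Y_flip {i : Br} (h1 : 1 ≤ i.2) (h2 : i ≠ (true, 2)) (y : ℝ) :
    W.flip.Y (fl i) (1 - y) = 1 - W.Y i y := by
  simp only [Y, flip_h, jj_fl h1 h2, fl_snd]; ring

lemma child_flip (hW : W.Valid) {i : Br} (hi : W.Act i) :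
    W.flip.child (fl i) = (W.child i).flip := by
  obtain ⟨h1, h2⟩ := Act.one_le i hi
  obtain ⟨h3, h4⟩ := pl_flip_ne hW h1 h2
  have h5 := (lam_pos hW h1).ne'
  unfold child
  rw [h3, h4, Y_flip h1 h2, Y_flip h1 h2, lam_flip, jj_fl h1 h2]
  simp only [flip, Seg.mk.injEq, and_true]
  field_simp
  unfold lam
  ring

lemma lo_le_pl : ∀ i : Br, W.lo ≤ W.pl i
  | (false, 0) => le_rfl
  | (false, 1) => le_rfl
  | (false, 2) => lo_le_cl _
  | (false, _ + 3) => lo_le_cl _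
  | (true, 0) => le_rfl
  | (true, 1) => lo_le_cl _
  | (true, 2) => le_rfl
  | (true, _ + 3) => lo_le_cl _

lemma ph_le_hi (hW : W.Valid) : ∀ i : Br, W.ph i ≤ W.hi
  | (false, 0) => hW.lt.le
  | (false, 1) => cl_le_hi hW _
  | (false, 2) => cl_le_hi hW _
  | (false, _ + 3) => cl_le_hi hW _
  | (true, 0) => hW.lt.le
  | (true, 1) => le_rfl
  | (true, 2) => hW.lt.le
  | (true, _ + 3) => cl_le_hi hW _

lemma dd_le_cc_two (hW : W.Valid) : W.dd 1 ≤ W.dd 2 ∧ W.dd 1 ≤ W.cc 1 ∧ W.cc 2 ≤ W.cc 1 ∧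
    W.cc 2 ≤ W.dd 2 := by
  have h0 := hW.s0; have h1 := hW.s1; have h2 := hW.a_le; have h3 := hW.le_a
  refine ⟨?_, ?_, cc_anti hW le_rfl (by norm_num), ?_⟩
  · unfold dd
    rw [div_le_div_iff₀ (by push_cast; linarith) (by push_cast; linarith)]
    push_cast; nlinarith
  · unfold dd cc
    gcongr; push_cast; linarith
  · unfold dd cc
    gcongr; push_cast; linarith

lemma pl_le_ph (hW : W.Valid) : ∀ i : Br, W.pl i ≤ W.ph i
  | (false, 0) => le_rfl
  | (false, 1) => lo_le_cl _
  | (false, 2) => by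
      obtain ⟨h1, h2, h3, h4⟩ := dd_le_cc_two hW
      exact cl_mono (max_le (le_min h4 h3) (le_min h1 h2))
  | (false, k + 3) => cl_mono (max_le_max_right _ (cc_anti hW (by omega) (by omega)))
  | (true, 0) => le_rfl
  | (true, 1) => cl_le_hi hW _
  | (true, 2) => le_rfl
  | (true, k + 3) => by
      refine cl_mono (min_le_min_right _ ?_)
      have h1 := dd_eq_flip hW (k := k + 2) (by omega)
      have h2 := dd_eq_flip hW (k := k + 3) (by omega)
      have := cc_anti hW.flip (k := k + 2) (l := k + 3) (by omega) (by omega)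
      linarith

lemma inPiece_of_act (hW : W.Valid) : ∀ {i : Br}, W.Act i → ∀ {y : ℝ}, W.pl i ≤ y →
    y ≤ W.ph i → InPiece (W.h y) y i
  | (false, 0), hi, _, _, _ => absurd hi (lt_irrefl _)
  | (false, 1), hi, y, h1, h2 => by
      have hi' : W.lo < W.cl (W.dd 1) := hi
      have h2' : y ≤ W.cl (W.dd 1) := h2
      have : y ≤ W.dd 1 := by
        unfold cl at *; grind
      rw [le_dd_iff hW le_rfl] at this
      simp only [InPiece]; push_cast at this; linarith
  | (false, 2), hi, y, h1, h2 => by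
      obtain ⟨h3, h4⟩ := of_cl_lt hi h1 h2
      rw [max_le_iff, cc_le_iff hW (by norm_num), dd_le_iff hW le_rfl] at h3
      rw [le_min_iff, le_cc_iff hW (by norm_num), le_dd_iff hW (by norm_num)] at h4
      push_cast at h3 h4
      refine ⟨?_, ?_, ?_, ?_⟩ <;> linarith [h3.1, h3.2, h4.1, h4.2]
  | (false, k + 3), hi, y, h1, h2 => by
      obtain ⟨h3, h4⟩ := of_cl_lt hi h1 h2
      have h5 : max (W.cc (k+3)) (W.dd 1) < max (W.cc (k+2)) (W.dd 1) := by
        by_contra hh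
        exact absurd hi (not_lt.2 (cl_mono (not_lt.1 hh)))
      have h6 : y ≤ W.cc (k+2) := by
        simp only [max_def] at *; split_ifs at * <;> linarith
      rw [max_le_iff, cc_le_iff hW (by omega), dd_le_iff hW le_rfl] at h3
      rw [le_cc_iff hW (by omega)] at h6
      push_cast at h3 h6
      refine ⟨?_, ?_, ?_⟩ <;> linarith [h3.1, h3.2]
  | (true, 0), hi, _, _, _ => absurd hi (lt_irrefl _)
  | (true, 1), hi, y, h1, h2 => by
      have hi' : W.cl (W.cc 1) < W.hi := hi
      have h1' : W.cl (W.cc 1) ≤ y := h1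
      have : W.cc 1 ≤ y := by
        unfold cl at *; grind
      rw [cc_le_iff hW le_rfl] at this
      simp only [InPiece]; push_cast at this; linarith
  | (true, 2), hi, _, _, _ => absurd hi (lt_irrefl _)
  | (true, k + 3), hi, y, h1, h2 => by
      obtain ⟨h3, h4⟩ := of_cl_lt hi h1 h2
      have h5 : min (W.dd (k+2)) (W.cc 1) < min (W.dd (k+3)) (W.cc 1) := by
        by_contra hh
        exact absurd hi (not_lt.2 (cl_mono (not_lt.1 hh)))
      have h6 : W.dd (k+2) ≤ y := by
        simp only [min_def] at *; split_ifs at * <;> linarith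
      rw [le_min_iff, le_dd_iff hW (by omega), le_cc_iff hW le_rfl] at h4
      rw [dd_le_iff hW (by omega)] at h6
      push_cast at h4 h6
      refine ⟨?_, ?_, ?_⟩ <;> linarith [h4.1, h4.2]

end Seg
end LTM

namespace LTM
namespace Seg

variable {W : Seg}

lemma lam_le (hW : W.Valid) (i : Br) : W.lam i ≤ 2 * i.2 + 1 / 2 := by
  have := hW.s1
  unfold lam; linarith

lemma Y_sub (i : Br) (y z : ℝ) : W.Y i z - W.Y i y = W.lam i * (z - y) := by
  simp only [Y, lam, h]; ring

lemma child_h_Y (hW : W.Valid) {i : Br} (hi : 1 ≤ i.2) (y : ℝ) : (W.child i).h (W.Y i y) = y := by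
  have := (lam_pos hW hi).ne'
  simp only [child, h, Y]
  field_simp
  unfold lam
  ring

lemma L1_le (hW : W.Valid) {y : ℝ} (hy : W.lo ≤ y) : W.L1 ≤ 2 * (1 - W.h y) + y := by
  have := h_lip hW hy
  unfold L1; linarith

lemma L2_le (hW : W.Valid) {y : ℝ} (hy : y ≤ W.hi) : W.L2 ≤ 2 * W.h y + 1 - y := by
  have := h_lip hW hy
  unfold L2; linarith

lemma len_pos (hW : W.Valid) : 0 < W.len := sub_pos.2 hW.lt

lemma len_le (hW : W.Valid) : W.len ≤ 1 := by
  have := hW.lo0; have := hW.hi1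
  unfold len; linarith

lemma eps_pos (hW : W.Valid) : 0 < W.eps := lt_min hW.L1pos hW.L2pos

lemma L1_add_L2 : W.L1 + W.L2 = 3 - (1 - 2 * W.s) * W.len := by
  unfold L1 L2 h len; ring

lemma two_le_L1_add_L2 (hW : W.Valid) : 2 ≤ W.L1 + W.L2 := by
  have := hW.s0; have := hW.s1; have := len_pos hW; have := len_le hW
  rw [L1_add_L2]; nlinarith

lemma eps_le (hW : W.Valid) : W.eps ≤ 3 / 2 := by
  have := hW.s0; have := hW.s1; have := len_pos hW
  have h1 := L1_add_L2 (W := W)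
  have h2 : W.eps ≤ W.L1 := min_le_left _ _
  have h3 : W.eps ≤ W.L2 := min_le_right _ _
  nlinarith

lemma one_le_chi : 1 ≤ W.chi := by
  unfold chi
  have : 0 ≤ (1 / 10) / √W.eps := by positivity
  linarith

lemma one_le_D (hW : W.Valid) : 1 ≤ W.D := by
  unfold D
  rw [one_le_div (len_pos hW)]
  exact (len_le hW).trans one_le_chi

lemma one_le_V (hW : W.Valid) : 1 ≤ W.V :=
  Real.one_le_rpow (one_le_D hW) (by norm_num)

end Seg

lemma inPiece_bounds {x y : ℝ} (hx0 : 0 ≤ x) (hx1 : x ≤ 1) (hy0 : 0 ≤ y) (hy1 : y ≤ 1) :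
    ∀ {i : Br}, InPiece x y i → 0 ≤ x + 2 * i.2 * y - 2 * jj i ∧ x + 2 * i.2 * y - 2 * jj i ≤ 1
  | (false, 1), h => by
      simp only [InPiece, jj] at *; push_cast; constructor <;> linarith
  | (false, 2), h => by
      simp only [InPiece, jj] at *; push_cast; constructor <;> linarith
  | (false, k + 3), ⟨h1, h2, h3⟩ => by
      have hk : (0:ℝ) ≤ k * y := by positivity
      simp only [jj]; push_cast; constructor <;> nlinarith
  | (true, 1), h => by
      simp only [InPiece, jj] at *; push_cast; constructor <;> linarith
  | (true, k + 3), ⟨h1, h2, h3⟩ => by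
      have hk : (0:ℝ) ≤ k * (1 - y) := by have := sub_nonneg.2 hy1; positivity
      simp only [jj]; push_cast; constructor <;> nlinarith
  | (false, 0), h => h.elim
  | (true, 0), h => h.elim
  | (true, 2), h => h.elim

lemma inPiece_corner {x y : ℝ} (hx0 : 0 ≤ x) (hy0 : 0 ≤ y) (hy1 : y ≤ 1) :
    ∀ {i : Br}, InPiece x y i → i.2 ≠ 1 →
      1 ≤ 2 * (1 - y) + (x + 2 * i.2 * y - 2 * jj i) ∧ 1 ≤ 2 * y + 1 - (x + 2 * i.2 * y - 2 * jj i)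
  | (false, 1), _, h => absurd rfl h
  | (false, 2), h, _ => by
      simp only [InPiece, jj] at *; push_cast; constructor <;> linarith
  | (false, k + 3), ⟨h1, h2, h3⟩, _ => by
      have hk : (0:ℝ) ≤ k * y := by positivity
      simp only [jj]; push_cast; constructor <;> nlinarith
  | (true, 1), _, h => absurd rfl h
  | (true, k + 3), ⟨h1, h2, h3⟩, _ => by
      have hk : (0:ℝ) ≤ k * (1 - y) := by have := sub_nonneg.2 hy1; positivity
      simp only [jj]; push_cast; constructor <;> nlinarith
  | (false, 0), h, _ => h.elim
  | (true, 0), h, _ => h.elim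
  | (true, 2), h, _ => h.elim

namespace Seg
variable {W : Seg}

lemma pl_mem (hW : W.Valid) (i : Br) : W.lo ≤ W.pl i ∧ W.pl i ≤ W.hi :=
  ⟨lo_le_pl (W := W) i, (pl_le_ph hW i).trans (ph_le_hi hW i)⟩

lemma ph_mem (hW : W.Valid) (i : Br) : W.lo ≤ W.ph i ∧ W.ph i ≤ W.hi :=
  ⟨(lo_le_pl (W := W) i).trans (pl_le_ph hW i), ph_le_hi hW i⟩

lemma Y_bounds (hW : W.Valid) {i : Br} (hi : W.Act i) {y : ℝ} (h1 : W.pl i ≤ y) (h2 : y ≤ W.ph i) :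
    0 ≤ W.Y i y ∧ W.Y i y ≤ 1 := by
  have h3 := (lo_le_pl (W := W) i).trans h1
  have h4 := h2.trans (ph_le_hi hW i)
  exact inPiece_bounds (hW.h_nonneg h3) (hW.h_le h4) (hW.lo0.trans h3) (h4.trans hW.hi1)
    (inPiece_of_act hW hi h1 h2)

lemma child_L (hW : W.Valid) {i : Br} (hi : W.Act i) :
    (W.child i).L1 = 2 * (1 - W.pl i) + W.Y i (W.pl i) ∧
      (W.child i).L2 = 2 * W.ph i + 1 - W.Y i (W.ph i) := by
  have h1 := (Act.one_le i hi).1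
  unfold L1 L2
  have h2 : (W.child i).lo = W.Y i (W.pl i) := rfl
  have h3 : (W.child i).hi = W.Y i (W.ph i) := rfl
  rw [h2, h3, child_h_Y hW h1, child_h_Y hW h1]
  simp

lemma child_L_of_ne_one (hW : W.Valid) {i : Br} (hi : W.Act i) (h : i.2 ≠ 1) :
    1 ≤ (W.child i).L1 ∧ 1 ≤ (W.child i).L2 := by
  obtain ⟨h1, h2⟩ := child_L hW hi
  have h3 := pl_mem hW i
  have h4 := ph_mem hW i
  have h5 := inPiece_of_act hW hi le_rfl (pl_le_ph hW i)
  have h6 := inPiece_of_act hW hi (pl_le_ph hW i) le_rfl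
  rw [h1, h2]
  exact ⟨(inPiece_corner (hW.h_nonneg h3.1) (hW.lo0.trans h3.1)
      (h3.2.trans hW.hi1) h5 h).1,
    (inPiece_corner (hW.h_nonneg h4.1) (hW.lo0.trans h4.1)
      (h4.2.trans hW.hi1) h6 h).2⟩

lemma child_L_A0 (hW : W.Valid) (hi : W.Act (false, 1)) :
    2 ≤ (W.child (false, 1)).L1 ∧ 2 / 5 * W.L1 ≤ (W.child (false, 1)).L2 := by
  obtain ⟨h1, h2⟩ := child_L hW hi
  have h3 := pl_mem hW (false, 1)
  have h4 := ph_mem hW (false, 1)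
  have h6 := inPiece_of_act hW hi (pl_le_ph hW _) le_rfl
  have h7 := L1_le hW h4.1
  have h8 := hW.h_nonneg h3.1
  rw [h1, h2]
  simp only [InPiece, Y, jj] at *
  push_cast
  constructor <;> linarith

lemma child_L_B0 (hW : W.Valid) (hi : W.Act (true, 1)) :
    2 ≤ (W.child (true, 1)).L2 ∧ 2 / 5 * W.L2 ≤ (W.child (true, 1)).L1 := by
  have h1 := child_L_A0 hW.flip (Act.flip hW hi)
  have h2 := child_flip hW hi
  simp only [fl, Bool.not_true] at h2
  rwa [h2, flip_L1, flip_L2, flip_L1] at h1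

lemma child_valid (hW : W.Valid) {i : Br} (hi : W.Act i) : (W.child i).Valid := by
  have h1 := (Act.one_le i hi).1
  have hl := lam_pos hW h1
  have hk : (1:ℝ) ≤ i.2 := by exact_mod_cast h1
  have hle := pl_le_ph hW i
  have hlo : (W.child i).lo = W.Y i (W.pl i) := rfl
  have hhi : (W.child i).hi = W.Y i (W.ph i) := rfl
  have hL : 0 < (W.child i).L1 ∧ 0 < (W.child i).L2 := by
    have p1 := hW.L1pos
    have p2 := hW.L2pos
    by_cases h : i.2 = 1
    · obtain ⟨b, k⟩ := i
      obtain rfl : k = 1 := h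
      cases b
      · have := child_L_A0 hW hi
        constructor <;> linarith
      · have := child_L_B0 hW hi
        constructor <;> linarith
    · have := child_L_of_ne_one hW hi h
      constructor <;> linarith
  refine ⟨?_, ?_, ?_, ?_, ?_, ?_, ?_, hL.1, hL.2⟩
  · exact (one_div_pos.2 hl).le
  · have := two_k_le_lam hW i
    change 1 / W.lam i ≤ 1 / 2
    apply one_div_le_one_div_of_le <;> linarith
  · have := Y_sub (W := W) i (W.pl i) (W.ph i)
    have h2 : 0 < W.ph i - W.pl i := sub_pos.2 hi
    have := mul_pos hl h2
    rw [hlo, hhi]; linarith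
  · exact (Y_bounds hW hi le_rfl hle).1
  · exact (Y_bounds hW hi hle le_rfl).2
  · rw [hlo, child_h_Y hW h1]; exact hW.lo0.trans (pl_mem hW i).1
  · rw [hhi, child_h_Y hW h1]; exact (ph_mem hW i).2.trans hW.hi1

lemma child_len (i : Br) : (W.child i).len = W.lam i * W.plen i := by
  rw [plen, ← Y_sub]; rfl

lemma Act.plen_pos {i : Br} (hi : W.Act i) : 0 < W.plen i := sub_pos.2 hi

lemma plen_nonneg (hW : W.Valid) (i : Br) : 0 ≤ W.plen i := sub_nonneg.2 (pl_le_ph hW i)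

lemma plen_le_len (hW : W.Valid) (i : Br) : W.plen i ≤ W.len :=
  sub_le_sub (ph_le_hi hW i) (lo_le_pl (W := W) i)

lemma eps_mul_le_aux (hW : W.Valid) {k : ℕ} (hi : W.Act (false, k + 3)) :
    ((k : ℝ) + 3) * W.L1 ≤ 15 / 2 := by
  have h4 := pl_mem hW (false, k + 3)
  obtain ⟨h5, h6, h7⟩ := inPiece_of_act hW hi le_rfl (pl_le_ph hW _)
  have h8 := L1_le hW h4.1
  have h9 := hW.h_nonneg h4.1
  have h10 : (0:ℝ) ≤ k := by positivity
  have h11 : W.L1 ≤ 5 * W.pl (false, k + 3) := by linarith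
  have h12 := hW.L1pos
  nlinarith

lemma eps_mul_le (hW : W.Valid) : ∀ {i : Br}, W.Act i → (i.2 : ℝ) * W.eps ≤ 15 / 2
  | (b, 0), hi => absurd (Act.one_le _ hi).1 (by simp)
  | (b, 1), _ => by have := eps_le hW; push_cast; linarith
  | (b, 2), _ => by have := eps_le hW; push_cast; linarith
  | (false, k + 3), hi => by
      have := eps_mul_le_aux hW hi
      have h2 : W.eps ≤ W.L1 := min_le_left _ _
      push_cast; nlinarith
  | (true, k + 3), hi => by
      have h3 := eps_mul_le_aux hW.flip (Act.flip hW hi)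
      rw [flip_L1] at h3
      have h2 : W.eps ≤ W.L2 := min_le_right _ _
      push_cast; nlinarith

lemma plen_le_aux (hW : W.Valid) {k : ℕ} (hi : W.Act (false, k + 3)) :
    ((k : ℝ) + 3) ^ 2 * W.plen (false, k + 3) ≤ 3 / 2 := by
  have h1 := Y_sub (W := W) (false, k + 3) (W.pl (false, k + 3)) (W.ph (false, k + 3))
  have h2 := (Y_bounds hW hi le_rfl (pl_le_ph hW _)).1
  have h4 := ph_mem hW (false, k + 3)
  obtain ⟨h5, h6, h7⟩ := inPiece_of_act hW hi (pl_le_ph hW _) le_rfl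
  have h8 := two_k_le_lam hW (false, k + 3)
  have h9 := hi.plen_pos
  have h11 := hW.h_nonneg h4.1
  have h10 : (0:ℝ) ≤ k := by positivity
  change _ = _ * W.plen _ at h1
  simp only [Y, jj] at h1 h2
  push_cast at h1 h2 h8
  have h12 : 2 * ((k:ℝ) + 3) * W.plen (false, k+3) ≤ 2 * W.ph (false, k+3) := by nlinarith
  have h13 : ((k:ℝ) + 2) * W.ph (false, k+3) ≤ 1 := by nlinarith
  have h14 : ((k:ℝ) + 2) * (((k:ℝ) + 3) * W.plen (false, k+3)) ≤ 1 := by nlinarith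
  have h15 : 0 ≤ ((k:ℝ) + 3) * W.plen (false, k+3) := by positivity
  nlinarith

lemma plen_le (hW : W.Valid) : ∀ {i : Br}, W.Act i → (i.2 : ℝ) ^ 2 * W.plen i ≤ 3 / 2
  | (b, 0), hi => absurd (Act.one_le _ hi).1 (by simp)
  | (false, k + 3), hi => by
      have := plen_le_aux hW hi
      push_cast; exact this
  | (true, k + 3), hi => by
      have h3 := plen_le_aux hW.flip (Act.flip hW hi)
      have h4 := plen_flip hW hi
      simp only [fl, Bool.not_true] at h4
      rw [h4] at h3
      push_cast; exact h3
  | (b, 1), hi => by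
      have h1 := len_le (child_valid hW hi)
      have h2 := two_k_le_lam hW (b, 1)
      have h3 := hi.plen_pos
      rw [child_len] at h1
      push_cast at *
      nlinarith
  | (b, 2), hi => by
      have h1 := len_le (child_valid hW hi)
      have h2 := two_k_le_lam hW (b, 2)
      have h3 := hi.plen_pos
      rw [child_len] at h1
      push_cast at *
      nlinarith

end Seg

/-- The branches with half return time less than `n`. -/
def T (n : ℕ) : Finset Br := Finset.univ ×ˢ Finset.range n

namespace Seg
variable {W : Seg}

lemma exists_ee (hW : W.Valid) : ∃ K, ∀ n ≥ K, W.ee n = W.cl (W.dd 1) := by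
  have hpos : 0 < max W.lo (W.dd 1) := by
    rcases hW.lo0.lt_or_eq with h | h
    · exact lt_max_of_lt_left h
    · apply lt_max_of_lt_right
      have h1 := hW.L1pos
      have h2 := hW.s0
      simp only [L1, Seg.h, ← h] at h1
      unfold dd
      apply div_pos <;> push_cast <;> linarith
  obtain ⟨K, hK⟩ := exists_nat_gt ((2 - W.a) / max W.lo (W.dd 1))
  refine ⟨K + 1, fun n hn => ?_⟩
  have h3 : W.cc n ≤ max W.lo (W.dd 1) := by
    have h4 : (K:ℝ) + 1 ≤ n := by exact_mod_cast hn
    have h5 := hW.s0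
    have h6 : (0:ℝ) ≤ K := by positivity
    rw [div_lt_iff₀ hpos] at hK
    unfold cc
    rw [div_le_iff₀ (by linarith)]
    nlinarith
  have := hW.lt
  unfold ee cl
  grind

lemma exists_ff (hW : W.Valid) : ∃ K, ∀ n ≥ K, W.ff n = W.cl (W.cc 1) := by
  obtain ⟨K, hK⟩ := exists_ee hW.flip
  refine ⟨K + 1, fun n hn => ?_⟩
  have h1 := hK n (by omega)
  rw [ee_flip hW (by omega), dd, ← dd, cc_eq_flip hW le_rfl, cl_flip hW] at h1
  linarith

lemma exists_telescope (hW : W.Valid) : ∃ K, ∀ n ≥ K, ∀ Φ : ℝ → ℝ,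
    ∑ i ∈ T n, (Φ (W.ph i) - Φ (W.pl i)) = Φ W.hi - Φ W.lo := by
  obtain ⟨K1, hK1⟩ := exists_ee hW
  obtain ⟨K2, hK2⟩ := exists_ff hW
  refine ⟨K1 + K2 + 3, fun n hn Φ => ?_⟩
  obtain ⟨m, rfl⟩ : ∃ m, n = m + 3 := ⟨n - 3, by omega⟩
  have hA : ∀ m, ∑ k ∈ Finset.range m, (Φ (W.ph (false, k + 3)) - Φ (W.pl (false, k + 3))) =
      Φ (W.ee 2) - Φ (W.ee (m + 2)) := by
    intro m
    induction m with
    | zero => simp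
    | succ m ih => rw [Finset.sum_range_succ, ih]; simp only [ph, pl]; ring_nf
  have hB : ∀ m, ∑ k ∈ Finset.range m, (Φ (W.ph (true, k + 3)) - Φ (W.pl (true, k + 3))) =
      Φ (W.ff (m + 2)) - Φ (W.ff 2) := by
    intro m
    induction m with
    | zero => simp
    | succ m ih => rw [Finset.sum_range_succ, ih]; simp only [ph, pl]; ring_nf
  rw [T, Finset.sum_product]
  simp only [Fintype.sum_bool, Finset.sum_range_succ' _ (m+2), Finset.sum_range_succ' _ (m+1),
    Finset.sum_range_succ' _ m, add_assoc, Nat.reduceAdd]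
  rw [hA, hB, hK1 (m+2) (by omega), hK2 (m+2) (by omega)]
  simp only [ph, pl]
  ring

lemma mem_T {n : ℕ} {i : Br} : i ∈ T n ↔ i.2 < n := by simp [T]

end Seg
end LTM

namespace LTM
namespace Seg
variable {W : Seg}

open Classical in
/-- The nonempty pieces with half return time less than `n`. -/
def act (W : Seg) (n : ℕ) : Finset Br := (T n).filter W.Act

lemma mem_act {n : ℕ} {i : Br} : i ∈ W.act n ↔ i.2 < n ∧ W.Act i := by
  simp [act, mem_T]

lemma sum_act_flip (hW : W.Valid) (n : ℕ) (f : Br → ℝ) :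
    ∑ i ∈ W.flip.act n, f i = ∑ i ∈ W.act n, f (fl i) := by
  refine Finset.sum_nbij' fl fl ?_ ?_ ?_ ?_ ?_
  · intro i hi
    rw [mem_act] at *
    rw [fl_snd]
    have := Act.flip hW.flip hi.2
    rw [flip_flip] at this
    exact ⟨hi.1, this⟩
  · intro i hi
    rw [mem_act] at *
    rw [fl_snd]
    exact ⟨hi.1, Act.flip hW hi.2⟩
  · intro i _; exact fl_fl i
  · intro i _; exact fl_fl i
  · intro i _; rw [fl_fl]

lemma exists_telescope_act (hW : W.Valid) : ∃ K, ∀ n ≥ K, ∀ Φ : ℝ → ℝ,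
    ∑ i ∈ W.act n, (Φ (W.ph i) - Φ (W.pl i)) = Φ W.hi - Φ W.lo := by
  obtain ⟨K, hK⟩ := exists_telescope hW
  refine ⟨K, fun n hn Φ => ?_⟩
  rw [← hK n hn Φ, act, Finset.sum_filter]
  refine Finset.sum_congr rfl fun i _ => ?_
  split_ifs with h
  · rfl
  · rw [le_antisymm (pl_le_ph hW i) (not_lt.1 h), sub_self]

lemma chi_le_of {c : ℝ} (hc : 0 < c) (h : c ≤ W.eps) : W.chi ≤ 1 + (1 / 10) / √c := by
  unfold chi
  gcongr

lemma child_chi_le (hW : W.Valid) {i : Br} (hi : W.Act i) (h : i.2 ≠ 1) :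
    (W.child i).chi ≤ 11 / 10 := by
  have := child_L_of_ne_one hW hi h
  have := chi_le_of (W := W.child i) one_pos (le_min this.1 this.2)
  rw [Real.sqrt_one] at this
  linarith

lemma chi_aux {c d : ℝ} (hc : 0 < c) (hd : 2 / 5 * c ≤ d) : 1 / √d ≤ (15812 / 10000) * (1 / √c) := by
  have hd0 : 0 < d := by linarith
  have h1 : √c ≤ (15812 / 10000) * √d := by
    rw [Real.sqrt_le_left (by positivity), mul_pow, Real.sq_sqrt hd0.le]
    norm_num; linarith
  have h2 := Real.sqrt_pos.2 hc
  have h3 := Real.sqrt_pos.2 hd0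
  rw [← mul_div_assoc, mul_one, div_le_div_iff₀ h3 h2]
  linarith

lemma child_eps (hW : W.Valid) {i : Br} (hi : W.Act i) : 2 / 5 * W.eps ≤ (W.child i).eps := by
  have h0 := eps_le hW
  have h1 : W.eps ≤ W.L1 := min_le_left _ _
  have h2 : W.eps ≤ W.L2 := min_le_right _ _
  by_cases h : i.2 = 1
  · obtain ⟨b, k⟩ := i
    obtain rfl : k = 1 := h
    cases b
    · have := child_L_A0 hW hi
      apply le_min <;> linarith
    · have := child_L_B0 hW hi
      apply le_min <;> linarith
  · have := child_L_of_ne_one hW hi h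
    apply le_min <;> linarith

lemma child_chi_le' (hW : W.Valid) {i : Br} (hi : W.Act i) : (W.child i).chi ≤ 8 / 5 * W.chi := by
  have h1 := chi_aux (eps_pos hW) (child_eps hW hi)
  have h2 : 0 < 1 / √W.eps := by have := Real.sqrt_pos.2 (eps_pos hW); positivity
  unfold chi
  rw [div_eq_mul_one_div _ √(W.child i).eps, div_eq_mul_one_div _ √W.eps]
  linarith

lemma L1_le_three (hW : W.Valid) : W.L1 ≤ 3 := by
  have := hW.h0; have := hW.hi1; have := hW.lt
  unfold L1; linarith

lemma child_chi_A0 (hW : W.Valid) (hi : W.Act (false, 1)) :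
    (W.child (false, 1)).chi ≤ 1 + (15812 / 100000) * (1 / √W.L1) := by
  have h1 := child_L_A0 hW hi
  have h0 := L1_le_three hW
  have h2 : 2 / 5 * W.L1 ≤ (W.child (false, 1)).eps := by
    apply le_min <;> linarith
  have h3 := chi_aux hW.L1pos h2
  unfold chi
  rw [div_eq_mul_one_div]
  linarith

lemma child_chi_B0 (hW : W.Valid) (hi : W.Act (true, 1)) :
    (W.child (true, 1)).chi ≤ 1 + (15812 / 100000) * (1 / √W.L2) := by
  have h1 := child_chi_A0 hW.flip (Act.flip hW hi)
  have h2 := child_flip hW hi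
  simp only [fl, Bool.not_true] at h2
  rwa [h2, flip_L1, flip_chi] at h1

lemma sqrt_k_le (hW : W.Valid) {i : Br} (hi : W.Act i) : √(i.2 : ℝ) ≤ 28 * W.chi := by
  have h1 := eps_mul_le hW hi
  have h2 := eps_pos hW
  have h3 : √(i.2 : ℝ) * √W.eps ≤ 28 / 10 := by
    rw [← Real.sqrt_mul (by positivity), Real.sqrt_le_left (by norm_num)]
    linarith
  have h4 := Real.sqrt_pos.2 h2
  have h5 : √(i.2 : ℝ) ≤ 28 * ((1 / 10) / √W.eps) := by
    rw [mul_div_assoc', le_div_iff₀ h4]; linarith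
  unfold chi
  linarith

/-- The segment crosses the central piece. -/
def FullC (W : Seg) : Prop := W.lo ≤ W.cc 2 ∧ W.dd 2 ≤ W.hi

def FullA (W : Seg) (k : ℕ) : Prop := W.lo ≤ W.cc k ∧ W.dd 1 ≤ W.cc k ∧ W.cc (k - 1) ≤ W.hi

lemma lo_le_cc_two (hW : W.Valid) : ∀ {k : ℕ}, k ≠ 2 → W.Act (false, k) → W.lo ≤ W.cc 2
  | 0, _, hi => absurd hi (lt_irrefl _)
  | 1, _, hi => by
      have h1 := inPiece_of_act hW hi le_rfl (pl_le_ph hW _)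
      simp only [InPiece, pl] at h1
      have := hW.h0
      rw [le_cc_iff hW (by norm_num)]
      push_cast; linarith
  | 2, h, _ => absurd rfl h
  | k + 3, _, hi => by
      have h1 := inPiece_of_act hW hi le_rfl (pl_le_ph hW _)
      simp only [InPiece] at h1
      have h2 := pl_mem hW (false, k + 3)
      have : 0 ≤ (k:ℝ) * W.pl (false, k+3) := mul_nonneg (by positivity) (hW.lo0.trans h2.1)
      refine h2.1.trans ?_
      rw [le_cc_iff hW (by norm_num)]
      push_cast; linarith

lemma fullC_of_act (hW : W.Valid) {k l : ℕ} (hk : k ≠ 2) (hi : W.Act (false, k))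
    (hj : W.Act (true, l)) : W.FullC := by
  refine ⟨lo_le_cc_two hW hk hi, ?_⟩
  have hl : l ≠ 2 := by rintro rfl; exact (Act.one_le _ hj).2 rfl
  have h1 := Act.flip hW hj
  have h2 : fl (true, l) = (false, l) := by
    rcases l with _ | _ | _ | l <;> simp_all [fl]
  rw [h2] at h1
  have := lo_le_cc_two hW.flip hl h1
  rw [dd_eq_flip hW (by norm_num)] at this
  simp only [Seg.flip] at this
  linarith

lemma fullA_of_act (hW : W.Valid) {k l : ℕ} (hl : 2 ≤ l) (hkl : l + 2 ≤ k)
    (hi : W.Act (false, k)) (hj : W.Act (false, l)) : W.FullA (l + 1) := by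
  obtain ⟨m, rfl⟩ : ∃ m, k = m + 3 := ⟨k - 3, by omega⟩
  have hml : (l:ℝ) ≤ m + 1 := by exact_mod_cast (by omega : l ≤ m + 1)
  obtain ⟨h1, h2, h3⟩ := inPiece_of_act hW hi (pl_le_ph hW _) le_rfl
  have h4 := ph_mem hW (false, m + 3)
  have h6 : W.ph (false, m + 3) ≤ W.cc (l + 1) := by
    rw [le_cc_iff hW (by omega)]
    push_cast
    have := hW.lo0.trans h4.1
    nlinarith
  refine ⟨h4.1.trans h6, le_trans ?_ h6, ?_⟩
  · rw [dd_le_iff hW le_rfl]; push_cast; linarith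
  · have h5 := ph_mem hW (false, l)
    refine le_trans ?_ h5.2
    have h7 := inPiece_of_act hW hj (pl_le_ph hW _) le_rfl
    rw [Nat.add_sub_cancel, cc_le_iff hW (by omega)]
    rcases l with _ | _ | _ | l
    · omega
    · omega
    · have := h7.2.2.1
      push_cast; linarith
    · have := h7.2.2
      push_cast; linarith

lemma FullA.len_ge (hW : W.Valid) {k : ℕ} (hk : 3 ≤ k) (h : W.FullA k) :
    1 / (3 * (k:ℝ) ^ 2) ≤ W.len := by
  obtain ⟨h1, h2, h3⟩ := h
  have h4 : W.cc (k - 1) - W.cc k ≤ W.len := by unfold len; linarith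
  refine le_trans ?_ h4
  have hk' : (3:ℝ) ≤ k := by exact_mod_cast hk
  have h0 := hW.s0; have h1 := hW.s1; have h2 := hW.a_le
  unfold cc
  rw [Nat.cast_sub (by omega), Nat.cast_one, div_sub_div _ _ (by linarith) (by linarith),
    div_le_div_iff₀ (by positivity) (by apply mul_pos <;> linarith)]
  nlinarith [mul_nonneg h0 (by linarith : (0:ℝ) ≤ k), mul_nonneg (by linarith : (0:ℝ) ≤ k) (by linarith : 0 ≤ 1 - W.a),
    mul_nonneg (sq_nonneg (k:ℝ)) (by linarith : 0 ≤ 1 - W.a)]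

lemma FullC.len_ge (hW : W.Valid) (h : W.FullC) : 1 / 5 ≤ W.len := by
  obtain ⟨h1, h2⟩ := h
  have h4 : W.dd 2 - W.cc 2 ≤ W.len := by unfold len; linarith
  refine le_trans ?_ h4
  have h0 := hW.s0; have h1 := hW.s1
  unfold cc dd
  rw [← sub_div]
  push_cast
  rw [div_le_div_iff₀ (by norm_num) (by linarith)]
  linarith

/-- If the central piece is not crossed and there is no branch on the right, then either some
piece is crossed near the top, or there are at most three pieces. -/
lemma act_subset_or (hW : W.Valid) (hC : ∀ l, ¬ W.Act (true, l)) :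
    ∃ k, 2 ≤ k ∧ ((∀ i, W.Act i → i = (false, 1) ∨ i = (false, k) ∨ i = (false, k + 1)) ∨
      (W.Act (false, k) ∧ W.FullA (k + 1) ∧ (∃ l, k + 2 ≤ l ∧ W.Act (false, l)) ∧
        ∀ i, W.Act i → i ≠ (false, k) → i = (false, 1) ∨ (∃ l, k + 1 ≤ l ∧ i = (false, l)))) := by
  classical
  by_cases hex : ∃ k, 2 ≤ k ∧ W.Act (false, k)
  · have h1 := Nat.find_spec hex
    have h2 := fun m => @Nat.find_min' _ _ hex m
    set k := Nat.find hex
    refine ⟨k, h1.1, ?_⟩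
    by_cases h3 : ∃ l, k + 2 ≤ l ∧ W.Act (false, l)
    · right
      obtain ⟨l, hl, hl2⟩ := h3
      refine ⟨h1.2, fullA_of_act hW h1.1 hl hl2 h1.2, ⟨l, hl, hl2⟩, ?_⟩
      rintro ⟨b, m⟩ hi hne
      cases b
      · have := (Act.one_le _ hi).1
        rcases eq_or_ne m 1 with rfl | h
        · exact Or.inl rfl
        · refine Or.inr ⟨m, ?_, rfl⟩
          have h4 := h2 m ⟨by simp at this; omega, hi⟩
          have : m ≠ k := by rintro rfl; exact hne rfl
          omega
      · exact absurd hi (hC m)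
    · left
      push Not at h3
      rintro ⟨b, m⟩ hi
      cases b
      · have := (Act.one_le _ hi).1
        rcases eq_or_ne m 1 with rfl | h
        · exact Or.inl rfl
        · have h4 := h2 m ⟨by simp at this; omega, hi⟩
          have h5 : ¬ (k + 2 ≤ m) := fun h => h3 m h hi
          have : m = k ∨ m = k + 1 := by omega
          rcases this with h | h <;> simp [h]
      · exact absurd hi (hC m)
  · push Not at hex
    refine ⟨2, le_rfl, Or.inl ?_⟩
    rintro ⟨b, m⟩ hi
    cases b
    · have := (Act.one_le _ hi).1
      rcases eq_or_ne m 1 with rfl | h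
      · exact Or.inl rfl
      · exact absurd hi (hex m (by simp at this; omega))
    · exact absurd hi (hC m)

/-- Sum over the nonempty pieces, when there are at most three of them. -/
lemma sum_act_le_three {k n : ℕ} (hk : 2 ≤ k) (f : Br → ℝ) (g : Br → ℝ)
    (hg : ∀ i, 0 ≤ g i) (hfg : ∀ i, W.Act i → f i ≤ g i)
    (h : ∀ i, W.Act i → i = (false, 1) ∨ i = (false, k) ∨ i = (false, k + 1)) :
    ∑ i ∈ W.act n, f i ≤ g (false, 1) + g (false, k) + g (false, k + 1) := by
  calc ∑ i ∈ W.act n, f i ≤ ∑ i ∈ W.act n, g i :=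
        Finset.sum_le_sum fun i hi => hfg i (mem_act.1 hi).2
    _ ≤ ∑ i ∈ ({(false, 1), (false, k), (false, k + 1)} : Finset Br), g i := by
        refine Finset.sum_le_sum_of_subset_of_nonneg ?_ fun i _ _ => hg i
        intro i hi
        simpa using h i (mem_act.1 hi).2
    _ = _ := by
        rw [Finset.sum_insert, Finset.sum_insert, Finset.sum_singleton, add_assoc]
        · simp
        · simp; omega

lemma FullA.plen (hW : W.Valid) {k : ℕ} (hk : 2 ≤ k) (h : W.FullA (k + 1)) :
    W.lam (false, k + 1) * W.plen (false, k + 1) = 2 * W.cc k ∧ W.Act (false, k + 1) := by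
  obtain ⟨m, rfl⟩ : ∃ m, k = m + 2 := ⟨k - 2, by omega⟩
  obtain ⟨h1, h2, h3⟩ := h
  rw [Nat.add_sub_cancel] at h3
  have h4 := cc_anti hW (k := m + 2) (l := m + 3) (by omega) (by omega)
  have e1 : W.ee (m + 3) = W.cc (m + 3) := by
    unfold ee; rw [max_eq_left h2]; unfold cl; rw [min_eq_right (h4.trans h3), max_eq_right h1]
  have e2 : W.ee (m + 2) = W.cc (m + 2) := by
    unfold ee; rw [max_eq_left (h2.trans h4)]; unfold cl
    rw [min_eq_right h3, max_eq_right (h1.trans h4)]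
  have h0 := hW.s0; have h5 := hW.a_le
  have hm : (0:ℝ) ≤ m := by positivity
  have key : W.lam (false, m + 2 + 1) * W.plen (false, m + 2 + 1) = 2 * W.cc (m + 2) := by
    unfold Seg.plen
    simp only [pl, ph, e1, e2, cc, lam]
    push_cast
    have : 2 * ((m:ℝ) + 3) + W.s ≠ 0 := by linarith
    have : 2 * ((m:ℝ) + 2) + W.s ≠ 0 := by linarith
    field_simp
    ring
  refine ⟨key, ?_⟩
  have hpos : 0 < W.cc (m + 2) := by
    unfold cc; apply div_pos
    · linarith
    · push_cast; linarith
  have hl := lam_pos hW (i := (false, m + 2 + 1)) (by simp)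
  have : 0 < W.plen (false, m + 2 + 1) := by
    by_contra hn
    have := mul_nonpos_of_nonneg_of_nonpos hl.le (not_lt.1 hn)
    linarith
  exact sub_pos.1 this

lemma sum_plen (hW : W.Valid) : ∃ K, ∀ n ≥ K, ∑ i ∈ W.act n, W.plen i = W.len := by
  obtain ⟨K, hK⟩ := exists_telescope_act hW
  exact ⟨K, fun n hn => hK n hn id⟩

lemma growth_aux (hW : W.Valid) (hC : ∀ l, ¬ W.Act (true, l)) :
    ∃ i, W.Act i ∧ 12 / 11 * W.len ≤ (W.child i).len := by
  by_contra hcon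
  push Not at hcon
  simp only [child_len] at hcon
  have hlen := len_pos hW
  have hb : ∀ i, W.Act i → (i.2:ℝ) * W.plen i ≤ 6 / 11 * W.len := by
    intro i hi
    have h1 := hcon i hi
    have h2 := two_k_le_lam hW i
    have := hi.plen_pos
    nlinarith
  obtain ⟨k, hk, h | ⟨h1, h2, -, h3⟩⟩ := act_subset_or hW hC
  · obtain ⟨K, hK⟩ := sum_plen hW
    have h9 := sum_act_le_three (n := K) hk W.plen W.plen (plen_nonneg hW)
      (fun _ _ => le_rfl) h
    rw [hK K le_rfl] at h9
    have hk' : (2:ℝ) ≤ k := by exact_mod_cast hk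
    have q : ∀ i : Br, W.plen i * (2 * i.2) < 12 / 11 * W.len := by
      intro i
      by_cases hi : W.Act i
      · have h1 := hcon i hi
        have h2 := two_k_le_lam hW i
        have := hi.plen_pos
        nlinarith
      · have : W.plen i ≤ 0 := sub_nonpos.2 (not_lt.1 hi)
        rw [le_antisymm this (plen_nonneg hW i)]; linarith
    have q1 := q (false, 1)
    have q2 := q (false, k)
    have q3 := q (false, k + 1)
    have n2 := plen_nonneg hW (false, k)
    have n3 := plen_nonneg hW (false, k + 1)
    push_cast at q1 q2 q3
    nlinarith
  · obtain ⟨h4, h5⟩ := h2.plen hW hk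
    have h6 := hcon _ h5
    have h7 := hb _ h1
    rw [h4] at h6
    obtain ⟨K, hK⟩ := exists_telescope_act hW
    obtain ⟨h8, h9, h10⟩ := h2
    rw [Nat.add_sub_cancel] at h10
    have h11 := cc_anti hW (k := k) (l := k + 1) (by omega) (by omega)
    have h12 : W.hi - W.cc k ≤ W.plen (false, k) := by
      have h13 := hK (K + k + 1) (by omega) (fun y => max y (W.cc k))
      rw [max_eq_left h10, max_eq_right (h8.trans h11)] at h13
      rw [← h13, Finset.sum_eq_single (false, k)]
      · have := pl_le_ph hW (false, k)
        unfold Seg.plen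
        rcases max_cases (W.ph (false, k)) (W.cc k) with h | h <;>
        rcases max_cases (W.pl (false, k)) (W.cc k) with h' | h' <;> linarith
      · intro i hi hne
        have hi := (mem_act.1 hi).2
        have h14 : W.ph i ≤ W.cc k := by
          have h15 := inPiece_of_act hW hi (pl_le_ph hW _) le_rfl
          rcases h3 i hi hne with rfl | ⟨l, hl, rfl⟩
          · refine le_trans ?_ (h9.trans h11)
            simp only [InPiece] at h15
            rw [le_dd_iff hW le_rfl]
            push_cast; linarith
          · obtain ⟨m, rfl⟩ : ∃ m, l = m + 3 := ⟨l - 3, by omega⟩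
            rw [le_cc_iff hW (by omega)]
            have h16 := h15.2.1
            have hml : (k:ℝ) ≤ m + 2 := by exact_mod_cast (by omega : k ≤ m + 2)
            have := hW.lo0.trans (ph_mem hW (false, m + 3)).1
            nlinarith
        rw [max_eq_right h14, max_eq_right ((pl_le_ph hW i).trans h14), sub_self]
      · intro h
        exact absurd (mem_act.2 ⟨by simp, h1⟩) h
    have := hW.lo0
    have hk' : (2:ℝ) ≤ k := by exact_mod_cast hk
    have := h1.plen_pos
    have h20 : W.len = W.hi - W.lo := rfl
    push_cast at h7
    nlinarith

lemma no_side_of_not_fullC (hW : W.Valid) (hC : ¬ W.FullC) :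
    (∀ l, ¬ W.Act (true, l)) ∨ (∀ l, ¬ W.flip.Act (true, l)) := by
  by_contra hcon
  push Not at hcon
  obtain ⟨⟨l, hl⟩, ⟨k, hk⟩⟩ := hcon
  have h1 := Act.flip hW.flip hk
  rw [flip_flip] at h1
  have hl2 : k ≠ 2 := by rintro rfl; exact (Act.one_le _ hk).2 rfl
  have h2 : fl (true, k) = (false, k) := by
    rcases k with _ | _ | _ | l <;> simp_all [fl]
  rw [h2] at h1
  exact hC (fullC_of_act hW hl2 h1 hl)

/-- A segment that does not cross the central piece has a piece whose image is longer. -/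
lemma growth (hW : W.Valid) (hC : ¬ W.FullC) :
    ∃ i, W.Act i ∧ 12 / 11 * W.len ≤ (W.child i).len := by
  rcases no_side_of_not_fullC hW hC with h | h
  · exact growth_aux hW h
  · obtain ⟨i, hi, hl⟩ := growth_aux hW.flip h
    have h1 := Act.flip hW.flip hi
    have h2 := child_flip hW.flip hi
    rw [flip_flip] at h1 h2
    refine ⟨fl i, h1, ?_⟩
    rw [h2, flip_len]
    rwa [flip_len] at hl

end Seg
end LTM

namespace LTM
namespace Seg
variable {W : Seg}

lemma child_ratio_le (hW : W.Valid) {i : Br} (hi : W.Act i) {c : ℝ} (hc : 0 ≤ c)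
    (h : (W.child i).chi ≤ c) : (W.child i).chi / W.lam i ≤ c / (2 * i.2) := by
  have h1 := (Act.one_le i hi).1
  have h2 : (1:ℝ) ≤ i.2 := by exact_mod_cast h1
  exact div_le_div₀ hc h (by linarith) (two_k_le_lam hW i)

/-- The total expansion deficit of all pieces, up to a logarithmic term. -/
lemma sum_ratio_le (hW : W.Valid) (n : ℕ) :
    ∑ i ∈ W.act n, (W.child i).chi / W.lam i ≤
      21 / 10 + 79061 / 1000000 * (1 / √W.L1) + 79061 / 1000000 * (1 / √W.L2) +
        11 / 10 * Real.log (15 / 2 / W.eps) := by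
  have heps := eps_pos hW
  set N := ⌊15 / 2 / W.eps⌋₊ with hN
  have p1 : 0 ≤ 1 / √W.L1 := by positivity
  have p2 : 0 ≤ 1 / √W.L2 := by positivity
  calc ∑ i ∈ W.act n, (W.child i).chi / W.lam i
      ≤ ∑ i ∈ W.act n, ((if (false, 1) = i then 1 / 2 + 79061 / 1000000 * (1 / √W.L1) else 0) +
          (if (true, 1) = i then 1 / 2 + 79061 / 1000000 * (1 / √W.L2) else 0) +
            11 / 20 * (i.2 : ℝ)⁻¹ - (if (i.2 : ℕ) = 1 then 11 / 20 else 0)) := by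
        refine Finset.sum_le_sum fun i hi => ?_
        have hi := (mem_act.1 hi).2
        by_cases h : i.2 = 1
        · obtain ⟨b, k⟩ := i
          obtain rfl : k = 1 := h
          cases b
          · have := child_ratio_le hW hi (by positivity) (child_chi_A0 hW hi)
            have p : 0 ≤ (√W.L1)⁻¹ := by positivity
            simp at this ⊢
            linarith
          · have := child_ratio_le hW hi (by positivity) (child_chi_B0 hW hi)
            have p : 0 ≤ (√W.L2)⁻¹ := by positivity
            simp at this ⊢
            linarith
        · have := child_ratio_le hW hi (by positivity) (child_chi_le hW hi h)
          rw [if_neg (by rintro rfl; exact h rfl), if_neg (by rintro rfl; exact h rfl), if_neg h]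
          refine this.trans (le_of_eq ?_)
          have h1 := (Act.one_le i hi).1
          have h2 : (i.2 : ℝ) ≠ 0 := by positivity
          field_simp
          norm_num
    _ ≤ (1 / 2 + 79061 / 1000000 * (1 / √W.L1)) + (1 / 2 + 79061 / 1000000 * (1 / √W.L2)) +
          ∑ i ∈ Finset.univ ×ˢ Finset.Icc 2 N, 11 / 20 * ((i : Br).2 : ℝ)⁻¹ := by
        rw [Finset.sum_congr rfl (fun i _ => add_sub_assoc _ _ _), Finset.sum_add_distrib,
          Finset.sum_add_distrib, Finset.sum_ite_eq, Finset.sum_ite_eq]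
        gcongr
        · split_ifs
          · exact le_rfl
          · positivity
        · split_ifs
          · exact le_rfl
          · positivity
        · calc ∑ i ∈ W.act n, (11 / 20 * (i.2 : ℝ)⁻¹ - (if (i.2 : ℕ) = 1 then 11 / 20 else 0))
              = ∑ i ∈ (W.act n).filter (fun i => i.2 ≠ 1), 11 / 20 * (i.2 : ℝ)⁻¹ := by
                rw [Finset.sum_filter]
                refine Finset.sum_congr rfl fun i _ => ?_
                by_cases h : i.2 = 1 <;> simp [h]
            _ ≤ _ := by
                refine Finset.sum_le_sum_of_subset_of_nonneg ?_ fun i _ _ => by positivity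
                intro i hi
                rw [Finset.mem_filter, mem_act] at hi
                obtain ⟨⟨_, hi⟩, h⟩ := hi
                have h1 := (Act.one_le i hi).1
                have h2 := eps_mul_le hW hi
                simp only [Finset.mem_product, Finset.mem_univ, Finset.mem_Icc, true_and]
                refine ⟨by omega, Nat.le_floor ?_⟩
                rw [le_div_iff₀ heps]; exact h2
    _ ≤ _ := by
        rw [Finset.sum_product]
        simp only [Fintype.sum_bool]
        have h5 : 5 ≤ 15 / 2 / W.eps := by
          rw [le_div_iff₀ heps]; have := eps_le hW; linarith
        have hN1 : 1 ≤ N := Nat.le_floor (by push_cast; linarith)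
        have h1 : ∑ k ∈ Finset.Icc 2 N, (k : ℝ)⁻¹ ≤ Real.log (15 / 2 / W.eps) := by
          have h2 := harmonic_le_one_add_log N
          rw [harmonic_eq_sum_Icc] at h2
          push_cast at h2
          rw [← Finset.add_sum_Ioc_eq_sum_Icc hN1] at h2
          have h3 : Finset.Ioc 1 N = Finset.Icc 2 N := by ext; simp; omega
          rw [h3] at h2
          have h4 : Real.log N ≤ Real.log (15 / 2 / W.eps) :=
            Real.log_le_log (by exact_mod_cast hN1) (Nat.floor_le (by linarith))
          simp at h2
          linarith
        rw [← Finset.mul_sum]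
        linarith

lemma sum_ratio_le' (hW : W.Valid) (n : ℕ) :
    ∑ i ∈ W.act n, (W.child i).chi / W.lam i ≤ 3000 + 83 / 1000 * (1 / √W.eps) := by
  have h1 := sum_ratio_le hW n
  have heps := eps_pos hW
  have hs := Real.sqrt_pos.2 heps
  set v := 1 / √W.eps with hv
  have hvpos : 0 < v := by positivity
  have hv2 : v ^ 2 = 1 / W.eps := by rw [hv, div_pow, Real.sq_sqrt heps.le, one_pow]
  have h2 : 1 / √W.L1 + 1 / √W.L2 ≤ v + 1 := by
    have h3 := two_le_L1_add_L2 hW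
    have key : ∀ a b : ℝ, 0 < a → a ≤ b → 2 ≤ a + b → 1 / √b ≤ 1 := by
      intro a b ha hab h
      have hb : 1 ≤ √b := by rw [Real.one_le_sqrt]; linarith
      exact (div_le_one (by linarith)).2 hb
    rcases le_total W.L1 W.L2 with h | h
    · have := key _ _ hW.L1pos h h3
      rw [hv, eps, min_eq_left h]; linarith
    · have := key _ _ hW.L2pos h (by linarith)
      rw [hv, eps, min_eq_right h]; linarith
  have h3 : Real.log (15 / 2 / W.eps) ≤ 2600 + 1 / 500 * v := by
    have e : 15 / 2 / W.eps = 15 / 2 * (1000 * (v / 1000)) ^ 2 := by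
      rw [mul_div_cancel₀ _ (by norm_num : (1000:ℝ) ≠ 0), hv2]; ring
    have hv3 : 0 < v / 1000 := by positivity
    rw [e, Real.log_mul (by norm_num) (by positivity), Real.log_pow,
      Real.log_mul (by norm_num) hv3.ne']
    have l1 := Real.log_le_sub_one_of_pos (by norm_num : (0:ℝ) < 15 / 2)
    have l2 := Real.log_le_sub_one_of_pos (by norm_num : (0:ℝ) < 1000)
    have l3 := Real.log_le_sub_one_of_pos hv3
    push_cast
    linarith
  linarith

lemma sum_ratio_few_aux (hW : W.Valid) (hC : ∀ l, ¬ W.Act (true, l))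
    (hA : ∀ k l, 3 ≤ k → W.FullA k → W.Act (false, l) → l ≤ k) (n : ℕ) :
    ∑ i ∈ W.act n, (W.child i).chi / W.lam i ≤ 49 / 50 * W.chi := by
  obtain ⟨k, hk, h | ⟨h1, h2, ⟨l, h4, h5⟩, h3⟩⟩ := act_subset_or hW hC
  · have hk' : (2:ℝ) ≤ k := by exact_mod_cast hk
    have p1 : 0 ≤ 1 / √W.L1 := by positivity
    have h6 := sum_act_le_three (n := n) hk (fun i => (W.child i).chi / W.lam i)
      (fun i => if i.2 = 1 then 1 / 2 + 79061 / 1000000 * (1 / √W.L1) else 11 / 20 * (i.2 : ℝ)⁻¹)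
      (fun i => by split_ifs <;> positivity)
      (fun i hi => by
        split_ifs with hi1
        · rcases h i hi with rfl | rfl | rfl
          · have := child_ratio_le hW hi (by positivity) (child_chi_A0 hW hi)
            have p : 0 ≤ (√W.L1)⁻¹ := by positivity
            simp at this ⊢
            linarith
          · simp at hi1; omega
          · simp at hi1; omega
        · have := child_ratio_le hW hi (by positivity) (child_chi_le hW hi hi1)
          refine this.trans (le_of_eq ?_)
          have h1 := (Act.one_le i hi).1
          have h2 : (i.2 : ℝ) ≠ 0 := by positivity
          field_simp
          norm_num) h
    refine h6.trans ?_
    rw [if_pos rfl, if_neg (by simp; omega), if_neg (by simp; omega)]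
    have i1 : (k:ℝ)⁻¹ ≤ 2⁻¹ := by gcongr
    have i2 : (((k+1 : ℕ):ℝ))⁻¹ ≤ 3⁻¹ := by gcongr; push_cast; linarith
    have i3 : 1 / √W.L1 ≤ 1 / √W.eps := by
      have := Real.sqrt_pos.2 (eps_pos hW)
      gcongr
      exact min_le_left _ _
    have i4 : 0 ≤ 1 / √W.eps := by positivity
    simp only [chi]
    rw [div_eq_mul_one_div (1/10) √W.eps]
    linarith
  · have := hA _ _ (by omega) h2 h5
    omega

lemma sum_ratio_flip (hW : W.Valid) (n : ℕ) :
    ∑ i ∈ W.flip.act n, (W.flip.child i).chi / W.flip.lam i =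
      ∑ i ∈ W.act n, (W.child i).chi / W.lam i := by
  rw [sum_act_flip hW]
  refine Finset.sum_congr rfl fun i hi => ?_
  rw [child_flip hW (mem_act.1 hi).2, lam_flip, flip_chi]

/-- Drift of `χ / len` under the return map. -/
lemma exists_drift : ∃ CD : ℝ, 1 ≤ CD ∧ ∀ W : Seg, W.Valid → ∀ n,
    ∑ i ∈ W.act n, (W.child i).chi / W.lam i ≤ 49 / 50 * W.chi + CD * W.len := by
  -- short segments far away from the corners have few pieces
  obtain ⟨ℓ, hℓ, hfew⟩ : ∃ ℓ : ℝ, 0 < ℓ ∧ ∀ W : Seg, W.Valid → 1 / √W.eps ≤ 300000 →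
      W.len < ℓ → ∀ n, ∑ i ∈ W.act n, (W.child i).chi / W.lam i ≤ 49 / 50 * W.chi := by
    obtain ⟨B, hB⟩ := exists_nat_gt ((15 / 2) * (300000:ℝ) ^ 2)
    have hB0 : (0:ℝ) < B := by refine lt_trans ?_ hB; norm_num
    refine ⟨1 / (5 * (B:ℝ) ^ 2), by positivity, ?_⟩
    have hlt : ∀ W : Seg, W.Valid → 1 / √W.eps ≤ 300000 → W.len < 1 / (5 * (B:ℝ) ^ 2) →
        ∀ k l, 3 ≤ k → W.FullA k → W.Act (false, l) → l ≤ k := by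
      intro W hW heps hlen k l h3 hk hl
      by_contra hkl
      push Not at hkl
      have h1 : (l:ℝ) ≤ B := by
        have h2 := eps_mul_le hW hl
        have h3 := eps_pos hW
        have h4 := Real.sqrt_pos.2 h3
        rw [div_le_iff₀ h4] at heps
        have h5 : 1 ≤ (300000:ℝ)^2 * W.eps := by
          rw [← Real.sq_sqrt h3.le, ← mul_pow]; exact one_le_pow₀ heps
        have h6 : (l:ℝ) * 1 ≤ l * ((300000:ℝ)^2 * W.eps) := by gcongr
        dsimp only at h2
        nlinarith
      have h2 := hk.len_ge hW h3
      have h4 : (k:ℝ) ≤ B := by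
        refine le_trans ?_ h1; exact_mod_cast hkl.le
      have h5 : 1 / (5 * (B:ℝ) ^ 2) ≤ 1 / (3 * (k:ℝ) ^ 2) := by
        have : (0:ℝ) < k := by positivity
        apply one_div_le_one_div_of_le (by positivity)
        nlinarith
      linarith
    have hside : ∀ W : Seg, W.Valid → W.len < 1 / (5 * (B:ℝ) ^ 2) → ¬ W.FullC := by
      intro W hW hlen h
      have h1 := h.len_ge hW
      have hB1 : (1:ℝ) ≤ B := by linarith
      have : 1 / (5 * (B:ℝ) ^ 2) ≤ 1 / 5 := by
        apply one_div_le_one_div_of_le (by positivity); nlinarith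
      linarith
    intro W hW heps hlen n
    rcases no_side_of_not_fullC hW (hside W hW hlen) with h | h
    · exact sum_ratio_few_aux hW h (hlt W hW heps hlen) n
    · rw [← sum_ratio_flip hW, ← flip_chi]
      refine sum_ratio_few_aux hW.flip h (hlt _ hW.flip ?_ ?_) n
      · rwa [flip_eps]
      · rwa [flip_len]
  refine ⟨1 + 30000 / ℓ, by have : 0 ≤ 30000 / ℓ := by positivity
                            linarith, fun W hW n => ?_⟩
  have h1 := sum_ratio_le' hW n
  have h2 : W.chi = 1 + 1 / 10 * (1 / √W.eps) := by unfold chi; ring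
  have h3 : 0 ≤ 1 / √W.eps := by positivity
  have h0 := len_pos hW
  have h6 : 0 ≤ 30000 / ℓ * W.len := by positivity
  by_cases h4 : 1 / √W.eps ≤ 300000
  · by_cases h5 : W.len < ℓ
    · have := hfew W hW h4 h5 n
      linarith
    · have : 30000 ≤ 30000 / ℓ * W.len := by
        rw [div_mul_eq_mul_div, le_div_iff₀ hℓ]; push Not at h5; nlinarith
      rw [h2]; linarith
  · push Not at h4
    rw [h2]; linarith

end Seg
end LTM

namespace LTM

/-- The return time of a branch. -/
def tau (i : Br) : ℕ := 2 * i.2 - 1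

lemma tau_le (i : Br) : (tau i : ℝ) ≤ 2 * i.2 := by
  have : tau i ≤ 2 * i.2 := Nat.sub_le _ _
  exact_mod_cast this

namespace Seg
variable {W : Seg}

/-- The proportion of `W` covered by a piece. -/
def w (W : Seg) (i : Br) : ℝ := W.plen i / W.len

/-- All nonempty pieces of `W`. -/
def pcs (W : Seg) : Finset Br := W.act (⌊15 / 2 / W.eps⌋₊ + 1)

lemma lt_of_act (hW : W.Valid) {i : Br} (hi : W.Act i) : i.2 < ⌊15 / 2 / W.eps⌋₊ + 1 := by
  have h := eps_mul_le hW hi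
  rw [← le_div_iff₀ (eps_pos hW)] at h
  exact Nat.lt_succ_of_le (Nat.le_floor h)

lemma mem_pcs (hW : W.Valid) {i : Br} : i ∈ W.pcs ↔ W.Act i := by
  rw [pcs, mem_act, and_iff_right_of_imp (lt_of_act hW)]

lemma sum_pcs (hW : W.Valid) (Φ : ℝ → ℝ) :
    ∑ i ∈ W.pcs, (Φ (W.ph i) - Φ (W.pl i)) = Φ W.hi - Φ W.lo := by
  obtain ⟨K, hK⟩ := exists_telescope_act hW
  rw [← hK (K + (⌊15 / 2 / W.eps⌋₊ + 1)) (by omega)]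
  congr 1
  ext i
  rw [mem_pcs hW, mem_act, and_iff_right_of_imp]
  intro h
  have := lt_of_act hW h
  omega

lemma sum_plen_pcs (hW : W.Valid) : ∑ i ∈ W.pcs, W.plen i = W.len := sum_pcs hW id

lemma sum_w (hW : W.Valid) : ∑ i ∈ W.pcs, W.w i = 1 := by
  simp only [w]
  rw [← Finset.sum_div, sum_plen_pcs hW, div_self (len_pos hW).ne']

lemma w_nonneg (hW : W.Valid) (i : Br) : 0 ≤ W.w i := div_nonneg (plen_nonneg hW i) (len_pos hW).le

lemma w_le_one (hW : W.Valid) (i : Br) : W.w i ≤ 1 :=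
  (div_le_one (len_pos hW)).2 (plen_le_len hW i)

lemma sum_w_le (hW : W.Valid) {s : Finset Br} (hs : s ⊆ W.pcs) : ∑ i ∈ s, W.w i ≤ 1 :=
  (Finset.sum_le_sum_of_subset_of_nonneg hs fun i _ _ => w_nonneg hW i).trans (sum_w hW).le

lemma one_le_k {i : Br} (hi : W.Act i) : (1:ℝ) ≤ i.2 := by
  exact_mod_cast (Act.one_le i hi).1

lemma one_le_chi_k (hW : W.Valid) {i : Br} (hi : W.Act i) :
    1 ≤ 28 * W.chi * (i.2:ℝ) ^ (-(1/2) : ℝ) := by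
  have h1 := sqrt_k_le hW hi
  have h2 := one_le_k hi
  rw [Real.sqrt_eq_rpow] at h1
  have h3 : 0 < (i.2:ℝ) ^ (1/2 : ℝ) := by positivity
  rw [Real.rpow_neg (by positivity), ← div_eq_mul_inv, le_div_iff₀ h3]
  linarith

lemma ratio_le (hW : W.Valid) {i : Br} (hi : W.Act i) :
    (W.child i).chi / W.lam i ≤ 16 * W.chi * (i.2:ℝ) ^ (-(3/2) : ℝ) := by
  have h2 := one_le_k hi
  have h3 := one_le_chi (W := W)
  by_cases h : i.2 = 1
  · refine (child_ratio_le hW hi (by positivity) (child_chi_le' hW hi)).trans ?_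
    rw [h]; simp; linarith
  · refine (child_ratio_le hW hi (by positivity) (child_chi_le hW hi h)).trans ?_
    have h4 := one_le_chi_k hW hi
    have h5 : (i.2:ℝ) ^ (-(3/2) : ℝ) = (i.2:ℝ) ^ (-(1/2) : ℝ) * (i.2:ℝ)⁻¹ := by
      rw [← Real.rpow_neg_one, ← Real.rpow_add (by positivity)]; norm_num
    rw [h5]
    have h6 : 0 < (i.2:ℝ)⁻¹ := by positivity
    have h7 : 11 / 10 / (2 * (i.2:ℝ)) = 11 / 20 * (i.2:ℝ)⁻¹ := by field_simp; norm_num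
    rw [h7]
    nlinarith

lemma w_mul_D (hW : W.Valid) {i : Br} (hi : W.Act i) :
    W.w i * (W.child i).D = (W.child i).chi / W.lam i / W.len := by
  have h1 := hi.plen_pos
  have h2 := lam_pos hW (Act.one_le i hi).1
  have h3 := len_pos hW
  rw [w, D, child_len]
  field_simp

lemma w_mul_V_le (hW : W.Valid) {i : Br} (hi : W.Act i) :
    W.w i * (W.child i).V ≤ 84 * W.V * (i.2:ℝ) ^ (-(5/4) : ℝ) := by
  have hc := child_valid hW hi
  have hk := one_le_k hi
  have hD := one_le_D hW
  have hDc := one_le_D hc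
  have hw := w_nonneg hW i
  have h1 : W.w i ≤ (W.w i) ^ (9/10 : ℝ) := by
    nth_rw 1 [← Real.rpow_one (W.w i)]
    rcases hw.eq_or_lt with h | h
    · rw [← h]; simp
    · exact Real.rpow_le_rpow_of_exponent_ge h (w_le_one hW i) (by norm_num)
  have h2 : W.w i * (W.child i).D ≤ 16 * W.D * (i.2:ℝ) ^ (-(3/2) : ℝ) := by
    rw [w_mul_D hW hi, D, div_le_iff₀ (len_pos hW)]
    refine (ratio_le hW hi).trans (le_of_eq ?_)
    have := (len_pos hW).ne'
    field_simp
  calc W.w i * (W.child i).V ≤ (W.w i) ^ (9/10 : ℝ) * (W.child i).V := by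
        have : 0 ≤ (W.child i).V := by linarith [one_le_V hc]
        gcongr
    _ = (W.w i * (W.child i).D) ^ (9/10 : ℝ) := by
        rw [V, Real.mul_rpow hw (by linarith)]
    _ ≤ (16 * W.D * (i.2:ℝ) ^ (-(3/2) : ℝ)) ^ (9/10 : ℝ) :=
        Real.rpow_le_rpow (mul_nonneg hw (by linarith)) h2 (by norm_num)
    _ = 16 ^ (9/10 : ℝ) * W.V * (i.2:ℝ) ^ (-(3/2) * (9/10) : ℝ) := by
        rw [Real.mul_rpow (by positivity) (by positivity), Real.mul_rpow (by positivity) (by positivity),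
          V, ← Real.rpow_mul (by positivity)]
    _ ≤ _ := by
        have : 0 ≤ W.V := by linarith [one_le_V hW]
        gcongr
        · calc (16:ℝ) ^ (9/10 : ℝ) ≤ 16 ^ (1:ℝ) :=
                Real.rpow_le_rpow_of_exponent_le (by norm_num) (by norm_num)
            _ ≤ 84 := by norm_num
        · norm_num

lemma w_le (hW : W.Valid) {i : Br} (hi : W.Act i) :
    W.w i ≤ 42 * W.V * (i.2:ℝ) ^ (-(9/4) : ℝ) := by
  have hk := one_le_k hi
  have hD := one_le_D hW
  have hw := w_nonneg hW i
  have h0 := len_pos hW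
  have h1 : W.w i ≤ (W.w i) ^ (9/10 : ℝ) := by
    nth_rw 1 [← Real.rpow_one (W.w i)]
    rcases hw.eq_or_lt with h | h
    · rw [← h]; simp
    · exact Real.rpow_le_rpow_of_exponent_ge h (w_le_one hW i) (by norm_num)
  have h2 : W.w i ≤ 42 * W.D * (i.2:ℝ) ^ (-(5/2) : ℝ) := by
    have h3 := plen_le hW hi
    have h4 := one_le_chi_k hW hi
    have h5 : (i.2:ℝ) ^ (-(5/2) : ℝ) = (i.2:ℝ) ^ (-(1/2) : ℝ) * ((i.2:ℝ)^2)⁻¹ := by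
      rw [← Real.rpow_natCast, ← Real.rpow_neg (by positivity), ← Real.rpow_add (by positivity)]
      norm_num
    have h6 : 0 < ((i.2:ℝ)^2)⁻¹ := by positivity
    have h7 : W.plen i ≤ 3 / 2 * ((i.2:ℝ)^2)⁻¹ := by
      rw [← div_eq_mul_inv, le_div_iff₀ (by positivity)]; linarith
    rw [w, D, div_le_iff₀ h0, h5]
    have : 42 * (W.chi / W.len) * ((i.2:ℝ) ^ (-(1/2) : ℝ) * ((i.2:ℝ)^2)⁻¹) * W.len =
      3 / 2 * ((i.2:ℝ)^2)⁻¹ * (28 * W.chi * (i.2:ℝ) ^ (-(1/2) : ℝ)) := by field_simp; ring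
    rw [this]
    nlinarith
  calc W.w i ≤ (W.w i) ^ (9/10 : ℝ) := h1
    _ ≤ (42 * W.D * (i.2:ℝ) ^ (-(5/2) : ℝ)) ^ (9/10 : ℝ) := Real.rpow_le_rpow hw h2 (by norm_num)
    _ = 42 ^ (9/10 : ℝ) * W.V * (i.2:ℝ) ^ (-(5/2) * (9/10) : ℝ) := by
        rw [Real.mul_rpow (by positivity) (by positivity), Real.mul_rpow (by positivity) (by positivity),
          V, ← Real.rpow_mul (by positivity)]
    _ ≤ _ := by
        have : 0 ≤ W.V := by linarith [one_le_V hW]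
        gcongr
        · calc (42:ℝ) ^ (9/10 : ℝ) ≤ 42 ^ (1:ℝ) :=
                Real.rpow_le_rpow_of_exponent_le (by norm_num) (by norm_num)
            _ ≤ 42 := by norm_num
        · norm_num

lemma w_le' (hW : W.Valid) {i : Br} (hi : W.Act i) :
    W.w i ≤ 84 * W.V * (i.2:ℝ) ^ (-(9/4) : ℝ) := by
  have hk := one_le_k hi
  have : 0 ≤ W.V * (i.2:ℝ) ^ (-(9/4) : ℝ) := by
    have := one_le_V hW
    positivity
  linarith [w_le hW hi]

lemma w_mul_tau_le (hW : W.Valid) {i : Br} (hi : W.Act i) :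
    W.w i * tau i ≤ 84 * W.V * (i.2:ℝ) ^ (-(5/4) : ℝ) := by
  have hk := one_le_k hi
  have h1 := w_le hW hi
  have h2 : (i.2:ℝ) ^ (-(5/4) : ℝ) = (i.2:ℝ) ^ (-(9/4) : ℝ) * i.2 := by
    nth_rw 3 [← Real.rpow_one (i.2:ℝ)]
    rw [← Real.rpow_add (by positivity)]
    norm_num
  calc W.w i * tau i ≤ (42 * W.V * (i.2:ℝ) ^ (-(9/4) : ℝ)) * (2 * i.2) :=
        mul_le_mul h1 (tau_le i) (by positivity) ((w_nonneg hW i).trans h1)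
    _ = _ := by rw [h2]; ring

lemma w_le'' (hW : W.Valid) {i : Br} (hi : W.Act i) :
    W.w i ≤ 84 * W.V * (i.2:ℝ) ^ (-(5/4) : ℝ) := by
  refine (w_le' hW hi).trans ?_
  have := one_le_V hW
  gcongr
  · exact one_le_k hi
  · norm_num

/-- Drift of `V` under the return map. -/
lemma drift_V {CD : ℝ} (h1 : 1 ≤ CD) (hCD : ∀ W : Seg, W.Valid → ∀ n,
      ∑ i ∈ W.act n, (W.child i).chi / W.lam i ≤ 49/50 * W.chi + CD * W.len) (hW : W.Valid) :
    ∑ i ∈ W.pcs, W.w i * (W.child i).V ≤ 99/100 * W.V + CD := by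
  have h0 := len_pos hW
  have hD := one_le_D hW
  have h2 : ∑ i ∈ W.pcs, W.w i * (W.child i).D ≤ 49/50 * W.D + CD := by
    rw [Finset.sum_congr rfl fun i hi => w_mul_D hW ((mem_pcs hW).1 hi), ← Finset.sum_div,
      div_le_iff₀ h0]
    refine (hCD W hW _).trans (le_of_eq ?_)
    rw [D]; field_simp
  have hDn : ∀ i ∈ W.pcs, 0 ≤ (W.child i).D := fun i hi => by
    linarith [one_le_D (child_valid hW ((mem_pcs hW).1 hi))]
  have h3 : (∑ i ∈ W.pcs, W.w i * (W.child i).D ^ (9/10 : ℝ)) ≤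
      (∑ i ∈ W.pcs, W.w i * (W.child i).D) ^ (9/10 : ℝ) :=
    (Real.concaveOn_rpow (by norm_num) (by norm_num)).le_map_sum (fun i _ => w_nonneg hW i)
      (sum_w hW) (fun i hi => hDn i hi)
  refine h3.trans ?_
  calc (∑ i ∈ W.pcs, W.w i * (W.child i).D) ^ (9/10 : ℝ)
      ≤ (49/50 * W.D + CD) ^ (9/10 : ℝ) :=
        Real.rpow_le_rpow (Finset.sum_nonneg fun i hi => mul_nonneg (w_nonneg hW i) (hDn i hi)) h2
          (by norm_num)
    _ ≤ (49/50 * W.D) ^ (9/10 : ℝ) + CD ^ (9/10 : ℝ) :=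
        Real.rpow_add_le_add_rpow (by positivity) (by positivity) (by norm_num) (by norm_num)
    _ = (49/50) ^ (9/10 : ℝ) * W.V + CD ^ (9/10 : ℝ) := by
        rw [Real.mul_rpow (by norm_num) (by positivity), V]
    _ ≤ _ := by
        have : 0 ≤ W.V := by linarith [one_le_V hW]
        gcongr
        · have : ((49/50:ℝ)) ^ (9/10 : ℝ) = ((49/50:ℝ)^9) ^ (1/10 : ℝ) := by
            rw [← Real.rpow_natCast, ← Real.rpow_mul (by norm_num)]; norm_num
          rw [this]
          calc ((49/50:ℝ)^9) ^ (1/10 : ℝ) ≤ ((99/100:ℝ)^10) ^ (1/10 : ℝ) :=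
                Real.rpow_le_rpow (by norm_num) (by norm_num) (by norm_num)
            _ = 99/100 := by
                rw [← Real.rpow_natCast, ← Real.rpow_mul (by norm_num)]; norm_num
        · calc CD ^ (9/10 : ℝ) ≤ CD ^ (1:ℝ) :=
                Real.rpow_le_rpow_of_exponent_le h1 (by norm_num)
            _ = CD := Real.rpow_one _

end Seg
end LTM

namespace LTM

lemma sum_br_le (s : Finset Br) {f : ℕ → ℝ} (hf : ∀ k, 0 ≤ f k) :
    ∑ i ∈ s, f i.2 ≤ 2 * ∑ k ∈ s.image Prod.snd, f k := by
  calc ∑ i ∈ s, f i.2 ≤ ∑ i ∈ (Finset.univ : Finset Bool) ×ˢ s.image Prod.snd, f i.2 := by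
        refine Finset.sum_le_sum_of_subset_of_nonneg (fun i hi => ?_) fun i _ _ => hf _
        rw [Finset.mem_product]
        exact ⟨Finset.mem_univ _, Finset.mem_image_of_mem _ hi⟩
    _ = _ := by
        rw [Finset.sum_product]; simp

/-- Slowly varying rate functions. -/
structure Slow (g : ℕ → ℝ) (ζ M : ℝ) : Prop where
  pos : ∀ m, 0 < g m
  anti : Antitone g
  two : ∀ m, g m ≤ 2 * g (m + 1)
  star : ∀ (s : Finset Br) (m : ℕ) (c : Br → ℝ) (X : ℝ), 0 ≤ X → (∀ i ∈ s, 1 ≤ i.2 ∧ tau i ≤ m ∧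
    0 ≤ c i ∧ c i ≤ X * (i.2:ℝ) ^ (-(5/4) : ℝ)) →
    ∑ i ∈ s, c i * g (m - tau i) ≤ (∑ i ∈ s, c i) * g m + ζ * X * g m
  unres : ∀ (s : Finset Br) (m : ℕ) (c : Br → ℝ) (X : ℝ), 0 ≤ X → (∀ i ∈ s, 1 ≤ i.2 ∧ m < tau i ∧
    c i ≤ X * (i.2:ℝ) ^ (-(9/4) : ℝ)) → M * ∑ i ∈ s, c i ≤ ζ * X * g m
  low : ∀ m : ℕ, M * ((m:ℝ) + 1) ^ (-(5/4) : ℝ) ≤ ζ * g m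

lemma sum_rpow_le {p : ℝ} (hp : 1 < p) (s : Finset Br) :
    ∑ i ∈ s, (i.2 : ℝ) ^ (-p) ≤ 2 * ∑' k : ℕ, (k:ℝ) ^ (-p) := by
  refine (sum_br_le s (f := fun k => (k:ℝ) ^ (-p)) fun k => by positivity).trans ?_
  gcongr
  exact (Real.summable_nat_rpow.2 (by linarith)).sum_le_tsum _ fun k _ => by positivity

lemma sum_shift_le {n : ℕ} (hn : 1 ≤ n) (m : ℕ) (s : Finset Br) (hs : ∀ i ∈ s, 1 ≤ i.2 ∧ tau i ≤ m) :
    ∑ i ∈ s, (((m - tau i : ℕ) : ℝ) + n) ^ (-(6/5) : ℝ) ≤ 2 * ∑' k : ℕ, (k:ℝ) ^ (-(6/5) : ℝ) := by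
  refine (sum_br_le s (f := fun k => (((m - (2 * k - 1) : ℕ) : ℝ) + n) ^ (-(6/5) : ℝ))
    fun k => by positivity).trans ?_
  gcongr
  have hinj : Set.InjOn (fun k => m - (2 * k - 1) + n) (s.image Prod.snd : Finset ℕ) := by
    intro a ha b hb hab
    simp only [Finset.coe_image, Set.mem_image, Finset.mem_coe] at ha hb
    obtain ⟨i, hi, rfl⟩ := ha
    obtain ⟨j, hj, rfl⟩ := hb
    have h1 := hs i hi
    have h2 := hs j hj
    simp only [tau] at h1 h2
    dsimp only at hab
    omega
  calc ∑ k ∈ s.image Prod.snd, (((m - (2 * k - 1) : ℕ) : ℝ) + n) ^ (-(6/5) : ℝ)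
      = ∑ j ∈ (s.image Prod.snd).image (fun k => m - (2 * k - 1) + n), (j:ℝ) ^ (-(6/5) : ℝ) := by
        rw [Finset.sum_image hinj]
        simp
    _ ≤ _ := (Real.summable_nat_rpow.2 (by norm_num)).sum_le_tsum _ fun k _ => by positivity

/-- The base rate. -/
def rate (n m : ℕ) : ℝ := ((m:ℝ) + n) ^ (-(6/5) : ℝ)

lemma rate_pos {n : ℕ} (hn : 1 ≤ n) (m : ℕ) : 0 < rate n m := by
  have : (1:ℝ) ≤ n := by exact_mod_cast hn
  unfold rate; positivity

lemma exists_rate_star {ζ : ℝ} (hζ : 0 < ζ) : ∃ n : ℕ, 2 ≤ n ∧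
    ∀ (s : Finset Br) (m : ℕ) (c : Br → ℝ) (X : ℝ), 0 ≤ X → (∀ i ∈ s, 1 ≤ i.2 ∧ tau i ≤ m ∧
    0 ≤ c i ∧ c i ≤ X * (i.2:ℝ) ^ (-(5/4) : ℝ)) →
    ∑ i ∈ s, c i * rate n (m - tau i) ≤ (∑ i ∈ s, c i) * rate n m + ζ * X * rate n m := by
  set S1 := 2 * ∑' k : ℕ, (k:ℝ) ^ (-(5/4) : ℝ) with hS1
  set S2 := 2 * ∑' k : ℕ, (k:ℝ) ^ (-(6/5) : ℝ) with hS2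
  have hS1p : 0 ≤ S1 := mul_nonneg zero_le_two (tsum_nonneg fun k => by positivity)
  have hS2p : 0 ≤ S2 := mul_nonneg zero_le_two (tsum_nonneg fun k => by positivity)
  obtain ⟨η, hη0, hη1, hη⟩ : ∃ η : ℝ, 0 < η ∧ η < 1 ∧ S1 * ((1 - η) ^ (-(6/5) : ℝ) - 1) ≤ ζ / 2 := by
    have h1 : ContinuousAt (fun η : ℝ => S1 * ((1 - η) ^ (-(6/5) : ℝ) - 1)) 0 := by
      refine ContinuousAt.mul continuousAt_const (ContinuousAt.sub ?_ continuousAt_const)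
      exact ContinuousAt.rpow_const (by fun_prop) (Or.inl (by norm_num))
    have h2 : ∀ᶠ η in nhds (0:ℝ), S1 * ((1 - η) ^ (-(6/5) : ℝ) - 1) < ζ / 2 := by
      refine h1.eventually_lt continuousAt_const ?_
      simp; linarith
    have h3 : ∀ᶠ η : ℝ in nhdsWithin 0 (Set.Ioi 0), 0 < η ∧ η < 1 :=
      Ioo_mem_nhdsGT one_pos
    obtain ⟨η, h4, h5⟩ := ((h2.filter_mono nhdsWithin_le_nhds).and h3).exists
    exact ⟨η, h5.1, h5.2, h4.le⟩
  obtain ⟨n, hn2, hn⟩ : ∃ n : ℕ, 2 ≤ n ∧ (η / 2) ^ (-(5/4) : ℝ) * S2 * (n:ℝ) ^ (-(1/20) : ℝ) ≤ ζ / 2 := by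
    have h1 : Filter.Tendsto (fun n : ℕ => (η / 2) ^ (-(5/4) : ℝ) * S2 * (n:ℝ) ^ (-(1/20) : ℝ))
        Filter.atTop (nhds ((η / 2) ^ (-(5/4) : ℝ) * S2 * 0)) :=
      ((tendsto_rpow_neg_atTop (by norm_num)).comp tendsto_natCast_atTop_atTop).const_mul _
    rw [mul_zero] at h1
    obtain ⟨n, h2, h3⟩ := ((h1.eventually_le_const (by positivity : 0 < ζ / 2)).and
      (Filter.eventually_ge_atTop 2)).exists
    exact ⟨n, h3, h2⟩
  refine ⟨n, hn2, fun s m c X hX hs => ?_⟩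
  have hn1 : (1:ℝ) ≤ n := by exact_mod_cast (by omega : 1 ≤ n)
  set t : ℝ := (m:ℝ) + n with ht
  have ht0 : 0 < t := by positivity
  have hrp := rate_pos (by omega : 1 ≤ n) m
  have key : ∀ i ∈ s, c i * rate n (m - tau i) ≤ c i * rate n m +
      ((i.2:ℝ) ^ (-(5/4) : ℝ) * (X * ((1 - η) ^ (-(6/5) : ℝ) - 1) * rate n m) +
        rate n (m - tau i) * (X * ((η / 2) ^ (-(5/4) : ℝ) * t ^ (-(5/4) : ℝ)))) := by
    intro i hi
    obtain ⟨h1, h2, h3, h4⟩ := hs i hi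
    have hk : (1:ℝ) ≤ i.2 := by exact_mod_cast h1
    have hr := rate_pos (by omega : 1 ≤ n) (m - tau i)
    have h10 : 1 ≤ (1 - η) ^ (-(6/5) : ℝ) :=
      Real.one_le_rpow_of_pos_of_le_one_of_nonpos (by linarith) (by linarith) (by norm_num)
    have hcast : ((m - tau i : ℕ) : ℝ) = m - tau i := by push_cast [h2]; ring
    by_cases h5 : (tau i : ℝ) ≤ η * t
    · have h6 : rate n (m - tau i) ≤ (1 - η) ^ (-(6/5) : ℝ) * rate n m := by
        unfold rate
        rw [← Real.mul_rpow (by linarith) ht0.le]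
        refine Real.rpow_le_rpow_of_nonpos (by nlinarith) ?_ (by norm_num)
        rw [hcast]; linarith
      have h7 : c i * (rate n (m - tau i) - rate n m) ≤
          (X * (i.2:ℝ) ^ (-(5/4) : ℝ)) * (((1 - η) ^ (-(6/5) : ℝ) - 1) * rate n m) := by
        calc c i * (rate n (m - tau i) - rate n m)
            ≤ c i * (((1 - η) ^ (-(6/5) : ℝ) - 1) * rate n m) :=
              mul_le_mul_of_nonneg_left (by linarith) h3
          _ ≤ _ := mul_le_mul_of_nonneg_right h4 (mul_nonneg (by linarith) hrp.le)
      have h8 : 0 ≤ rate n (m - tau i) * (X * ((η / 2) ^ (-(5/4) : ℝ) * t ^ (-(5/4) : ℝ))) := by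
        positivity
      linarith
    · push Not at h5
      have h6 : η / 2 * t ≤ i.2 := by
        have := tau_le i; linarith
      have h7 : (i.2:ℝ) ^ (-(5/4) : ℝ) ≤ (η / 2) ^ (-(5/4) : ℝ) * t ^ (-(5/4) : ℝ) := by
        rw [← Real.mul_rpow (by linarith) ht0.le]
        exact Real.rpow_le_rpow_of_nonpos (by positivity) h6 (by norm_num)
      have h8 : c i * rate n (m - tau i) ≤
          rate n (m - tau i) * (X * ((η / 2) ^ (-(5/4) : ℝ) * t ^ (-(5/4) : ℝ))) := by
        rw [mul_comm]
        exact mul_le_mul_of_nonneg_left (h4.trans (mul_le_mul_of_nonneg_left h7 hX)) hr.le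
      have h9 : 0 ≤ (i.2:ℝ) ^ (-(5/4) : ℝ) * (X * ((1 - η) ^ (-(6/5) : ℝ) - 1) * rate n m) :=
        mul_nonneg (by positivity) (mul_nonneg (mul_nonneg hX (by linarith)) hrp.le)
      have : 0 ≤ c i * rate n m := mul_nonneg h3 hrp.le
      linarith
  have h10 : 1 ≤ (1 - η) ^ (-(6/5) : ℝ) :=
      Real.one_le_rpow_of_pos_of_le_one_of_nonpos (by linarith) (by linarith) (by norm_num)
  refine (Finset.sum_le_sum key).trans ?_
  rw [Finset.sum_add_distrib, Finset.sum_add_distrib, ← Finset.sum_mul, ← Finset.sum_mul,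
    ← Finset.sum_mul]
  have e1 : (∑ i ∈ s, (i.2:ℝ) ^ (-(5/4) : ℝ)) * (X * ((1 - η) ^ (-(6/5) : ℝ) - 1) * rate n m) ≤
      ζ / 2 * X * rate n m := by
    have h1 := sum_rpow_le (by norm_num : (1:ℝ) < 5/4) s
    calc _ ≤ S1 * (X * ((1 - η) ^ (-(6/5) : ℝ) - 1) * rate n m) :=
          mul_le_mul_of_nonneg_right h1 (mul_nonneg (mul_nonneg hX (by linarith)) hrp.le)
      _ = (S1 * ((1 - η) ^ (-(6/5) : ℝ) - 1)) * (X * rate n m) := by ring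
      _ ≤ ζ / 2 * (X * rate n m) := by gcongr
      _ = _ := by ring
  have e2 : (∑ i ∈ s, rate n (m - tau i)) * (X * ((η / 2) ^ (-(5/4) : ℝ) * t ^ (-(5/4) : ℝ))) ≤
      ζ / 2 * X * rate n m := by
    have h1 := sum_shift_le (by omega : 1 ≤ n) m s (fun i hi => ⟨(hs i hi).1, (hs i hi).2.1⟩)
    have h2 : t ^ (-(5/4) : ℝ) ≤ (n:ℝ) ^ (-(1/20) : ℝ) * rate n m := by
      have : t ^ (-(5/4) : ℝ) = t ^ (-(1/20) : ℝ) * t ^ (-(6/5) : ℝ) := by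
        rw [← Real.rpow_add ht0]; norm_num
      rw [this, rate]
      gcongr ?_ * _
      refine Real.rpow_le_rpow_of_nonpos (by positivity) ?_ (by norm_num)
      rw [ht]; have : (0:ℝ) ≤ m := by positivity
      linarith
    calc _ ≤ S2 * (X * ((η / 2) ^ (-(5/4) : ℝ) * ((n:ℝ) ^ (-(1/20) : ℝ) * rate n m))) := by
          unfold rate at *
          gcongr
      _ = ((η / 2) ^ (-(5/4) : ℝ) * S2 * (n:ℝ) ^ (-(1/20) : ℝ)) * (X * rate n m) := by ring
      _ ≤ ζ / 2 * (X * rate n m) := by gcongr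
      _ = _ := by ring
  linarith

lemma exists_slow {ζ M : ℝ} (hζ : 0 < ζ) (hM : 0 ≤ M) : ∃ g : ℕ → ℝ, Slow g ζ M ∧
    ∃ K, 0 < K ∧ ∀ m : ℕ, g m ≤ K * ((m:ℝ) + 1) ^ (-(6/5) : ℝ) := by
  obtain ⟨n, hn2, hn⟩ := exists_rate_star hζ
  have hn1 : (2:ℝ) ≤ n := by exact_mod_cast hn2
  set S := 2 * ∑' k : ℕ, (k:ℝ) ^ (-(21/20) : ℝ)
  have hSp : 0 ≤ S := mul_nonneg zero_le_two (tsum_nonneg fun k => by positivity)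
  set B := M * (S * (2:ℝ) ^ (6/5 : ℝ) + 1) with hB
  have hB0 : 0 ≤ B := by positivity
  set C := (B + 1) * (n:ℝ) ^ (6/5 : ℝ) / ζ with hC
  have hCpos : 0 < C := by positivity
  have hrate : ∀ m : ℕ, B * ((m:ℝ) + 1) ^ (-(6/5) : ℝ) ≤ ζ * (C * rate n m) := by
    intro m
    have h1 : ((m:ℝ) + 1) ^ (-(6/5) : ℝ) ≤ (n:ℝ) ^ (6/5 : ℝ) * rate n m := by
      have h2 : (n:ℝ) ^ (6/5 : ℝ) = ((n:ℝ)⁻¹) ^ (-(6/5) : ℝ) := by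
        rw [Real.inv_rpow (by positivity), Real.rpow_neg (by positivity), inv_inv]
      rw [rate, h2, ← Real.mul_rpow (by positivity) (by positivity)]
      refine Real.rpow_le_rpow_of_nonpos (by positivity) ?_ (by norm_num)
      rw [inv_mul_le_iff₀ (by positivity)]
      have : (0:ℝ) ≤ m := by positivity
      nlinarith
    have h3 : ζ * (C * rate n m) = (B + 1) * ((n:ℝ) ^ (6/5 : ℝ) * rate n m) := by
      rw [hC]; field_simp
    rw [h3]
    have := rate_pos (by omega : 1 ≤ n) m
    gcongr
    linarith
  refine ⟨fun m => C * rate n m, ⟨fun m => mul_pos hCpos (rate_pos (by omega) m), ?_, ?_, ?_, ?_, ?_⟩,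
    C, hCpos, ?_⟩
  · intro a b hab
    dsimp only [rate]
    gcongr ?_ * ?_
    refine Real.rpow_le_rpow_of_nonpos (by positivity) ?_ (by norm_num)
    have : (a:ℝ) ≤ b := by exact_mod_cast hab
    linarith
  · intro m
    have h1 : rate n m ≤ 2 * rate n (m + 1) := by
      have h2 : rate n m = (3/2 : ℝ) ^ (6/5 : ℝ) * ((3/2) * ((m:ℝ) + n)) ^ (-(6/5) : ℝ) := by
        rw [Real.mul_rpow (by norm_num) (by positivity), ← mul_assoc, ← Real.rpow_add (by norm_num)]
        norm_num [rate]
      have h3 : (3/2 : ℝ) ^ (6/5 : ℝ) ≤ 2 := by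
        have e : (3/2 : ℝ) ^ (6/5 : ℝ) = ((3/2 : ℝ) ^ 6) ^ (1/5 : ℝ) := by
          rw [← Real.rpow_natCast, ← Real.rpow_mul (by norm_num)]; norm_num
        rw [e]
        calc ((3/2 : ℝ) ^ 6) ^ (1/5 : ℝ) ≤ ((2:ℝ) ^ 5) ^ (1/5 : ℝ) :=
              Real.rpow_le_rpow (by norm_num) (by norm_num) (by norm_num)
          _ = 2 := by rw [← Real.rpow_natCast, ← Real.rpow_mul (by norm_num)]; norm_num
      rw [h2]
      refine mul_le_mul h3 ?_ (by positivity) (by norm_num)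
      refine Real.rpow_le_rpow_of_nonpos (by positivity) ?_ (by norm_num)
      push_cast
      have : (0:ℝ) ≤ m := by positivity
      linarith
    nlinarith
  · intro s m c X hX hs
    have := mul_le_mul_of_nonneg_left (hn s m c X hX hs) hCpos.le
    calc ∑ i ∈ s, c i * (C * rate n (m - tau i)) = C * ∑ i ∈ s, c i * rate n (m - tau i) := by
          rw [Finset.mul_sum]; exact Finset.sum_congr rfl fun i _ => by ring
      _ ≤ _ := this
      _ = _ := by ring
  · intro s m c X hX hs
    have h1 : ∑ i ∈ s, c i ≤ X * (2 ^ (6/5 : ℝ) * ((m:ℝ) + 1) ^ (-(6/5) : ℝ) * S) := by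
      calc ∑ i ∈ s, c i ≤ ∑ i ∈ s, (i.2:ℝ) ^ (-(21/20) : ℝ) *
            (X * (2 ^ (6/5 : ℝ) * ((m:ℝ) + 1) ^ (-(6/5) : ℝ))) := by
            refine Finset.sum_le_sum fun i hi => ?_
            obtain ⟨h1, h2, h3⟩ := hs i hi
            have hk : (1:ℝ) ≤ i.2 := by exact_mod_cast h1
            refine h3.trans ?_
            have h4 : (i.2:ℝ) ^ (-(9/4) : ℝ) = (i.2:ℝ) ^ (-(21/20) : ℝ) * (i.2:ℝ) ^ (-(6/5) : ℝ) := by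
              rw [← Real.rpow_add (by positivity)]; norm_num
            have h5 : (i.2:ℝ) ^ (-(6/5) : ℝ) ≤ 2 ^ (6/5 : ℝ) * ((m:ℝ) + 1) ^ (-(6/5) : ℝ) := by
              have h6 : (2:ℝ) ^ (6/5 : ℝ) = ((2:ℝ)⁻¹) ^ (-(6/5) : ℝ) := by
                rw [Real.inv_rpow (by positivity), Real.rpow_neg (by positivity), inv_inv]
              rw [h6, ← Real.mul_rpow (by positivity) (by positivity)]
              refine Real.rpow_le_rpow_of_nonpos (by positivity) ?_ (by norm_num)
              have h7 : m + 1 ≤ 2 * i.2 := by unfold tau at h2; omega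
              have : (m:ℝ) + 1 ≤ 2 * i.2 := by exact_mod_cast h7
              linarith
            rw [h4]
            calc X * ((i.2:ℝ) ^ (-(21/20) : ℝ) * (i.2:ℝ) ^ (-(6/5) : ℝ))
                ≤ X * ((i.2:ℝ) ^ (-(21/20) : ℝ) * (2 ^ (6/5 : ℝ) * ((m:ℝ) + 1) ^ (-(6/5) : ℝ))) := by
                  gcongr
              _ = _ := by ring
        _ ≤ S * (X * (2 ^ (6/5 : ℝ) * ((m:ℝ) + 1) ^ (-(6/5) : ℝ))) := by
            rw [← Finset.sum_mul]
            exact mul_le_mul_of_nonneg_right (sum_rpow_le (by norm_num) s) (by positivity)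
        _ = _ := by ring
    have h2 := hrate m
    have h3 : 0 < ((m:ℝ) + 1) ^ (-(6/5) : ℝ) := by positivity
    calc M * ∑ i ∈ s, c i ≤ M * (X * (2 ^ (6/5 : ℝ) * ((m:ℝ) + 1) ^ (-(6/5) : ℝ) * S)) := by gcongr
      _ = X * ((M * (S * (2:ℝ) ^ (6/5 : ℝ))) * ((m:ℝ) + 1) ^ (-(6/5) : ℝ)) := by ring
      _ ≤ X * (B * ((m:ℝ) + 1) ^ (-(6/5) : ℝ)) := by
          gcongr; rw [hB]; nlinarith
      _ ≤ X * (ζ * (C * rate n m)) := by gcongr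
      _ = _ := by ring
  · intro m
    have h2 := hrate m
    have h1 : ((m:ℝ) + 1) ^ (-(5/4) : ℝ) ≤ ((m:ℝ) + 1) ^ (-(6/5) : ℝ) :=
      Real.rpow_le_rpow_of_exponent_le (by linarith [(Nat.cast_nonneg m : (0:ℝ) ≤ m)]) (by norm_num)
    calc M * ((m:ℝ) + 1) ^ (-(5/4) : ℝ) ≤ M * ((m:ℝ) + 1) ^ (-(6/5) : ℝ) := by gcongr
      _ ≤ B * ((m:ℝ) + 1) ^ (-(6/5) : ℝ) := by
          gcongr; rw [hB]
          have : 0 ≤ S * (2:ℝ) ^ (6/5 : ℝ) := by positivity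
          nlinarith
      _ ≤ _ := h2
  · intro m
    dsimp only [rate]
    gcongr ?_ * ?_
    refine Real.rpow_le_rpow_of_nonpos (by positivity) ?_ (by norm_num)
    linarith

end LTM

namespace LTM

/-- Iterates of an observable under the square root of the linked-twist map, in coordinates. -/
structure Dyn (f : ℕ → ℝ → ℝ → ℝ) (M c α : ℝ) : Prop where
  bdd : ∀ m x y, |f m x y| ≤ M
  meas : ∀ m, Measurable (fun p : ℝ × ℝ => f m p.1 p.2)
  step : ∀ (W : Seg), W.Valid → ∀ (i : Br) (m : ℕ) (y : ℝ), W.pl i < y → y < W.ph i →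
    tau i ≤ m → f m (W.h y) y = f (m - tau i) y (W.Y i y)
  unres : ∀ (W U : Seg), W.Valid → U.Valid → ∀ (i : Br) (m : ℕ) (y : ℝ),
    W.pl i < y → y < W.ph i → U.pl i < y → y < U.ph i → m < tau i →
    |f m (W.h y) y - f m (U.h y) y| ≤ c * |W.h y - U.h y| ^ α

/-- Average over a segment. -/
def A (f : ℕ → ℝ → ℝ → ℝ) (m : ℕ) (W : Seg) : ℝ := (∫ y in W.lo..W.hi, f m (W.h y) y) / W.len

/-- Average over a piece of a segment. -/
def pa (f : ℕ → ℝ → ℝ → ℝ) (m : ℕ) (W : Seg) (i : Br) : ℝ :=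
  (∫ y in W.pl i..W.ph i, f m (W.h y) y) / W.plen i

section
variable {f : ℕ → ℝ → ℝ → ℝ} {M c α : ℝ}

lemma Dyn.M_nonneg (hf : Dyn f M c α) : 0 ≤ M := (abs_nonneg _).trans (hf.bdd 0 0 0)

lemma Dyn.measurable (hf : Dyn f M c α) (m : ℕ) (W : Seg) : Measurable fun y => f m (W.h y) y := by
  have : Measurable fun y : ℝ => (W.h y, y) := by unfold Seg.h; fun_prop
  exact (hf.meas m).comp this

lemma intervalIntegrable_of_bdd {u : ℝ → ℝ} (hu : Measurable u) {M : ℝ} (hM : ∀ x, |u x| ≤ M)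
    (a b : ℝ) : IntervalIntegrable u volume a b :=
  (intervalIntegrable_const (c := M)).mono_fun hu.aestronglyMeasurable
    (Filter.Eventually.of_forall fun x => (hM x).trans (le_abs_self M))

lemma Dyn.integrable (hf : Dyn f M c α) (m : ℕ) (W : Seg) (a b : ℝ) :
    IntervalIntegrable (fun y => f m (W.h y) y) volume a b :=
  intervalIntegrable_of_bdd (hf.measurable m W) (fun _ => hf.bdd _ _ _) a b

lemma abs_integral_le {u : ℝ → ℝ} {M : ℝ} (hM : ∀ x, |u x| ≤ M) {a b : ℝ} (hab : a ≤ b) :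
    |∫ x in a..b, u x| ≤ M * (b - a) := by
  have := intervalIntegral.norm_integral_le_of_norm_le_const (a := a) (b := b) (f := u) (C := M)
    (fun x _ => hM x)
  rwa [abs_of_nonneg (sub_nonneg.2 hab)] at this

lemma abs_div_le_of {x M l : ℝ} (hl : 0 < l) (h : |x| ≤ M * l) : |x / l| ≤ M := by
  rw [abs_div, abs_of_pos hl, div_le_iff₀ hl]; exact h

lemma Dyn.A_le (hf : Dyn f M c α) (m : ℕ) {W : Seg} (hW : W.Valid) : |A f m W| ≤ M :=
  abs_div_le_of (Seg.len_pos hW) (abs_integral_le (fun _ => hf.bdd _ _ _) hW.lt.le)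

lemma Dyn.pa_le (hf : Dyn f M c α) (m : ℕ) {W : Seg} {i : Br} (hi : W.Act i) :
    |pa f m W i| ≤ M :=
  abs_div_le_of hi.plen_pos (abs_integral_le (fun _ => hf.bdd _ _ _) hi.le)

/-- Change of variables along a piece. -/
lemma Dyn.integral_piece (hf : Dyn f M c α) {m : ℕ} {W : Seg} (hW : W.Valid) {i : Br}
    (hi : W.Act i) (hm : tau i ≤ m) {u v : ℝ} (hu : W.pl i ≤ u) (huv : u ≤ v) (hv : v ≤ W.ph i)
    (η : ℝ → ℝ) :
    ∫ y in u..v, η (W.Y i y) * f m (W.h y) y =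
      (1 / W.lam i) * ∫ Y in (W.Y i u)..(W.Y i v), η Y * f (m - tau i) ((W.child i).h Y) Y := by
  have hk := (Seg.Act.one_le i hi).1
  have hl := Seg.lam_pos hW hk
  have e : ∀ y, W.Y i y = W.lam i * y + (W.a - 2 * jj i) := fun y => by
    unfold Seg.Y Seg.lam Seg.h; ring
  have h1 : ∫ y in u..v, η (W.Y i y) * f m (W.h y) y = ∫ y in u..v,
      (fun Y => η Y * f (m - tau i) ((W.child i).h Y) Y) (W.lam i * y + (W.a - 2 * jj i)) := by
    refine intervalIntegral.integral_congr_ae ?_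
    have h0 : ∀ᵐ y : ℝ, y ≠ v := by
      rw [ae_iff]; simp
    filter_upwards [h0] with y hy hmem
    rw [Set.uIoc_of_le huv] at hmem
    have hyv : y < v := lt_of_le_of_ne hmem.2 hy
    rw [← e, Seg.child_h_Y hW hk, hf.step W hW i m y (by linarith [hmem.1]) (by linarith) hm]
  have h2 := intervalIntegral.integral_comp_mul_add (a := u) (b := v)
    (fun Y => η Y * f (m - tau i) ((W.child i).h Y) Y) hl.ne' (W.a - 2 * jj i)
  rw [h1, e, e, one_div, ← smul_eq_mul (a := (W.lam i)⁻¹)]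
  exact h2

lemma Dyn.integral_piece_one (hf : Dyn f M c α) {m : ℕ} {W : Seg} (hW : W.Valid) {i : Br}
    (hi : W.Act i) (hm : tau i ≤ m) {u v : ℝ} (hu : W.pl i ≤ u) (huv : u ≤ v) (hv : v ≤ W.ph i) :
    ∫ y in u..v, f m (W.h y) y =
      (1 / W.lam i) * ∫ Y in (W.Y i u)..(W.Y i v), f (m - tau i) ((W.child i).h Y) Y := by
  simpa using hf.integral_piece hW hi hm hu huv hv (fun _ => 1)

lemma Dyn.pa_eq (hf : Dyn f M c α) {m : ℕ} {W : Seg} (hW : W.Valid) {i : Br}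
    (hi : W.Act i) (hm : tau i ≤ m) : pa f m W i = A f (m - tau i) (W.child i) := by
  have hl := Seg.lam_pos hW (Seg.Act.one_le i hi).1
  rw [pa, A, hf.integral_piece_one hW hi hm le_rfl hi.le le_rfl, Seg.child_len]
  have := hi.plen_pos
  change _ = (∫ Y in (W.Y i (W.pl i))..(W.Y i (W.ph i)), _) / _
  field_simp

lemma integral_eq_sum {u : ℝ → ℝ} (hu : ∀ a b, IntervalIntegrable u volume a b) {W : Seg}
    (hW : W.Valid) : ∫ y in W.lo..W.hi, u y = ∑ i ∈ W.pcs, ∫ y in W.pl i..W.ph i, u y := by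
  have := Seg.sum_pcs hW (fun t => ∫ y in (0:ℝ)..t, u y)
  simp only [intervalIntegral.integral_interval_sub_left (hu _ _) (hu _ _)] at this
  exact this.symm

lemma Dyn.A_eq_sum (hf : Dyn f M c α) (m : ℕ) {W : Seg} (hW : W.Valid) :
    A f m W = ∑ i ∈ W.pcs, W.w i * pa f m W i := by
  rw [A, integral_eq_sum (hf.integrable m W) hW, Finset.sum_div]
  refine Finset.sum_congr rfl fun i hi => ?_
  have := ((Seg.mem_pcs hW).1 hi).plen_pos
  have := Seg.len_pos hW
  rw [pa, Seg.w]
  field_simp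

/-- Pieces that return by time `m`. -/
def Seg.res (W : Seg) (m : ℕ) : Finset Br := W.pcs.filter fun i => tau i ≤ m
/-- Pieces that do not return by time `m`. -/
def Seg.unr (W : Seg) (m : ℕ) : Finset Br := W.pcs.filter fun i => ¬ tau i ≤ m

lemma Seg.mem_res {W : Seg} (hW : W.Valid) {m : ℕ} {i : Br} :
    i ∈ W.res m ↔ W.Act i ∧ tau i ≤ m := by simp [Seg.res, Seg.mem_pcs hW]

lemma Seg.mem_unr {W : Seg} (hW : W.Valid) {m : ℕ} {i : Br} :
    i ∈ W.unr m ↔ W.Act i ∧ m < tau i := by simp [Seg.unr, Seg.mem_pcs hW]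

lemma Seg.sum_res_add (W : Seg) (m : ℕ) (u : Br → ℝ) :
    ∑ i ∈ W.res m, u i + ∑ i ∈ W.unr m, u i = ∑ i ∈ W.pcs, u i :=
  Finset.sum_filter_add_sum_filter_not _ _ _

lemma Seg.res_subset (W : Seg) (m : ℕ) : W.res m ⊆ W.pcs := Finset.filter_subset _ _

lemma Dyn.advance (hf : Dyn f M c α) (m : ℕ) {W : Seg} (hW : W.Valid) {r : ℝ} (hr : |r| ≤ M)
    {b : Br → ℝ} (hb : ∀ i ∈ W.res m, |A f (m - tau i) (W.child i) - r| ≤ b i) :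
    |A f m W - r| ≤ ∑ i ∈ W.res m, W.w i * b i + 2 * M * ∑ i ∈ W.unr m, W.w i := by
  have h1 : A f m W - r = ∑ i ∈ W.pcs, W.w i * (pa f m W i - r) := by
    simp only [mul_sub]
    rw [Finset.sum_sub_distrib, ← hf.A_eq_sum m hW, ← Finset.sum_mul, Seg.sum_w hW, one_mul]
  rw [h1, ← Seg.sum_res_add W m, Finset.mul_sum]
  refine (abs_add_le _ _).trans (add_le_add ?_ ?_)
  · refine (Finset.abs_sum_le_sum_abs _ _).trans (Finset.sum_le_sum fun i hi => ?_)
    obtain ⟨h2, h3⟩ := (Seg.mem_res hW).1 hi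
    rw [abs_mul, abs_of_nonneg (Seg.w_nonneg hW i), hf.pa_eq hW h2 h3]
    exact mul_le_mul_of_nonneg_left (hb i hi) (Seg.w_nonneg hW i)
  · refine (Finset.abs_sum_le_sum_abs _ _).trans (Finset.sum_le_sum fun i hi => ?_)
    obtain ⟨h2, h3⟩ := (Seg.mem_unr hW).1 hi
    rw [abs_mul, abs_of_nonneg (Seg.w_nonneg hW i), mul_comm]
    refine mul_le_mul_of_nonneg_right ?_ (Seg.w_nonneg hW i)
    have := abs_sub (pa f m W i) r
    linarith [hf.pa_le m h2]

/-- The drift inequality with constant `CD`. -/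
def Drift (CD : ℝ) : Prop := ∀ W : Seg, W.Valid → ∀ n,
  ∑ i ∈ W.act n, (W.child i).chi / W.lam i ≤ 49/50 * W.chi + CD * W.len

variable {g : ℕ → ℝ} {ζ CD : ℝ}

lemma Slow.sum_star (hg : Slow g ζ M) {W : Seg} (hW : W.Valid) {m : ℕ} {s : Finset Br}
    (hs : s ⊆ W.res m) (u : Br → ℝ)
    (hu : ∀ i ∈ s, 0 ≤ u i ∧ u i ≤ 84 * W.V * (i.2:ℝ) ^ (-(5/4) : ℝ)) :
    ∑ i ∈ s, u i * g (m - tau i) ≤ (∑ i ∈ s, u i) * g m + ζ * (84 * W.V) * g m := by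
  have := Seg.one_le_V hW
  refine hg.star s m u _ (by positivity) fun i hi => ?_
  have h := (Seg.mem_res hW).1 (hs hi)
  exact ⟨(Seg.Act.one_le i h.1).1, h.2, hu i hi⟩

lemma Slow.sum_min (hg : Slow g ζ M) {W : Seg} (hW : W.Valid) {m m' : ℕ} {s : Finset Br}
    (hs : s ⊆ W.res m) (u : Br → ℝ)
    (hu : ∀ i ∈ s, 0 ≤ u i ∧ u i ≤ 84 * W.V * (i.2:ℝ) ^ (-(5/4) : ℝ)) :
    ∑ i ∈ s, u i * g (min (m - tau i) m') ≤
      (∑ i ∈ s, u i) * g (min m m') + ζ * (84 * W.V) * g m := by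
  have h1 := hg.sum_star hW hs u hu
  have h2 : ∀ i ∈ s, u i * g (min (m - tau i) m') ≤
      u i * g (min m m') + (u i * g (m - tau i) - u i * g m) := by
    intro i hi
    have h3 := hg.anti (Nat.sub_le m (tau i))
    have h4 : g (min (m - tau i) m') ≤ g (min m m') + (g (m - tau i) - g m) := by
      rcases le_total (m - tau i) m' with h | h
      · rw [min_eq_left h]
        have := hg.anti (min_le_left m m')
        linarith
      · rw [min_eq_right h, min_eq_right (h.trans (Nat.sub_le _ _))]
        linarith
    nlinarith [(hu i hi).1]
  have h5 := Finset.sum_le_sum h2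
  rw [Finset.sum_add_distrib, Finset.sum_sub_distrib, ← Finset.sum_mul, ← Finset.sum_mul] at h5
  linarith

lemma Slow.sum_unr (hg : Slow g ζ M) {W : Seg} (hW : W.Valid) (m : ℕ) :
    M * ∑ i ∈ W.unr m, W.w i ≤ ζ * (84 * W.V) * g m := by
  have := Seg.one_le_V hW
  refine hg.unres _ m W.w _ (by positivity) fun i hi => ?_
  obtain ⟨h1, h2⟩ := (Seg.mem_unr hW).1 hi
  exact ⟨(Seg.Act.one_le i h1).1, h2, Seg.w_le' hW h1⟩

lemma Slow.sum_V (hg : Slow g ζ M) (hCD1 : 1 ≤ CD) (hCD : Drift CD) {W : Seg} (hW : W.Valid)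
    (m : ℕ) : ∑ i ∈ W.res m, W.w i * ((W.child i).V * g (m - tau i)) ≤
      (99/100 * W.V + CD + ζ * (84 * W.V)) * g m := by
  have hV : ∀ i ∈ W.pcs, 0 ≤ W.w i * (W.child i).V := fun i hi =>
    mul_nonneg (Seg.w_nonneg hW i)
      (by linarith [Seg.one_le_V (Seg.child_valid hW ((Seg.mem_pcs hW).1 hi))])
  have h1 := hg.sum_star hW subset_rfl (fun i => W.w i * (W.child i).V) (fun i hi =>
    ⟨hV i (W.res_subset m hi), Seg.w_mul_V_le hW ((Seg.mem_res hW).1 hi).1⟩)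
  have h2 : ∑ i ∈ W.res m, W.w i * (W.child i).V ≤ 99/100 * W.V + CD :=
    (Finset.sum_le_sum_of_subset_of_nonneg (W.res_subset m) fun i hi _ => hV i hi).trans
      (Seg.drift_V hCD1 hCD hW)
  have h3 := hg.pos m
  simp only [← mul_assoc]
  nlinarith

/-- Advancing a segment, for bounds of the form `V g + e`. -/
lemma Dyn.advance_V (hf : Dyn f M c α) (hg : Slow g ζ (2 * M)) (hCD1 : 1 ≤ CD) (hCD : Drift CD)
    (m : ℕ) {W : Seg} (hW : W.Valid) {r : ℝ} (hr : |r| ≤ M) {e : Br → ℝ}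
    (he : ∀ i ∈ W.res m, |A f (m - tau i) (W.child i) - r| ≤ (W.child i).V * g (m - tau i) + e i) :
    |A f m W - r| ≤ (99/100 * W.V + CD + ζ * (168 * W.V)) * g m + ∑ i ∈ W.res m, W.w i * e i := by
  have h1 := hf.advance m hW hr he
  simp only [mul_add] at h1
  rw [Finset.sum_add_distrib] at h1
  have h2 := hg.sum_V hCD1 hCD hW m
  have h3 := hg.sum_unr hW m
  linarith

lemma exists_tail {ρ : ℝ} (hρ : 0 < ρ) : ∃ n : ℕ, ∀ W : Seg, W.Valid → ∀ s ⊆ W.pcs,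
    (∀ i ∈ s, n < tau i) → ∑ i ∈ s, W.w i * tau i ≤ ρ * W.V := by
  set S := 2 * ∑' k : ℕ, (k:ℝ) ^ (-(9/8) : ℝ)
  have hS : 0 ≤ S := mul_nonneg zero_le_two (tsum_nonneg fun k => by positivity)
  obtain ⟨n, hn, hn1⟩ : ∃ n : ℕ, 84 * S * (n:ℝ) ^ (-(1/8) : ℝ) ≤ ρ ∧ 1 ≤ n := by
    have h1 : Filter.Tendsto (fun n : ℕ => 84 * S * (n:ℝ) ^ (-(1/8) : ℝ))
        Filter.atTop (nhds (84 * S * 0)) :=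
      ((tendsto_rpow_neg_atTop (by norm_num)).comp tendsto_natCast_atTop_atTop).const_mul _
    rw [mul_zero] at h1
    exact ((h1.eventually_le_const hρ).and (Filter.eventually_ge_atTop 1)).exists
  refine ⟨2 * n, fun W hW s hs hs2 => ?_⟩
  have hV := Seg.one_le_V hW
  have hn1' : (1:ℝ) ≤ n := by exact_mod_cast hn1
  calc ∑ i ∈ s, W.w i * tau i
      ≤ ∑ i ∈ s, (i.2:ℝ) ^ (-(9/8) : ℝ) * (84 * W.V * (n:ℝ) ^ (-(1/8) : ℝ)) := by
        refine Finset.sum_le_sum fun i hi => ?_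
        have hi1 := (Seg.mem_pcs hW).1 (hs hi)
        have hk := Seg.one_le_k hi1
        refine (Seg.w_mul_tau_le hW hi1).trans ?_
        have h1 : (i.2:ℝ) ^ (-(5/4) : ℝ) = (i.2:ℝ) ^ (-(9/8) : ℝ) * (i.2:ℝ) ^ (-(1/8) : ℝ) := by
          rw [← Real.rpow_add (by positivity)]; norm_num
        have h2 : (i.2:ℝ) ^ (-(1/8) : ℝ) ≤ (n:ℝ) ^ (-(1/8) : ℝ) := by
          refine Real.rpow_le_rpow_of_nonpos (by positivity) ?_ (by norm_num)
          have h3 := hs2 i hi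
          unfold tau at h3
          exact_mod_cast (by omega : n ≤ i.2)
        rw [h1]
        calc 84 * W.V * ((i.2:ℝ) ^ (-(9/8) : ℝ) * (i.2:ℝ) ^ (-(1/8) : ℝ))
            ≤ 84 * W.V * ((i.2:ℝ) ^ (-(9/8) : ℝ) * (n:ℝ) ^ (-(1/8) : ℝ)) := by gcongr
          _ = _ := by ring
    _ ≤ S * (84 * W.V * (n:ℝ) ^ (-(1/8) : ℝ)) := by
        rw [← Finset.sum_mul]
        exact mul_le_mul_of_nonneg_right (sum_rpow_le (by norm_num) s) (by positivity)
    _ = 84 * S * (n:ℝ) ^ (-(1/8) : ℝ) * W.V := by ring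
    _ ≤ _ := by gcongr

lemma exists_sum_tau {ρ : ℝ} (hρ : 0 < ρ) : ∃ L : ℝ, 0 ≤ L ∧ ∀ W : Seg, W.Valid → ∀ s ⊆ W.pcs,
    ∑ i ∈ s, W.w i * tau i ≤ L + ρ * W.V := by
  obtain ⟨n, hn⟩ := exists_tail hρ
  refine ⟨n, by positivity, fun W hW s hs => ?_⟩
  have h1 := hn W hW (s.filter fun i => ¬ tau i ≤ n) ((Finset.filter_subset _ _).trans hs)
    (fun i hi => by simpa using (Finset.mem_filter.1 hi).2)
  rw [← Finset.sum_filter_add_sum_filter_not s (fun i => tau i ≤ n)]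
  refine add_le_add ?_ h1
  calc ∑ i ∈ s.filter (fun i => tau i ≤ n), W.w i * tau i
      ≤ ∑ i ∈ s.filter (fun i => tau i ≤ n), W.w i * n := by
        refine Finset.sum_le_sum fun i hi => mul_le_mul_of_nonneg_left ?_ (Seg.w_nonneg hW i)
        exact_mod_cast (Finset.mem_filter.1 hi).2
    _ ≤ 1 * n := by
        rw [← Finset.sum_mul]
        gcongr
        exact Seg.sum_w_le hW ((Finset.filter_subset _ _).trans hs)
    _ = n := one_mul _

end
end LTM

namespace LTM

/-- Comparison of averages over two segments at two times. -/
def FarAt (f : ℕ → ℝ → ℝ → ℝ) (g : ℕ → ℝ) (κ K : ℝ) (W : Seg) (m : ℕ)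
    (W' : Seg) (n : ℕ) : Prop :=
  |A f m W - A f n W'| ≤ W.V * g m + W'.V * g n + (K + κ * |(m:ℝ) - n|) * g (min m n)

/-- `FarAt` for all pairs of total time less than `N`. -/
def FarLt (f : ℕ → ℝ → ℝ → ℝ) (g : ℕ → ℝ) (κ K : ℝ) (N : ℕ) : Prop :=
  ∀ W W' : Seg, W.Valid → W'.Valid → ∀ m m', m + m' < N → FarAt f g κ K W m W' m'

variable {f : ℕ → ℝ → ℝ → ℝ} {M c α : ℝ} {g : ℕ → ℝ} {ζ CD K : ℝ}

lemma FarAt.symm {κ : ℝ} {W W' : Seg} {m m' : ℕ} (h : FarAt f g κ K W m W' m') :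
    FarAt f g κ K W' m' W m := by
  unfold FarAt at *
  rw [abs_sub_comm, abs_sub_comm (m':ℝ), min_comm]
  linarith

lemma sum_w_res_le {W : Seg} (hW : W.Valid) (m : ℕ) : ∑ i ∈ W.res m, W.w i ≤ 1 :=
  Seg.sum_w_le hW (W.res_subset m)

lemma one_le_tau {i : Br} (h : 1 ≤ i.2) : 1 ≤ tau i := by unfold tau; omega

lemma far_ahead (hf : Dyn f M c α) (hg : Slow g ζ (2 * M)) (hCD1 : 1 ≤ CD) (hCD : Drift CD)
    (hK : 1 ≤ K) (hζ : ζ * (84 * (2 + K + CD)) ≤ 1 / 400) {R0 : ℕ}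
    (hR : ∀ W : Seg, W.Valid → ∀ s ⊆ W.pcs, (∀ i ∈ s, R0 < tau i) →
      ∑ i ∈ s, W.w i * tau i ≤ 1 / (400 * CD) * W.V)
    {W W' : Seg} (hW : W.Valid) (hW' : W'.Valid) {m m' : ℕ} (hd : m' + R0 ≤ m)
    (hd1 : m' < m) (IH : FarLt f g CD K (m + m')) : FarAt f g CD K W m W' m' := by
  have hV := Seg.one_le_V hW
  have hV' := Seg.one_le_V hW'
  have hgm := hg.pos m
  have hgm' := hg.pos m'
  have hgg : g m ≤ g m' := hg.anti hd1.le
  set d : ℝ := (m:ℝ) - m' with hdd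
  have hd0 : 1 ≤ d := by
    have : (m':ℝ) + 1 ≤ m := by exact_mod_cast hd1
    linarith
  set big := (W.res m).filter fun i => ¬ tau i ≤ m - m' with hbig
  have hbs : big ⊆ W.res m := Finset.filter_subset _ _
  have key : ∀ i ∈ W.res m, |A f (m - tau i) (W.child i) - A f m' W'| ≤
      (W.child i).V * g (m - tau i) + (W'.V * g m' + if tau i ≤ m - m' then
        (K + CD * (d - 1)) * g m' else (K + CD * tau i) * g (m - tau i)) := by
    intro i hi
    obtain ⟨h1, h2⟩ := (Seg.mem_res hW).1 hi
    have ht := one_le_tau (Seg.Act.one_le i h1).1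
    have h := IH _ _ (Seg.child_valid hW h1) hW' (m - tau i) m' (by omega)
    unfold FarAt at h
    rw [Nat.cast_sub h2] at h
    have ht' : (1:ℝ) ≤ tau i := by exact_mod_cast ht
    refine h.trans ?_
    rw [add_assoc]
    gcongr
    split_ifs with h3
    · rw [min_eq_right (by omega)]
      have h4 : (tau i : ℝ) ≤ m - m' := by
        rw [← Nat.cast_sub hd1.le]; exact_mod_cast h3
      rw [abs_of_nonneg (by linarith)]
      refine mul_le_mul_of_nonneg_right ?_ hgm'.le
      have := mul_le_mul_of_nonneg_left (by linarith : (m:ℝ) - tau i - m' ≤ d - 1) (by linarith : 0 ≤ CD)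
      linarith
    · rw [min_eq_left (by omega)]
      have h4 : (m:ℝ) - m' ≤ tau i := by
        rw [← Nat.cast_sub hd1.le]; exact_mod_cast (by omega : m - m' ≤ tau i)
      have := hg.pos (m - tau i)
      rw [abs_of_nonpos (by linarith)]
      gcongr
      linarith
  have h1 := hf.advance_V hg hCD1 hCD m hW (hf.A_le m' hW') key
  have hw : ∀ i, 0 ≤ W.w i := Seg.w_nonneg hW
  have hact : ∀ i ∈ big, W.Act i := fun i hi => ((Seg.mem_res hW).1 (hbs hi)).1
  have h2 := hg.sum_star hW hbs (fun i => W.w i) (fun i hi => ⟨hw i, Seg.w_le'' hW (hact i hi)⟩)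
  have h3 := hg.sum_star hW hbs (fun i => W.w i * tau i) (fun i hi =>
    ⟨mul_nonneg (hw i) (by positivity), Seg.w_mul_tau_le hW (hact i hi)⟩)
  have h4 := hR W hW big (hbs.trans (W.res_subset m)) (fun i hi => by
    have := (Finset.mem_filter.1 hi).2
    omega)
  have h5 : ∑ i ∈ W.res m, W.w i * (W'.V * g m' + if tau i ≤ m - m' then
        (K + CD * (d - 1)) * g m' else (K + CD * tau i) * g (m - tau i)) =
      (∑ i ∈ W.res m, W.w i) * (W'.V * g m') +
      ((∑ i ∈ (W.res m).filter fun i => tau i ≤ m - m', W.w i) * ((K + CD * (d - 1)) * g m') +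
        (K * ∑ i ∈ big, W.w i * g (m - tau i) +
          CD * ∑ i ∈ big, W.w i * tau i * g (m - tau i))) := by
    have e : ∀ i, W.w i * (W'.V * g m' + if tau i ≤ m - m' then
        (K + CD * (d - 1)) * g m' else (K + CD * tau i) * g (m - tau i)) =
        W.w i * (W'.V * g m') + if tau i ≤ m - m' then W.w i * ((K + CD * (d - 1)) * g m')
          else K * (W.w i * g (m - tau i)) + CD * (W.w i * tau i * g (m - tau i)) := by
      intro i
      split_ifs <;> ring
    simp only [e]
    rw [Finset.sum_add_distrib, Finset.sum_ite, ← Finset.sum_mul, ← Finset.sum_mul,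
      Finset.sum_add_distrib, ← Finset.mul_sum, ← Finset.mul_sum]
  have h6 : (∑ i ∈ (W.res m).filter fun i => tau i ≤ m - m', W.w i) + ∑ i ∈ big, W.w i ≤ 1 := by
    rw [Finset.sum_filter_add_sum_filter_not]; exact sum_w_res_le hW m
  have h7 := sum_w_res_le hW m
  rw [h5] at h1
  set s1 := ∑ i ∈ (W.res m).filter fun i => tau i ≤ m - m', W.w i
  set s2 := ∑ i ∈ big, W.w i
  have hs1 : 0 ≤ s1 := Finset.sum_nonneg fun i _ => hw i
  have hs2 : 0 ≤ s2 := Finset.sum_nonneg fun i _ => hw i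
  unfold FarAt
  rw [min_eq_right hd1.le, ← hdd, abs_of_nonneg (a := d) (by linarith)]
  refine h1.trans ?_
  have e1 : (∑ i ∈ W.res m, W.w i) * (W'.V * g m') ≤ 1 * (W'.V * g m') := by gcongr
  have e2 : s1 * ((K + CD * (d - 1)) * g m') + K * (s2 * g m) ≤ (K + CD * (d - 1)) * g m' := by
    have : K * (s2 * g m) ≤ s2 * ((K + CD * (d - 1)) * g m') := by
      have : K * g m ≤ (K + CD * (d - 1)) * g m' := by
        gcongr
        nlinarith
      nlinarith
    have hp : 0 ≤ (K + CD * (d - 1)) * g m' := by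
      have : 0 ≤ CD * (d - 1) := mul_nonneg (by linarith) (by linarith)
      positivity
    nlinarith
  have e3 : CD * (∑ i ∈ big, W.w i * tau i) ≤ 1 / 400 * W.V := by
    calc CD * (∑ i ∈ big, W.w i * tau i) ≤ CD * (1 / (400 * CD) * W.V) := by gcongr
      _ = _ := by field_simp
  have e4 : CD * (∑ i ∈ big, W.w i * tau i) * g m ≤ 1 / 400 * W.V * g m := by gcongr
  have e5 : K * ∑ i ∈ big, W.w i * g (m - tau i) ≤ K * (s2 * g m + ζ * (84 * W.V) * g m) := by
    gcongr
  have e6 : CD * ∑ i ∈ big, W.w i * tau i * g (m - tau i) ≤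
      CD * ((∑ i ∈ big, W.w i * tau i) * g m + ζ * (84 * W.V) * g m) := by
    gcongr
  have e7 : ζ * (84 * (2 + K + CD)) * (W.V * g m) ≤ 1 / 400 * (W.V * g m) := by gcongr
  have e8 : CD * g m ≤ CD * g m' := by gcongr
  have e9 : 0 ≤ W.V * g m := by positivity
  nlinarith

/-- The comparison when one of the segments is bad and times are close. -/
lemma far_bad (hf : Dyn f M c α) (hg : Slow g ζ (2 * M)) (hCD1 : 1 ≤ CD) (hCD : Drift CD)
    (hK : 1 ≤ K) {R0 : ℕ} {L V0 : ℝ} (hL : 0 ≤ L)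
    (hζ : ζ * (84 * (2 + K + CD * (R0 + 1))) ≤ 1 / 400)
    (hR : ∀ W : Seg, W.Valid → ∀ s ⊆ W.pcs,
      ∑ i ∈ s, W.w i * tau i ≤ L + 1 / (400 * CD * 2 ^ R0) * W.V)
    (hV0 : 400 * (CD + CD * (R0 + L) * 2 ^ R0) ≤ V0)
    {W W' : Seg} (hW : W.Valid) (hW' : W'.Valid) {m m' : ℕ} (hd : m ≤ m' + R0)
    (hd' : m' ≤ m + R0) (hWV : V0 ≤ W.V) (IH : FarLt f g CD K (m + m')) :
    FarAt f g CD K W m W' m' := by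
  have hV := Seg.one_le_V hW
  have hV' := Seg.one_le_V hW'
  have hgm := hg.pos m
  have hgm' := hg.pos m'
  have hgn := hg.pos (min m m')
  have hg2 : ∀ k n, g n ≤ 2 ^ k * g (n + k) := by
    intro k
    induction k with
    | zero => simp
    | succ k ih =>
      intro n
      have := ih n
      have h2 := hg.two (n + k)
      rw [pow_succ, ← add_assoc]
      have : (0:ℝ) < 2 ^ k := by positivity
      nlinarith
  have hgg : g (min m m') ≤ 2 ^ R0 * g m :=
    (hg2 R0 _).trans (mul_le_mul_of_nonneg_left (hg.anti (by omega)) (by positivity))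
  have hd0 : |(m:ℝ) - m'| ≤ R0 := by
    rw [abs_le]
    have h1 : (m:ℝ) ≤ m' + R0 := by exact_mod_cast hd
    have h2 : (m':ℝ) ≤ m + R0 := by exact_mod_cast hd'
    constructor <;> linarith
  have key : ∀ i ∈ W.res m, |A f (m - tau i) (W.child i) - A f m' W'| ≤
      (W.child i).V * g (m - tau i) + (W'.V * g m' +
        (K + CD * R0 + CD * tau i) * g (min (m - tau i) m')) := by
    intro i hi
    obtain ⟨h1, h2⟩ := (Seg.mem_res hW).1 hi
    have ht := one_le_tau (Seg.Act.one_le i h1).1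
    have h := IH _ _ (Seg.child_valid hW h1) hW' (m - tau i) m' (by omega)
    unfold FarAt at h
    rw [Nat.cast_sub h2] at h
    refine h.trans ?_
    have := hg.pos (min (m - tau i) m')
    rw [add_assoc]
    refine add_le_add_right (add_le_add_right (mul_le_mul_of_nonneg_right ?_ this.le) _) _
    have h4 : |(m:ℝ) - tau i - m'| ≤ R0 + tau i := by
      rw [abs_le] at *
      have : (0:ℝ) ≤ tau i := by positivity
      constructor <;> linarith
    nlinarith
  have h1 := hf.advance_V hg hCD1 hCD m hW (hf.A_le m' hW') key
  have hw : ∀ i, 0 ≤ W.w i := Seg.w_nonneg hW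
  have hact : ∀ i ∈ W.res m, W.Act i := fun i hi => ((Seg.mem_res hW).1 hi).1
  have h2 := hg.sum_min hW (m' := m') subset_rfl (fun i => W.w i)
    (fun i hi => ⟨hw i, Seg.w_le'' hW (hact i hi)⟩)
  have h3 := hg.sum_min hW (m' := m') subset_rfl (fun i => W.w i * tau i) (fun i hi =>
    ⟨mul_nonneg (hw i) (by positivity), Seg.w_mul_tau_le hW (hact i hi)⟩)
  have h4 := hR W hW (W.res m) (W.res_subset m)
  have h5 : ∑ i ∈ W.res m, W.w i * (W'.V * g m' +
        (K + CD * R0 + CD * tau i) * g (min (m - tau i) m')) =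
      (∑ i ∈ W.res m, W.w i) * (W'.V * g m') +
        ((K + CD * R0) * ∑ i ∈ W.res m, W.w i * g (min (m - tau i) m') +
          CD * ∑ i ∈ W.res m, W.w i * tau i * g (min (m - tau i) m')) := by
    rw [Finset.sum_mul, Finset.mul_sum, Finset.mul_sum, ← Finset.sum_add_distrib,
      ← Finset.sum_add_distrib]
    refine Finset.sum_congr rfl fun i _ => ?_
    ring
  have h7 := sum_w_res_le hW m
  rw [h5] at h1
  set s2 := ∑ i ∈ W.res m, W.w i
  have hs2 : 0 ≤ s2 := Finset.sum_nonneg fun i _ => hw i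
  unfold FarAt
  refine h1.trans ?_
  have e0 : 0 ≤ CD * |(m:ℝ) - m'| * g (min m m') := by positivity
  have e1 : s2 * (W'.V * g m') ≤ 1 * (W'.V * g m') := by gcongr
  have e2 : (K + CD * R0) * (∑ i ∈ W.res m, W.w i * g (min (m - tau i) m')) ≤
      (K + CD * R0) * (1 * g (min m m') + ζ * (84 * W.V) * g m) := by
    gcongr
    exact h2.trans (by gcongr)
  have e3 : CD * ∑ i ∈ W.res m, W.w i * tau i * g (min (m - tau i) m') ≤
      CD * ((L + 1 / (400 * CD * 2 ^ R0) * W.V) * g (min m m') + ζ * (84 * W.V) * g m) := by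
    gcongr
    exact h3.trans (by gcongr)
  have e4 : CD * (1 / (400 * CD * 2 ^ R0) * W.V) * g (min m m') ≤ 1 / 400 * W.V * g m := by
    calc CD * (1 / (400 * CD * 2 ^ R0) * W.V) * g (min m m')
        ≤ CD * (1 / (400 * CD * 2 ^ R0) * W.V) * (2 ^ R0 * g m) := by gcongr
      _ = _ := by field_simp
  have e5 : CD * (R0 + L) * g (min m m') ≤ CD * (R0 + L) * (2 ^ R0 * g m) := by gcongr
  have e6 : (CD + CD * (R0 + L) * 2 ^ R0) * g m ≤ 1 / 400 * W.V * g m := by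
    gcongr
    linarith
  have e7 : ζ * (84 * (2 + K + CD * (R0 + 1))) * (W.V * g m) ≤ 1 / 400 * (W.V * g m) := by gcongr
  have e9 : 0 ≤ W.V * g m := by positivity
  nlinarith

end LTM

namespace LTM

/-- Two segments over the same interval and close to each other. -/
structure Near (W W' : Seg) (δ : ℝ) : Prop where
  lo : W.lo = W'.lo
  hi : W.hi = W'.hi
  h0 : |W.h W.lo - W'.h W.lo| ≤ δ
  h1 : |W.h W.hi - W'.h W.hi| ≤ δ

/-- Comparison of averages over two nearby segments. -/
def CloseAt (f : ℕ → ℝ → ℝ → ℝ) (g : ℕ → ℝ) (σ K2 K3 : ℝ) (W W' : Seg) (m : ℕ) : Prop :=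
  ∀ δ : ℝ, 0 < δ → δ ≤ 1 → Near W W' δ →
    |A f m W - A f m W'| ≤ K2 * δ ^ σ * (W.D + W'.D + K3) * g m

def CloseLt (f : ℕ → ℝ → ℝ → ℝ) (g : ℕ → ℝ) (σ K2 K3 : ℝ) (N : ℕ) : Prop :=
  ∀ W U : Seg, W.Valid → U.Valid → ∀ m, 2 * m < N → CloseAt f g σ K2 K3 W U m

/-- On the class `T`, the comparison constant `K` improves by a definite factor. -/
def Good (f : ℕ → ℝ → ℝ → ℝ) (M CD σ c6 K3 : ℝ) (b : ℕ) (T : Seg → Seg → ℤ → Prop) : Prop :=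
  ∃ C β : ℝ, 0 ≤ C ∧ 0 < β ∧ β ≤ 1 ∧ ∀ (g : ℕ → ℝ) (ζ K : ℝ), 1 ≤ K → 0 < ζ → ζ * K ≤ 1 →
    Slow g ζ (2 * M) → ∀ N, FarLt f g CD K N → CloseLt f g σ (c6 * (1 + K)) K3 N →
    ∀ W W' : Seg, W.Valid → W'.Valid → ∀ m m' : ℕ, T W W' ((m:ℤ) - m') → m + m' + b ≤ N →
      |A f m W - A f m' W'| ≤ (C + (1 - β) * K) * g (min m m')

variable {f : ℕ → ℝ → ℝ → ℝ} {M c α : ℝ} {CD σ c6 K3 : ℝ}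
  {T T1 T2 : Seg → Seg → ℤ → Prop}

lemma Good.mono {b : ℕ} (h : Good f M CD σ c6 K3 b T)
    (hT : ∀ W W' d, W.Valid → W'.Valid → T1 W W' d → T W W' d) : Good f M CD σ c6 K3 b T1 := by
  obtain ⟨C, β, h1, h2, h3, h4⟩ := h
  exact ⟨C, β, h1, h2, h3, fun g ζ K a1 a2 a3 a4 N a5 a6 W W' hW hW' m m' hm hN =>
    h4 g ζ K a1 a2 a3 a4 N a5 a6 W W' hW hW' m m' (hT W W' _ hW hW' hm) hN⟩

lemma Good.one (h : Good f M CD σ c6 K3 0 T) : Good f M CD σ c6 K3 1 T := by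
  obtain ⟨C, β, h1, h2, h3, h4⟩ := h
  exact ⟨C, β, h1, h2, h3, fun g ζ K a1 a2 a3 a4 N a5 a6 W W' hW hW' m m' hm hN =>
    h4 g ζ K a1 a2 a3 a4 N a5 a6 W W' hW hW' m m' hm (by omega)⟩

lemma Good.swap {b : ℕ} (h : Good f M CD σ c6 K3 b T) :
    Good f M CD σ c6 K3 b (fun W W' d => T W' W (-d)) := by
  obtain ⟨C, β, h1, h2, h3, h4⟩ := h
  refine ⟨C, β, h1, h2, h3, fun g ζ K a1 a2 a3 a4 N a5 a6 W W' hW hW' m m' hm hN => ?_⟩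
  rw [abs_sub_comm, min_comm]
  exact h4 g ζ K a1 a2 a3 a4 N a5 a6 W' W hW' hW m' m 
    (by have h5 : T W' W (-((m:ℤ) - m')) := hm
        rwa [neg_sub] at h5) (by omega)

lemma Good.or {b : ℕ} (h : Good f M CD σ c6 K3 b T1) (h' : Good f M CD σ c6 K3 b T2) :
    Good f M CD σ c6 K3 b (fun W W' d => T1 W W' d ∨ T2 W W' d) := by
  obtain ⟨C, β, h1, h2, h3, h4⟩ := h
  obtain ⟨C', β', h1', h2', h3', h4'⟩ := h'
  refine ⟨max C C', min β β', le_max_of_le_left h1, lt_min h2 h2', min_le_of_left_le h3,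
    fun g ζ K a1 a2 a3 a4 N a5 a6 W W' hW hW' m m' hm hN => ?_⟩
  have hg := a4.pos (min m m')
  rcases hm with hm | hm
  · refine (h4 g ζ K a1 a2 a3 a4 N a5 a6 W W' hW hW' m m' hm hN).trans ?_
    gcongr
    · exact le_max_left _ _
    · exact min_le_left _ _
  · refine (h4' g ζ K a1 a2 a3 a4 N a5 a6 W W' hW hW' m m' hm hN).trans ?_
    gcongr
    · exact le_max_right _ _
    · exact min_le_right _ _

set_option maxHeartbeats 1000000 in
lemma Good.step (hf : Dyn f M c α) (hCD1 : 1 ≤ CD) (hCD : Drift CD)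
    (h1 : Good f M CD σ c6 K3 1 T1) {v d0 w0 : ℝ} {k0 : ℕ} (hw0 : 0 < w0)
    (hT : ∀ W W' d, W.Valid → W'.Valid → T W W' d → W.V ≤ v ∧ W'.V ≤ v ∧ |(d:ℝ)| ≤ d0 ∧
      ∃ i, W.Act i ∧ i.2 ≤ k0 ∧ w0 ≤ W.w i ∧ T1 (W.child i) W' (d - tau i)) :
    Good f M CD σ c6 K3 0 T := by
  obtain ⟨C1, β1, hC1, hβ1, hβ1', h1⟩ := h1
  obtain ⟨L, hL, hLs⟩ := exists_sum_tau one_pos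
  have hM := hf.M_nonneg
  set v1 := max v 1
  set dd0 := max d0 0
  refine ⟨(v1 + CD + 168 * v1) + v1 + (C1 + CD * dd0) + 84 * v1 * (C1 + 1 + CD * dd0) +
    CD * (L + v1 + 84 * v1) + (2 * k0 + 1) ^ (5/4 : ℝ), min w0 1 * β1, by positivity,
    by positivity, ?_, ?_⟩
  · exact mul_le_one₀ (min_le_right _ _) hβ1.le hβ1'
  intro g ζ K hK hζ hζK hg N hfar hclose W W' hW hW' m m' hTW hN
  obtain ⟨hv, hv', hd, i0, hi0, hk0, hw, hT1⟩ := hT W W' _ hW hW' hTW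
  replace hv : W.V ≤ v1 := hv.trans (le_max_left _ _)
  replace hv' : W'.V ≤ v1 := hv'.trans (le_max_left _ _)
  replace hd := hd.trans (le_max_left d0 0)
  push_cast at hd
  have hV := Seg.one_le_V hW
  have hV' := Seg.one_le_V hW'
  have hgm := hg.pos m
  set G := g (min m m')
  have hG : 0 < G := hg.pos _
  have hgG : g m ≤ G := hg.anti (min_le_left _ _)
  have hgG' : g m' ≤ G := hg.anti (min_le_right _ _)
  have hv1 : 1 ≤ v1 := le_max_right _ _
  have hdd0 : 0 ≤ dd0 := le_max_right _ _
  have hβ2 : min w0 1 * β1 ≤ 1 := mul_le_one₀ (min_le_right _ _) hβ1.le hβ1'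
  by_cases hm0 : tau i0 ≤ m
  swap
  · have e1 := hg.low m
    have e2 : ((m:ℝ) + 1) ≤ 2 * k0 + 1 := by
      unfold tau at hm0
      exact_mod_cast (by omega : m + 1 ≤ 2 * k0 + 1)
    have e3 : (2 * (k0:ℝ) + 1) ^ (-(5/4) : ℝ) ≤ ((m:ℝ) + 1) ^ (-(5/4) : ℝ) :=
      Real.rpow_le_rpow_of_nonpos (by positivity) e2 (by norm_num)
    have e4 : (0:ℝ) < (2 * k0 + 1) ^ (5/4 : ℝ) := by positivity
    have e5 : 2 * M ≤ (2 * k0 + 1) ^ (5/4 : ℝ) * G := by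
      rw [Real.rpow_neg (by positivity)] at e3
      have : 2 * M * ((2 * (k0:ℝ) + 1) ^ (5/4 : ℝ))⁻¹ ≤ G := by
        calc _ ≤ 2 * M * ((m:ℝ) + 1) ^ (-(5/4) : ℝ) := by gcongr
          _ ≤ ζ * g m := e1
          _ ≤ 1 * g m := by gcongr; nlinarith
          _ ≤ G := by linarith
      rwa [← div_eq_mul_inv, div_le_iff₀ e4, mul_comm G] at this
    have e6 := abs_sub (A f m W) (A f m' W')
    have e7 := hf.A_le m hW
    have e8 := hf.A_le m' hW'
    refine (by linarith : _ ≤ (2 * (k0:ℝ) + 1) ^ (5/4 : ℝ) * G).trans ?_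
    refine mul_le_mul_of_nonneg_right ?_ hG.le
    have e9 : 0 ≤ (1 - min w0 1 * β1) * K := mul_nonneg (by linarith) (by linarith)
    have e10 : 0 ≤ (v1 + CD + 168 * v1) + v1 + (C1 + CD * dd0) + 84 * v1 * (C1 + 1 + CD * dd0) +
      CD * (L + v1 + 84 * v1) := by positivity
    linarith
  have hi0m : i0 ∈ W.res m := (Seg.mem_res hW).2 ⟨hi0, hm0⟩
  have key : ∀ i ∈ W.res m, |A f (m - tau i) (W.child i) - A f m' W'| ≤
      (W.child i).V * g (m - tau i) + (W'.V * g m' + ((C1 + K + CD * dd0) + CD * tau i) *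
        g (min (m - tau i) m') - if i = i0 then β1 * K * G else 0) := by
    intro i hi
    obtain ⟨h3, h2⟩ := (Seg.mem_res hW).1 hi
    have ht := one_le_tau (Seg.Act.one_le i h3).1
    have hcv := Seg.child_valid hW h3
    have hgp := hg.pos (min (m - tau i) m')
    have hgp' := hg.pos (m - tau i)
    have hgm' := hg.pos m'
    have hcV := Seg.one_le_V hcv
    split_ifs with h0
    · have h := h1 g ζ K hK hζ hζK hg N hfar hclose _ W' hcv hW' (m - tau i) m'
        (by rw [h0, Nat.cast_sub (by rw [← h0]; exact h2), sub_right_comm]; exact hT1) (by omega)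
      have h4 : G ≤ g (min (m - tau i) m') := hg.anti (by omega)
      have h5 : β1 * K * G ≤ β1 * K * g (min (m - tau i) m') := by gcongr
      have h6 : 0 ≤ (CD * dd0 + CD * tau i) * g (min (m - tau i) m') := by positivity
      have h7 : 0 ≤ (W.child i).V * g (m - tau i) := by positivity
      have h8 : 0 ≤ W'.V * g m' := by positivity
      linarith
    · have h := hfar _ _ hcv hW' (m - tau i) m' (by omega)
      unfold FarAt at h
      rw [Nat.cast_sub h2] at h
      rw [sub_zero, ← add_assoc]
      refine h.trans (add_le_add_right (mul_le_mul_of_nonneg_right ?_ hgp.le) _)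
      have h4 : |(m:ℝ) - tau i - m'| ≤ dd0 + tau i := by
        rw [abs_le] at *
        have : (0:ℝ) ≤ tau i := by positivity
        constructor <;> linarith
      nlinarith
  have h3 := hf.advance_V hg hCD1 hCD m hW (hf.A_le m' hW') key
  have hwn : ∀ i, 0 ≤ W.w i := Seg.w_nonneg hW
  have hact : ∀ i ∈ W.res m, W.Act i := fun i hi => ((Seg.mem_res hW).1 hi).1
  have h4 := hg.sum_min hW (m' := m') subset_rfl (fun i => W.w i)
    (fun i hi => ⟨hwn i, Seg.w_le'' hW (hact i hi)⟩)
  have h5 := hg.sum_min hW (m' := m') subset_rfl (fun i => W.w i * tau i) (fun i hi =>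
    ⟨mul_nonneg (hwn i) (by positivity), Seg.w_mul_tau_le hW (hact i hi)⟩)
  have h6 := hLs W hW (W.res m) (W.res_subset m)
  have h7 : ∑ i ∈ W.res m, W.w i * (W'.V * g m' + ((C1 + K + CD * dd0) + CD * tau i) *
        g (min (m - tau i) m') - if i = i0 then β1 * K * G else 0) =
      (∑ i ∈ W.res m, W.w i) * (W'.V * g m') +
        ((C1 + K + CD * dd0) * ∑ i ∈ W.res m, W.w i * g (min (m - tau i) m') +
          CD * ∑ i ∈ W.res m, W.w i * tau i * g (min (m - tau i) m')) - W.w i0 * (β1 * K * G) := by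
    have : W.w i0 * (β1 * K * G) =
        ∑ i ∈ W.res m, if i = i0 then W.w i * (β1 * K * G) else 0 := by
      rw [Finset.sum_ite_eq', if_pos hi0m]
    rw [this, Finset.sum_mul, Finset.mul_sum, Finset.mul_sum, ← Finset.sum_add_distrib,
      ← Finset.sum_add_distrib, ← Finset.sum_sub_distrib]
    refine Finset.sum_congr rfl fun i _ => ?_
    split_ifs <;> ring
  have h8 := sum_w_res_le hW m
  rw [h7] at h3
  set s2 := ∑ i ∈ W.res m, W.w i
  have hs2 : 0 ≤ s2 := Finset.sum_nonneg fun i _ => hwn i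
  have hζ1 : ζ ≤ 1 := by nlinarith
  have hgm' := hg.pos m'
  refine h3.trans ?_
  have hE : ζ * (84 * W.V) * g m ≤ ζ * (84 * v1) * G := by gcongr
  have hE1 : ζ * (84 * v1) * G ≤ 1 * (84 * v1) * G := by gcongr
  have e1 : (99/100 * W.V + CD + ζ * (168 * W.V)) * g m ≤ (v1 + CD + 168 * v1) * G := by
    have : 99/100 * W.V + CD + ζ * (168 * W.V) ≤ v1 + CD + 168 * v1 := by
      have : ζ * (168 * W.V) ≤ 1 * (168 * v1) := by gcongr
      linarith
    calc _ ≤ (v1 + CD + 168 * v1) * g m := by gcongr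
      _ ≤ _ := by gcongr
  have e2 : s2 * (W'.V * g m') ≤ 1 * (v1 * G) := by gcongr
  have e3 : (C1 + K + CD * dd0) * ∑ i ∈ W.res m, W.w i * g (min (m - tau i) m') ≤
      (C1 + K + CD * dd0) * (1 * G + ζ * (84 * v1) * G) := by
    gcongr
    exact h4.trans (add_le_add (by gcongr) hE)
  have e3' : (C1 + K + CD * dd0) * (ζ * (84 * v1) * G) ≤ 84 * v1 * (C1 + 1 + CD * dd0) * G := by
    have : (C1 + K + CD * dd0) * ζ ≤ C1 + 1 + CD * dd0 := by
      have a1 : C1 * ζ ≤ C1 * 1 := by gcongr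
      have a2 : CD * dd0 * ζ ≤ CD * dd0 * 1 := by gcongr
      nlinarith
    calc _ = ((C1 + K + CD * dd0) * ζ) * (84 * v1 * G) := by ring
      _ ≤ (C1 + 1 + CD * dd0) * (84 * v1 * G) := by gcongr
      _ = _ := by ring
  have e4 : CD * ∑ i ∈ W.res m, W.w i * tau i * g (min (m - tau i) m') ≤
      CD * ((L + v1) * G + 84 * v1 * G) := by
    gcongr
    refine h5.trans (add_le_add ?_ (by linarith))
    gcongr
    linarith
  have e5 : min w0 1 * (β1 * K * G) ≤ W.w i0 * (β1 * K * G) := by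
    gcongr
    exact (min_le_left _ _).trans hw
  have e6 : 0 ≤ (2 * (k0:ℝ) + 1) ^ (5/4 : ℝ) * G := by positivity
  linarith

end LTM

namespace LTM

namespace Seg

/-- Segments crossing the square near the antidiagonal branch. -/
structure Full (W : Seg) : Prop where
  lo : W.lo = 0
  hi : W.hi = 1
  a0 : 1 / 4 ≤ W.h 0
  a1 : W.h 0 ≤ 1 / 2
  b0 : 1 / 2 ≤ W.h 1
  b1 : W.h 1 ≤ 3 / 4

variable {W : Seg}

lemma V_le_D (hW : W.Valid) : W.V ≤ W.D := by
  have := Real.rpow_le_rpow_of_exponent_le (one_le_D hW) (by norm_num : (9/10:ℝ) ≤ 1)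
  rwa [Real.rpow_one] at this

lemma V_le_of (hW : W.Valid) {l e : ℝ} (hl : 0 < l) (he : 0 < e) (h1 : l ≤ W.len)
    (h2 : e ≤ W.eps) : W.V ≤ (1 + (1 / 10) / √e) / l := by
  refine (V_le_D hW).trans ?_
  unfold D
  have := chi_le_of he h2
  gcongr

lemma FullC.spec (hW : W.Valid) (h : W.FullC) : W.Act (false, 2) ∧
    W.pl (false, 2) = W.cc 2 ∧ W.ph (false, 2) = W.dd 2 := by
  obtain ⟨h1, h2⟩ := h
  have h3 := dd_le_cc_two hW
  have e1 := (cc_le_iff hW (by norm_num : 1 ≤ 2)).1 le_rfl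
  have e2 := (le_cc_iff hW (by norm_num : 1 ≤ 2)).1 le_rfl
  have e3 := (dd_le_iff hW (by norm_num : 1 ≤ 2)).1 le_rfl
  have e4 := (le_dd_iff hW (by norm_num : 1 ≤ 2)).1 le_rfl
  push_cast at e1 e2 e3 e4
  have h5 := hW.h_nonneg h1
  have h6 := hW.h_le h2
  have h7 : W.dd 1 ≤ W.cc 2 := (dd_le_iff hW le_rfl).2 (by push_cast; linarith)
  have h8 : W.dd 2 ≤ W.cc 1 := (le_cc_iff hW le_rfl).2 (by push_cast; linarith)
  have h9 : W.cc 2 < W.dd 2 := by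
    refine lt_of_le_of_ne h3.2.2.2 fun h => ?_
    rw [← h] at e3 e4
    linarith
  have p1 : W.pl (false, 2) = W.cc 2 := by
    change max W.lo (min W.hi (max (W.cc 2) (W.dd 1))) = _
    rw [max_eq_left h7, min_eq_right (h9.le.trans h2), max_eq_right h1]
  have p2 : W.ph (false, 2) = W.dd 2 := by
    change max W.lo (min W.hi (min (W.dd 2) (W.cc 1))) = _
    rw [min_eq_left h8, min_eq_right h2, max_eq_right (h1.trans h9.le)]
  exact ⟨by unfold Act; rw [p1, p2]; exact h9, p1, p2⟩

lemma FullC.w_ge (hW : W.Valid) (h : W.FullC) : 1 / 5 ≤ W.w (false, 2) := by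
  obtain ⟨_, h1, h2⟩ := FullC.spec hW h
  have h0 := hW.s0
  have h3 := hW.s1
  have h4 : 1 / 5 ≤ W.plen (false, 2) := by
    unfold plen
    rw [h1, h2]
    unfold cc dd
    rw [← sub_div]
    push_cast
    rw [div_le_div_iff₀ (by norm_num) (by linarith)]
    linarith
  unfold w
  rw [le_div_iff₀ (len_pos hW)]
  have := len_le hW
  linarith

lemma FullC.child_h (hW : W.Valid) (h : W.FullC) :
    (W.child (false, 2)).lo = 0 ∧ (W.child (false, 2)).hi = 1 ∧
      (W.child (false, 2)).h 0 = W.cc 2 ∧ (W.child (false, 2)).h 1 = W.dd 2 := by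
  obtain ⟨_, h1, h2⟩ := FullC.spec hW h
  have e1 := (cc_le_iff hW (by norm_num : 1 ≤ 2)).1 le_rfl
  have e2 := (le_cc_iff hW (by norm_num : 1 ≤ 2)).1 le_rfl
  have e3 := (dd_le_iff hW (by norm_num : 1 ≤ 2)).1 le_rfl
  have e4 := (le_dd_iff hW (by norm_num : 1 ≤ 2)).1 le_rfl
  push_cast at e1 e2 e3 e4
  have hY1 : W.Y (false, 2) (W.cc 2) = 0 := by
    unfold Y; simp only [jj]; push_cast; linarith
  have hY2 : W.Y (false, 2) (W.dd 2) = 1 := by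
    unfold Y; simp only [jj]; push_cast; linarith
  refine ⟨?_, ?_, ?_, ?_⟩
  · change W.Y (false, 2) (W.pl (false, 2)) = 0; rw [h1, hY1]
  · change W.Y (false, 2) (W.ph (false, 2)) = 1; rw [h2, hY2]
  · rw [← hY1, child_h_Y hW (by norm_num)]
  · rw [← hY2, child_h_Y hW (by norm_num)]

lemma FullC.child_full (hW : W.Valid) (h : W.FullC) : (W.child (false, 2)).Full := by
  obtain ⟨h1, h2, h3, h4⟩ := FullC.child_h hW h
  have e1 := (cc_le_iff hW (by norm_num : 1 ≤ 2)).1 le_rfl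
  have e2 := (le_cc_iff hW (by norm_num : 1 ≤ 2)).1 le_rfl
  have e3 := (dd_le_iff hW (by norm_num : 1 ≤ 2)).1 le_rfl
  have e4 := (le_dd_iff hW (by norm_num : 1 ≤ 2)).1 le_rfl
  have hcd := (dd_le_cc_two hW).2.2.2
  have b1 := hW.h_nonneg h.1
  have b2 := hW.h_le (hcd.trans h.2)
  have b3 := hW.h_nonneg (h.1.trans hcd)
  have b4 := hW.h_le h.2
  push_cast at e1 e2 e3 e4
  refine ⟨h1, h2, ?_, ?_, ?_, ?_⟩ <;> first | rw [h3] | rw [h4]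
  all_goals linarith

lemma Full.fullC (hW : W.Valid) (h : W.Full) : W.FullC := by
  obtain ⟨h1, h2, h3, h4, h5, h6⟩ := h
  refine ⟨(le_cc_iff hW (by norm_num)).2 ?_, (dd_le_iff hW (by norm_num)).2 ?_⟩
  · rw [h1]; push_cast; linarith
  · rw [h2]; push_cast; linarith

lemma Full.eps_ge (h : W.Full) : 1 ≤ W.eps := by
  obtain ⟨h1, h2, h3, h4, h5, h6⟩ := h
  unfold eps L1 L2
  rw [h1, h2]
  apply le_min <;> linarith

lemma Full.len_eq (h : W.Full) : W.len = 1 := by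
  unfold len; rw [h.lo, h.hi]; norm_num

lemma Full.V_le (hW : W.Valid) (h : W.Full) : W.V ≤ 3 := by
  refine (V_le_of hW one_pos one_pos h.len_eq.ge h.eps_ge).trans ?_
  norm_num

lemma Full.spec_A (hW : W.Valid) (h : W.Full) : W.Act (false, 1) ∧ 1 / 5 ≤ W.w (false, 1) ∧
    (W.child (false, 1)).FullC ∧ (W.child (false, 1)).V ≤ 3 := by
  obtain ⟨h1, h2, h3, h4, h5, h6⟩ := id h
  have h0 := hW.s0
  have hs1 := hW.s1
  have e3 := (dd_le_iff hW le_rfl).1 le_rfl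
  have e4 := (le_dd_iff hW le_rfl).1 le_rfl
  push_cast at e3 e4
  have d0 : 1 / 5 ≤ W.dd 1 := (le_dd_iff hW le_rfl).2 (by unfold Seg.h at *; push_cast; linarith)
  have d1 : W.dd 1 ≤ 1 := (dd_le_iff hW le_rfl).2 (by push_cast; linarith)
  have p1 : W.pl (false, 1) = 0 := h1
  have p2 : W.ph (false, 1) = W.dd 1 := by
    change max W.lo (min W.hi (W.dd 1)) = _
    rw [h1, h2, min_eq_right d1, max_eq_right (by linarith)]
  have hact : W.Act (false, 1) := by unfold Act; rw [p1, p2]; linarith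
  have hv := child_valid hW hact
  have q1 : W.Y (false, 1) 0 = W.h 0 := by unfold Y; simp [jj]
  have q2 : W.Y (false, 1) (W.dd 1) = 1 := by
    unfold Y; simp only [jj]; push_cast; linarith
  have c1 : (W.child (false, 1)).lo = W.h 0 := by
    change W.Y (false, 1) (W.pl (false, 1)) = _; rw [p1, q1]
  have c2 : (W.child (false, 1)).hi = 1 := by
    change W.Y (false, 1) (W.ph (false, 1)) = _; rw [p2, q2]
  have c3 : (W.child (false, 1)).h (W.h 0) = 0 := by rw [← q1, child_h_Y hW le_rfl]
  have c4 : (W.child (false, 1)).h 1 = W.dd 1 := by rw [← q2, child_h_Y hW le_rfl]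
  refine ⟨hact, ?_, ⟨(le_cc_iff hv (by norm_num)).2 ?_, (dd_le_iff hv (by norm_num)).2 ?_⟩, ?_⟩
  · unfold w plen
    rw [p1, p2, h.len_eq]; linarith
  · rw [c1, c3]; push_cast; linarith
  · rw [c2, c4]; push_cast; linarith
  · have h7 := child_eps hW hact
    have h8 := h.eps_ge
    refine (V_le_of hv (l := 1 / 2) (e := 1 / 4) (by norm_num) (by norm_num) ?_ (by linarith)).trans ?_
    · unfold len; rw [c1, c2]; linarith
    · rw [show (1/4:ℝ) = (1/2)^2 by norm_num, Real.sqrt_sq (by norm_num)]; norm_num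

/-- The central branch contracts distances by a factor four. -/
lemma Full.contract {W' : Seg} (hW : W.Valid) (hW' : W'.Valid) (h : W.Full) (h' : W'.Full) {δ : ℝ}
    (hd : Near W W' δ) : Near (W.child (false, 2)) (W'.child (false, 2)) (δ / 4) := by
  obtain ⟨a1, a2, a3, a4⟩ := FullC.child_h hW (h.fullC hW)
  obtain ⟨b1, b2, b3, b4⟩ := FullC.child_h hW' (h'.fullC hW')
  have e1 := (cc_le_iff hW (by norm_num : 1 ≤ 2)).1 le_rfl
  have e2 := (le_cc_iff hW (by norm_num : 1 ≤ 2)).1 le_rfl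
  have e3 := (dd_le_iff hW (by norm_num : 1 ≤ 2)).1 le_rfl
  have e4 := (le_dd_iff hW (by norm_num : 1 ≤ 2)).1 le_rfl
  have e1' := (cc_le_iff hW' (by norm_num : 1 ≤ 2)).1 le_rfl
  have e2' := (le_cc_iff hW' (by norm_num : 1 ≤ 2)).1 le_rfl
  have e3' := (dd_le_iff hW' (by norm_num : 1 ≤ 2)).1 le_rfl
  have e4' := (le_dd_iff hW' (by norm_num : 1 ≤ 2)).1 le_rfl
  push_cast at e1 e2 e3 e4 e1' e2' e3' e4'
  have key : ∀ y, 0 ≤ y → y ≤ 1 → |W.h y - W'.h y| ≤ δ := by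
    intro y h0 h1
    have k1 := hd.h0
    have k2 := hd.h1
    rw [h.lo] at k1
    rw [h.hi] at k2
    rw [abs_le] at *
    unfold Seg.h at *
    constructor <;> nlinarith
  have core : ∀ y y' : ℝ, 0 ≤ y → y ≤ 1 → W.h y + 4 * y = W'.h y' + 4 * y' → |y - y'| ≤ δ / 4 := by
    intro y y' h0 h1 he
    have k := abs_le.1 (key y h0 h1)
    rw [abs_le]
    rcases le_total y y' with hy | hy
    · have := h_mono hW' hy
      constructor <;> linarith
    · have := h_mono hW' hy
      constructor <;> linarith
  have f1 := (h.fullC hW).1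
  have f2 := (h.fullC hW).2
  have f3 := (dd_le_cc_two hW).2.2.2
  rw [h.lo] at f1
  rw [h.hi] at f2
  refine ⟨by rw [a1, b1], by rw [a2, b2], ?_, ?_⟩
  · rw [a1, a3, b3]; exact core _ _ f1 (f3.trans f2) (by linarith)
  · rw [a2, a4, b4]; exact core _ _ (f1.trans f3) f2 (by linarith)

end Seg

variable {f : ℕ → ℝ → ℝ → ℝ} {M c α : ℝ} {CD σ c6 K3 : ℝ}
  {T T1 T2 : Seg → Seg → ℤ → Prop}

/-- Advancing the second segment. -/
lemma Good.step_right (hf : Dyn f M c α) (hCD1 : 1 ≤ CD) (hCD : Drift CD)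
    (h1 : Good f M CD σ c6 K3 1 T1) {v d0 w0 : ℝ} {k0 : ℕ} (hw0 : 0 < w0)
    (hT : ∀ W W' d, W.Valid → W'.Valid → T W W' d → W.V ≤ v ∧ W'.V ≤ v ∧ |(d:ℝ)| ≤ d0 ∧
      ∃ i, W'.Act i ∧ i.2 ≤ k0 ∧ w0 ≤ W'.w i ∧ T1 W (W'.child i) (d + tau i)) :
    Good f M CD σ c6 K3 0 T := by
  have := (Good.step (T := fun W W' d => T W' W (-d)) hf hCD1 hCD h1.swap (v := v) (d0 := d0)
    (k0 := k0) hw0 fun W W' d hW hW' h => by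
      obtain ⟨a1, a2, a3, i, b1, b2, b3, b4⟩ := hT W' W _ hW' hW h
      refine ⟨a2, a1, by simpa using a3, i, b1, b2, b3, ?_⟩
      convert b4 using 1
      ring).swap
  exact this.mono fun W W' d _ _ h => by
    rwa [neg_neg]

lemma tau_C : tau (false, 2) = 3 := rfl

/-- Full segments at distance at most `4 ^ (-n)`. -/
def FullNear (n : ℕ) (W W' : Seg) (d : ℤ) : Prop :=
  W.Full ∧ W'.Full ∧ d = 0 ∧ Near W W' ((1 / 4) ^ n)

lemma FullNear.good_base (hσ : 0 < σ) (hc6 : 0 ≤ c6) :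
    ∃ n, Good f M CD σ c6 K3 1 (FullNear n) := by
  obtain ⟨n, hn⟩ : ∃ n : ℕ, c6 * (((1/4 : ℝ) ^ n) ^ σ) * (4 + K3) ≤ 1 / 2 := by
    have h1 : Filter.Tendsto (fun n : ℕ => c6 * (((1/4 : ℝ) ^ σ) ^ n) * (4 + K3))
        Filter.atTop (nhds (c6 * 0 * (4 + K3))) :=
      ((tendsto_pow_atTop_nhds_zero_of_lt_one (by positivity)
        (Real.rpow_lt_one (by norm_num) (by norm_num) hσ)).const_mul _).mul_const _
    rw [mul_zero, zero_mul] at h1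
    obtain ⟨n, hn⟩ := (h1.eventually_le_const (by norm_num : (0:ℝ) < 1 / 2)).exists
    refine ⟨n, ?_⟩
    rwa [← Real.rpow_natCast, ← Real.rpow_mul (by norm_num), mul_comm (n:ℝ), Real.rpow_mul (by norm_num),
      Real.rpow_natCast]
  refine ⟨n, 1 / 2, 1 / 2, by norm_num, by norm_num, by norm_num, ?_⟩
  rintro g ζ K hK - - hg N - hC W W' hW hW' m m' ⟨h1, h2, h3, h4⟩ hN
  obtain rfl : m = m' := by omega
  have h5 := hC W W' hW hW' m (by omega) _ (by positivity) (pow_le_one₀ (by norm_num) (by norm_num)) h4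
  rw [min_self]
  have hD : ∀ W : Seg, W.Valid → W.Full → W.D ≤ 2 := by
    intro W hW h
    have := Seg.chi_le_of one_pos h.eps_ge
    unfold Seg.D
    rw [h.len_eq, div_one]
    norm_num at this
    linarith
  have h6 := hD W hW h1
  have h7 := hD W' hW' h2
  refine h5.trans (mul_le_mul_of_nonneg_right ?_ (hg.pos m).le)
  calc c6 * (1 + K) * ((1 / 4) ^ n) ^ σ * (W.D + W'.D + K3)
      ≤ c6 * (1 + K) * ((1 / 4) ^ n) ^ σ * (4 + K3) := by gcongr; linarith
    _ = c6 * (((1/4 : ℝ) ^ n) ^ σ) * (4 + K3) * (1 + K) := by ring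
    _ ≤ 1 / 2 * (1 + K) := by gcongr
    _ = _ := by ring

lemma FullNear.good_pred (hf : Dyn f M c α) (hCD1 : 1 ≤ CD) (hCD : Drift CD) {n : ℕ}
    (h : Good f M CD σ c6 K3 1 (FullNear (n + 1))) : Good f M CD σ c6 K3 0 (FullNear n) := by
  let T1 : Seg → Seg → ℤ → Prop := fun W W' d => W.Full ∧ W'.Full ∧ d = -3 ∧
    Near W (W'.child (false, 2)) ((1 / 4) ^ (n + 1))
  have h1 : Good f M CD σ c6 K3 0 T1 := by
    refine Good.step_right hf hCD1 hCD h (v := 3) (d0 := 3) (k0 := 2) (w0 := 1/5) (by norm_num) ?_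
    rintro W W' d hW hW' ⟨a1, a2, rfl, a4⟩
    refine ⟨a1.V_le hW, a2.V_le hW', by norm_num, (false, 2), (Seg.FullC.spec hW' (a2.fullC hW')).1,
      le_rfl, Seg.FullC.w_ge hW' (a2.fullC hW'), a1, Seg.FullC.child_full hW' (a2.fullC hW'),
      by rw [tau_C]; norm_num, a4⟩
  refine Good.step hf hCD1 hCD h1.one (v := 3) (d0 := 3) (k0 := 2) (w0 := 1/5) (by norm_num) ?_
  rintro W W' d hW hW' ⟨a1, a2, rfl, a4⟩
  refine ⟨a1.V_le hW, a2.V_le hW', by norm_num, (false, 2), (Seg.FullC.spec hW (a1.fullC hW)).1,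
    le_rfl, Seg.FullC.w_ge hW (a1.fullC hW), Seg.FullC.child_full hW (a1.fullC hW), a2,
    by rw [tau_C]; norm_num, ?_⟩
  have := Seg.Full.contract hW hW' a1 a2 a4
  rwa [pow_succ, ← div_eq_mul_one_div]

lemma FullNear.good_zero (hf : Dyn f M c α) (hCD1 : 1 ≤ CD) (hCD : Drift CD) (hσ : 0 < σ)
    (hc6 : 0 ≤ c6) : Good f M CD σ c6 K3 0 (FullNear 0) := by
  obtain ⟨n, hn⟩ := FullNear.good_base (f := f) (M := M) (CD := CD) hσ hc6
  have : ∀ n, Good f M CD σ c6 K3 1 (FullNear (n + 1)) → Good f M CD σ c6 K3 0 (FullNear 0) := by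
    intro n
    induction n with
    | zero => exact fun h => FullNear.good_pred hf hCD1 hCD h
    | succ n ih => exact fun h => ih (FullNear.good_pred hf hCD1 hCD h).one
  refine this n (hn.mono fun W W' d hW hW' h => ?_)
  obtain ⟨h1, h2, h3, h4⟩ := h
  have : ((1:ℝ)/4) ^ (n + 1) ≤ (1/4) ^ n :=
    pow_le_pow_of_le_one (by norm_num) (by norm_num) (Nat.le_succ n)
  exact ⟨h1, h2, h3, h4.lo, h4.hi, h4.h0.trans this, h4.h1.trans this⟩

/-- Full segments with bounded time difference. -/
def FullDiff (n : ℕ) (W W' : Seg) (d : ℤ) : Prop := W.Full ∧ W'.Full ∧ |d| ≤ n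

lemma FullDiff.good (hf : Dyn f M c α) (hCD1 : 1 ≤ CD) (hCD : Drift CD) (hσ : 0 < σ)
    (hc6 : 0 ≤ c6) (n : ℕ) : Good f M CD σ c6 K3 0 (FullDiff n) := by
  induction n with
  | zero =>
    refine (FullNear.good_zero hf hCD1 hCD hσ hc6).mono fun W W' d hW hW' h => ?_
    obtain ⟨h1, h2, h3⟩ := h
    refine ⟨h1, h2, by simpa using h3, by rw [h1.lo, h2.lo], by rw [h1.hi, h2.hi], ?_, ?_⟩
    · rw [h1.lo, pow_zero, abs_le]
      constructor <;> linarith [h1.a0, h1.a1, h2.a0, h2.a1]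
    · rw [h1.hi, pow_zero, abs_le]
      constructor <;> linarith [h1.b0, h1.b1, h2.b0, h2.b1]
  | succ n ih =>
    have cast_bd : ∀ d : ℤ, ∀ b : ℕ, |d| ≤ b → |(d:ℝ)| ≤ b := fun d b h => by exact_mod_cast h
    let Ta : Seg → Seg → ℤ → Prop := fun W W' d => W.Full ∧ W'.Full ∧ |d + 3| ≤ n
    let Tb : Seg → Seg → ℤ → Prop := fun W W' d => W.FullC ∧ W.V ≤ 3 ∧ W'.Full ∧ |d| ≤ n
    let Tc : Seg → Seg → ℤ → Prop := fun W W' d => W.Full ∧ W'.Full ∧ |d - 1| ≤ n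
    have ha : Good f M CD σ c6 K3 0 Ta := by
      refine Good.step_right hf hCD1 hCD ih.one (v := 3) (d0 := (n + 3 : ℕ)) (k0 := 2)
        (w0 := 1/5) (by norm_num) ?_
      rintro W W' d hW hW' ⟨a1, a2, a3⟩
      refine ⟨a1.V_le hW, a2.V_le hW', cast_bd _ _ (by grind), (false, 2),
        (Seg.FullC.spec hW' (a2.fullC hW')).1, le_rfl, Seg.FullC.w_ge hW' (a2.fullC hW'), a1,
        Seg.FullC.child_full hW' (a2.fullC hW'), a3⟩
    have hb : Good f M CD σ c6 K3 0 Tb := by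
      refine Good.step hf hCD1 hCD ha.one (v := 3) (d0 := (n : ℕ)) (k0 := 2)
        (w0 := 1/5) (by norm_num) ?_
      rintro W W' d hW hW' ⟨a1, a2, a3, a4⟩
      refine ⟨a2, a3.V_le hW', cast_bd _ _ a4, (false, 2), (Seg.FullC.spec hW a1).1, le_rfl,
        Seg.FullC.w_ge hW a1, Seg.FullC.child_full hW a1, a3, ?_⟩
      rw [tau_C]; push_cast; rwa [sub_add_cancel]
    have hc : Good f M CD σ c6 K3 0 Tc := by
      refine Good.step hf hCD1 hCD hb.one (v := 3) (d0 := (n + 1 : ℕ)) (k0 := 2)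
        (w0 := 1/5) (by norm_num) ?_
      rintro W W' d hW hW' ⟨a1, a2, a3⟩
      obtain ⟨b1, b2, b3, b4⟩ := a1.spec_A hW
      exact ⟨a1.V_le hW, a2.V_le hW', cast_bd _ _ (by grind), (false, 1), b1, by norm_num, b2, b3,
        b4, a2, a3⟩
    refine ((hc.or hc.swap).or ih).mono fun W W' d _ _ ⟨h1, h2, h3⟩ => ?_
    push_cast at h3
    rw [abs_le] at h3
    rcases lt_trichotomy d 0 with hd | hd | hd
    · exact Or.inl (Or.inr ⟨h2, h1, abs_le.2 ⟨by omega, by omega⟩⟩)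
    · exact Or.inr ⟨h1, h2, by rw [hd]; simp⟩
    · exact Or.inl (Or.inl ⟨h1, h2, abs_le.2 ⟨by omega, by omega⟩⟩)

/-- Segments with length and `eps` bounded below. -/
def Seg.Big (W : Seg) (l e : ℝ) : Prop := l ≤ W.len ∧ e ≤ W.eps

lemma Good.grow (hf : Dyn f M c α) (hCD1 : 1 ≤ CD) (hCD : Drift CD) {X : Seg → Prop} {v : ℝ}
    (hX : ∀ W : Seg, W.Valid → X W → W.V ≤ v)
    (h : ∀ n : ℕ, Good f M CD σ c6 K3 0 (fun W W' d => W.Full ∧ X W' ∧ |d| ≤ n)) (n : ℕ) :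
    ∀ l e : ℝ, 0 < l → 0 < e → 1 < l * (12 / 11) ^ n → ∀ b : ℕ,
      Good f M CD σ c6 K3 0 (fun W W' d => W.Big l e ∧ X W' ∧ |d| ≤ b) := by
  induction n with
  | zero =>
    intro l e _ _ hl b
    refine (h 0).mono fun W W' d hW hW' h1 => ?_
    have := Seg.len_le hW
    have := h1.1.1
    rw [pow_zero] at hl
    linarith
  | succ n ih =>
    intro l e hl he hn b
    obtain ⟨k, hk⟩ := exists_nat_ge (max 2 (15 / 2 / e))
    have h1 := ((h (b + 2 * k)).or (ih (12 / 11 * l) (2 / 5 * e) (by positivity) (by positivity)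
      (by rw [pow_succ] at hn; linarith) (b + 2 * k))).one
    refine Good.step hf hCD1 hCD h1 (v := max v ((1 + (1 / 10) / √e) / l)) (d0 := b) (k0 := k)
      (w0 := 1 / (2 * k + 1)) (by positivity) ?_
    rintro W W' d hW hW' ⟨a1, a2, a3⟩
    refine ⟨(Seg.V_le_of hW hl he a1.1 a1.2).trans (le_max_right _ _),
      (hX W' hW' a2).trans (le_max_left _ _), by exact_mod_cast a3, ?_⟩
    have hk2 : (2:ℝ) ≤ k := (le_max_left _ _).trans hk
    by_cases hC : W.FullC
    · refine ⟨(false, 2), (Seg.FullC.spec hW hC).1, by exact_mod_cast hk2, ?_, Or.inl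
        ⟨Seg.FullC.child_full hW hC, a2, ?_⟩⟩
      · refine le_trans ?_ (Seg.FullC.w_ge hW hC)
        exact one_div_le_one_div_of_le (by norm_num) (by linarith)
      · rw [tau_C]
        have : 2 ≤ k := by exact_mod_cast hk2
        push_cast
        grind
    · obtain ⟨i, hi, hl2⟩ := Seg.growth hW hC
      have hki : (i.2:ℝ) ≤ k := by
        refine le_trans ?_ ((le_max_right _ _).trans hk)
        rw [le_div_iff₀ he]
        have := Seg.eps_mul_le hW hi
        have : (i.2:ℝ) * e ≤ i.2 * W.eps := by gcongr; exact a1.2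
        linarith
      have hki' : i.2 ≤ k := by exact_mod_cast hki
      have hlam := Seg.lam_pos hW (Seg.Act.one_le i hi).1
      refine ⟨i, hi, hki', ?_, Or.inr ⟨⟨?_, ?_⟩, a2, ?_⟩⟩
      · rw [Seg.child_len] at hl2
        have hlen := Seg.len_pos hW
        have h3 := Seg.lam_le hW i
        have hp := hi.plen_pos
        unfold Seg.w
        rw [div_le_div_iff₀ (by positivity) hlen]
        have : W.lam i * W.plen i ≤ (2 * k + 1) * W.plen i := by gcongr; linarith
        linarith
      · have := a1.1
        linarith
      · have := Seg.child_eps hW hi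
        have := a1.2
        linarith
      · unfold tau
        push_cast
        grind

lemma Seg.big_of_V_le {W : Seg} (hW : W.Valid) {v : ℝ} (h : W.V ≤ v) :
    W.Big (1 / v ^ 2) (1 / (100 * v ^ 4)) := by
  have h1 := one_le_D hW
  have hV := one_le_V hW
  have hD : W.D ≤ v ^ 2 := by
    have h2 : W.D = W.V ^ (10/9 : ℝ) := by
      unfold V; rw [← Real.rpow_mul (by linarith)]; norm_num
    rw [h2]
    calc W.V ^ (10/9 : ℝ) ≤ W.V ^ (2:ℝ) :=
          Real.rpow_le_rpow_of_exponent_le hV (by norm_num)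
      _ = W.V ^ 2 := by norm_cast
      _ ≤ v ^ 2 := by gcongr
  have hl := len_pos hW
  have hl1 := len_le hW
  have hc := one_le_chi (W := W)
  have he := eps_pos hW
  have hDl : W.chi = W.D * W.len := by unfold D; field_simp
  have hv : 0 < v := by linarith
  constructor
  · rw [div_le_iff₀ (by positivity)]
    nlinarith
  · have h3 : W.chi ≤ v ^ 2 := by nlinarith
    have h4 : (1 / 10) / √W.eps ≤ v ^ 2 := by unfold chi at h3; linarith
    have h5 := Real.sqrt_pos.2 he
    rw [div_le_iff₀ h5] at h4
    rw [div_le_iff₀ (by positivity)]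
    have h6 := Real.sq_sqrt he.le
    have : (1/10 : ℝ) ^ 2 ≤ (v ^ 2 * √W.eps) ^ 2 := by gcongr
    rw [mul_pow, h6] at this
    nlinarith

lemma Good.bounded (hf : Dyn f M c α) (hCD1 : 1 ≤ CD) (hCD : Drift CD) (hσ : 0 < σ)
    (hc6 : 0 ≤ c6) {v : ℝ} (hv : 0 < v) (b : ℕ) :
    Good f M CD σ c6 K3 0 (fun W W' d => W.V ≤ v ∧ W'.V ≤ v ∧ |d| ≤ b) := by
  set l := 1 / v ^ 2
  set e := 1 / (100 * v ^ 4)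
  have hl : 0 < l := by positivity
  have he : 0 < e := by positivity
  obtain ⟨n, hn⟩ := pow_unbounded_of_one_lt (1 / l) (by norm_num : (1:ℝ) < 12 / 11)
  rw [div_lt_iff₀ hl, mul_comm] at hn
  have h1 := fun b => (Good.grow hf hCD1 hCD (X := Seg.Full) (v := 3) (fun W hW h => h.V_le hW)
    (FullDiff.good (K3 := K3) hf hCD1 hCD hσ hc6) n l e hl he hn b).swap
  have h2 := Good.grow hf hCD1 hCD (X := fun W => W.Big l e) (v := (1 + (1 / 10) / √e) / l)
    (fun W hW h => Seg.V_le_of hW hl he h.1 h.2)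
    (fun b => (h1 b).mono fun W W' d _ _ h => ⟨h.2.1, h.1, by rw [abs_neg]; exact h.2.2⟩)
    n l e hl he hn b
  exact h2.mono fun W W' d hW hW' h =>
    ⟨Seg.big_of_V_le hW h.1, Seg.big_of_V_le hW' h.2.1, h.2.2⟩

end LTM

namespace LTM

namespace Seg
variable {W W' : Seg} {δ : ℝ}

/-- The same line over a smaller interval. -/
def sub (W : Seg) (u v : ℝ) : Seg := ⟨W.a, W.s, u, v⟩

lemma sub_eps_le (hW : W.Valid) {u v : ℝ} (hu : W.lo ≤ u) (hv : v ≤ W.hi) :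
    W.eps ≤ (W.sub u v).eps := by
  have h1 : W.L1 ≤ (W.sub u v).L1 := L1_le hW hu
  have h2 : W.L2 ≤ (W.sub u v).L2 := L2_le hW hv
  exact min_le_min h1 h2

lemma sub_valid (hW : W.Valid) {u v : ℝ} (hu : W.lo ≤ u) (huv : u < v) (hv : v ≤ W.hi) :
    (W.sub u v).Valid where
  s0 := hW.s0
  s1 := hW.s1
  lt := huv
  lo0 := hW.lo0.trans hu
  hi1 := hv.trans hW.hi1
  h0 := hW.h_nonneg hu
  h1 := hW.h_le hv
  L1pos := hW.L1pos.trans_le (L1_le hW hu)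
  L2pos := hW.L2pos.trans_le (L2_le hW hv)

lemma sub_chi_le (hW : W.Valid) {u v : ℝ} (hu : W.lo ≤ u) (hv : v ≤ W.hi) :
    (W.sub u v).chi ≤ W.chi :=
  chi_le_of (eps_pos hW) (sub_eps_le hW hu hv)

lemma not_act (hW : W.Valid) {i : Br} (hi : ¬ W.Act i) : W.ph i = W.pl i :=
  le_antisymm (not_lt.1 hi) (pl_le_ph hW i)

end Seg

namespace Near
open Seg
variable {W W' : Seg} {δ : ℝ}

lemma symm (h : Near W W' δ) : Near W' W δ := by
  refine ⟨h.lo.symm, h.hi.symm, ?_, ?_⟩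
  · rw [← h.lo, abs_sub_comm]; exact h.h0
  · rw [← h.hi, abs_sub_comm]; exact h.h1

lemma nonneg (h : Near W W' δ) : 0 ≤ δ := (abs_nonneg _).trans h.h0

lemma h_le (hW : W.Valid) (hd : Near W W' δ) {y : ℝ} (h0 : W.lo ≤ y) (h1 : y ≤ W.hi) :
    |W.h y - W'.h y| ≤ δ := by
  have k1 := abs_le.1 hd.h0
  have k2 := abs_le.1 hd.h1
  have hl := len_pos hW
  have e : (W.h y - W'.h y) * W.len = (W.h W.lo - W'.h W.lo) * (W.hi - y) +
    (W.h W.hi - W'.h W.hi) * (y - W.lo) := by unfold Seg.h len; ring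
  have e0 : W.len = (W.hi - y) + (y - W.lo) := by unfold len; ring
  rw [abs_le]
  constructor
  · refine le_of_mul_le_mul_right ?_ hl
    rw [e, e0]; nlinarith
  · refine le_of_mul_le_mul_right ?_ hl
    rw [e, e0]; nlinarith

lemma slope_le (hd : Near W W' δ) : (W.s - W'.s) * W.len ≤ 2 * δ := by
  have k1 := abs_le.1 hd.h0
  have k2 := abs_le.1 hd.h1
  have e : (W.s - W'.s) * W.len = (W.h W.hi - W'.h W.hi) - (W.h W.lo - W'.h W.lo) := by
    unfold Seg.h len; ring
  linarith

lemma core (hW : W.Valid) (hW' : W'.Valid) (hd : Near W W' δ) {k : ℝ} (hk : 1 ≤ k) {y y' : ℝ}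
    (h0 : W'.lo ≤ y') (h1 : y' ≤ W'.hi) (h : W.h y + 2 * k * y = W'.h y' + 2 * k * y') :
    |y - y'| ≤ δ / 2 := by
  have k1 := abs_le.1 (hd.symm.h_le hW' h0 h1)
  have hs := hW.s0
  have e : (2 * k + W.s) * (y - y') = W'.h y' - W.h y' := by
    unfold Seg.h at *; linarith
  have hδ := hd.nonneg
  rw [abs_le]
  constructor
  · by_contra! h2
    nlinarith
  · by_contra! h2
    nlinarith

lemma cl_cc_le (hW : W.Valid) (hd : Near W W' δ) (hW' : W'.Valid) {k : ℕ} (hk : 1 ≤ k) :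
    W'.cl (W'.cc k) - δ / 2 ≤ W.cl (W.cc k) := by
  have hδ := hd.nonneg
  have hk' : (1:ℝ) ≤ k := by exact_mod_cast hk
  by_contra! h
  set y' := W'.cl (W'.cc k)
  have h1 := lo_le_cl (W := W) (W.cc k)
  have h2 := cl_le_hi hW' (W'.cc k)
  have h3 : W'.cl W'.lo < W'.cl (W'.cc k) := by
    have : W'.cl W'.lo = W'.lo := by
      have := hW'.lt
      unfold cl; rw [min_eq_right this.le, max_self]
    rw [this, ← hd.lo]
    linarith
  have h4 := (of_cl_lt h3 h3.le le_rfl).2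
  rw [le_cc_iff hW' hk] at h4
  have h5 : y' - δ / 2 ≤ W.cc k := by
    rw [le_cc_iff hW hk]
    have h6 := abs_le.1 (hd.h_le hW (h1.trans (by linarith : W.cl (W.cc k) ≤ y')) (by rw [hd.hi]; exact h2))
    have h7 := h_mono hW (by linarith : y' - δ / 2 ≤ y')
    nlinarith
  have h8 : y' - δ / 2 ≤ W.cl (W.cc k) := by
    refine le_max_of_le_right (le_min ?_ h5)
    rw [hd.hi]; linarith
  linarith

lemma cl_dd_le (hW : W.Valid) (hd : Near W W' δ) (hW' : W'.Valid) {k : ℕ} (hk : 1 ≤ k) :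
    W'.cl (W'.dd k) - δ / 2 ≤ W.cl (W.dd k) := by
  have hδ := hd.nonneg
  have hk' : (1:ℝ) ≤ k := by exact_mod_cast hk
  by_contra! h
  set y' := W'.cl (W'.dd k)
  have h1 := lo_le_cl (W := W) (W.dd k)
  have h2 := cl_le_hi hW' (W'.dd k)
  have h3 : W'.cl W'.lo < W'.cl (W'.dd k) := by
    have : W'.cl W'.lo = W'.lo := by
      have := hW'.lt
      unfold cl; rw [min_eq_right this.le, max_self]
    rw [this, ← hd.lo]
    linarith
  have h4 := (of_cl_lt h3 h3.le le_rfl).2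
  rw [le_dd_iff hW' hk] at h4
  have h5 : y' - δ / 2 ≤ W.dd k := by
    rw [le_dd_iff hW hk]
    have h6 := abs_le.1 (hd.h_le hW (h1.trans (by linarith : W.cl (W.dd k) ≤ y')) (by rw [hd.hi]; exact h2))
    have h7 := h_mono hW (by linarith : y' - δ / 2 ≤ y')
    nlinarith
  have h8 : y' - δ / 2 ≤ W.cl (W.dd k) := by
    refine le_max_of_le_right (le_min ?_ h5)
    rw [hd.hi]; linarith
  linarith

lemma cl_cc (hW : W.Valid) (hW' : W'.Valid) (hd : Near W W' δ) {k : ℕ} (hk : 1 ≤ k) :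
    |W.cl (W.cc k) - W'.cl (W'.cc k)| ≤ δ / 2 := by
  have h1 := hd.cl_cc_le hW hW' hk
  have h2 := hd.symm.cl_cc_le hW' hW hk
  rw [abs_le]; constructor <;> linarith

lemma cl_dd (hW : W.Valid) (hW' : W'.Valid) (hd : Near W W' δ) {k : ℕ} (hk : 1 ≤ k) :
    |W.cl (W.dd k) - W'.cl (W'.dd k)| ≤ δ / 2 := by
  have h1 := hd.cl_dd_le hW hW' hk
  have h2 := hd.symm.cl_dd_le hW' hW hk
  rw [abs_le]; constructor <;> linarith

lemma ee (hW : W.Valid) (hW' : W'.Valid) (hd : Near W W' δ) {k : ℕ} (hk : 1 ≤ k) :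
    |W.ee k - W'.ee k| ≤ δ / 2 := by
  unfold Seg.ee
  rw [(monotone_iff_forall_lt.2 fun _ _ h => cl_mono h.le : Monotone W.cl).map_max,
    (monotone_iff_forall_lt.2 fun _ _ h => cl_mono h.le : Monotone W'.cl).map_max]
  exact (abs_max_sub_max_le_max _ _ _ _).trans (max_le (hd.cl_cc hW hW' hk) (hd.cl_dd hW hW' le_rfl))

lemma ff (hW : W.Valid) (hW' : W'.Valid) (hd : Near W W' δ) {k : ℕ} (hk : 1 ≤ k) :
    |W.ff k - W'.ff k| ≤ δ / 2 := by
  unfold Seg.ff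
  rw [(monotone_iff_forall_lt.2 fun _ _ h => cl_mono h.le : Monotone W.cl).map_min,
    (monotone_iff_forall_lt.2 fun _ _ h => cl_mono h.le : Monotone W'.cl).map_min]
  exact (abs_min_sub_min_le_max _ _ _ _).trans (max_le (hd.cl_dd hW hW' hk) (hd.cl_cc hW hW' le_rfl))

lemma pl (hW : W.Valid) (hW' : W'.Valid) (hd : Near W W' δ) : ∀ i, |W.pl i - W'.pl i| ≤ δ / 2
  | (false, 0) | (false, 1) | (true, 0) | (true, 2) => by
    change |W.lo - W'.lo| ≤ _
    have := hd.nonneg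
    rw [hd.lo, sub_self, abs_zero]; linarith
  | (false, 2) => hd.ee hW hW' (by norm_num)
  | (false, k + 3) => hd.ee hW hW' (by omega)
  | (true, 1) => hd.cl_cc hW hW' le_rfl
  | (true, k + 3) => hd.ff hW hW' (by omega)

lemma ph (hW : W.Valid) (hW' : W'.Valid) (hd : Near W W' δ) : ∀ i, |W.ph i - W'.ph i| ≤ δ / 2
  | (false, 0) | (true, 0) | (true, 2) => by
    change |W.lo - W'.lo| ≤ _
    have := hd.nonneg
    rw [hd.lo, sub_self, abs_zero]; linarith
  | (false, 1) => hd.cl_dd hW hW' le_rfl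
  | (false, 2) => hd.ff hW hW' (by norm_num)
  | (false, k + 3) => hd.ee hW hW' (by omega)
  | (true, 1) => by
    change |W.hi - W'.hi| ≤ _
    have := hd.nonneg
    rw [hd.hi, sub_self, abs_zero]; linarith
  | (true, k + 3) => hd.ff hW hW' (by omega)

/-- Inverse branches of nearby segments are near each other. -/
lemma child_h (hW : W.Valid) (hW' : W'.Valid) (hd : Near W W' δ) {i : Br} (hi' : W'.Act i) {u : ℝ}
    (h0 : (W'.child i).lo ≤ u) (h1 : u ≤ (W'.child i).hi) :
    |(W.child i).h u - (W'.child i).h u| ≤ δ / 2 := by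
  have hk := (Act.one_le i hi').1
  have hl := lam_pos hW hk
  have hl' := lam_pos hW' hk
  have hv := child_valid hW' hi'
  have e : ∀ W : Seg, 0 < W.lam i → W.h ((W.child i).h u) + 2 * i.2 * ((W.child i).h u) = u + 2 * jj i := by
    intro W hl
    simp only [child, Seg.h]
    field_simp
    unfold lam
    ring
  have p1 : (W'.child i).h (W'.child i).lo = W'.pl i := child_h_Y hW' hk _
  have p2 : (W'.child i).h (W'.child i).hi = W'.ph i := child_h_Y hW' hk _
  refine hd.core hW hW' (by exact_mod_cast hk) ?_ ?_ ((e W hl).trans (e W' hl').symm)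
  · exact ((lo_le_pl (W := W') i).trans p1.ge).trans (h_mono hv h0)
  · exact (h_mono hv h1).trans (p2.le.trans (ph_le_hi hW' i))

end Near

end LTM

namespace LTM

namespace Seg
variable {W : Seg}

/-- Short parts of a piece. -/
lemma short_le (hW : W.Valid) {i : Br} (hk : 1 ≤ i.2) {t δ σ : ℝ} (ht0 : 0 ≤ t)
    (htp : t ≤ W.plen i) (htδ : t ≤ δ) (hδ : 0 < δ) (hδ1 : δ ≤ 1) (hσ : σ ≤ 1 / 20) :
    t ≤ 42 * W.chi * δ ^ σ * (i.2:ℝ) ^ (-(9/4) : ℝ) := by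
  have hχ := one_le_chi (W := W)
  by_cases hi : W.Act i
  swap
  · have : W.plen i = 0 := by unfold plen; rw [not_act hW hi, sub_self]
    have : t = 0 := by linarith
    rw [this]; positivity
  have hk' := one_le_k hi
  have h1 := one_le_chi_k hW hi
  have h2 : t ≤ 3 / 2 * (i.2:ℝ) ^ (-2 : ℝ) := by
    have := plen_le hW hi
    rw [Real.rpow_neg (by positivity), ← div_eq_mul_inv, le_div_iff₀ (by positivity)]
    norm_num
    have : t * (i.2:ℝ) ^ 2 ≤ W.plen i * (i.2:ℝ) ^ 2 := by gcongr
    linarith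
  have h3 : t ^ (1/20 : ℝ) ≤ δ ^ σ :=
    (Real.rpow_le_rpow ht0 htδ (by norm_num)).trans (Real.rpow_le_rpow_of_exponent_ge hδ hδ1 hσ)
  have h4 : t ^ (19/20 : ℝ) ≤ 3 / 2 * (i.2:ℝ) ^ (-(19/10) : ℝ) := by
    refine (Real.rpow_le_rpow ht0 h2 (by norm_num)).trans ?_
    rw [Real.mul_rpow (by norm_num) (by positivity), ← Real.rpow_mul (by positivity)]
    norm_num
    gcongr
    calc (3/2 : ℝ) ^ (19/20 : ℝ) ≤ (3/2 : ℝ) ^ (1:ℝ) :=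
          Real.rpow_le_rpow_of_exponent_le (by norm_num) (by norm_num)
      _ = _ := Real.rpow_one _
  have h5 : t = t ^ (1/20 : ℝ) * t ^ (19/20 : ℝ) := by
    rw [← Real.rpow_add_of_nonneg ht0 (by norm_num) (by norm_num)]
    norm_num
  calc t = t ^ (1/20 : ℝ) * t ^ (19/20 : ℝ) * 1 := by rw [mul_one]; exact h5
    _ ≤ δ ^ σ * (3 / 2 * (i.2:ℝ) ^ (-(19/10) : ℝ)) * (28 * W.chi * (i.2:ℝ) ^ (-(1/2) : ℝ)) := by
        gcongr
    _ = 42 * W.chi * δ ^ σ * ((i.2:ℝ) ^ (-(19/10) : ℝ) * (i.2:ℝ) ^ (-(1/2) : ℝ)) := by ring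
    _ ≤ 42 * W.chi * δ ^ σ * (i.2:ℝ) ^ (-(9/4) : ℝ) := by
        rw [← Real.rpow_add (by linarith)]
        gcongr
        norm_num

lemma ratio_short_le (hW : W.Valid) {i : Br} (hi : W.Act i) {t δ σ : ℝ} (ht0 : 0 ≤ t)
    (htδ : t ≤ δ) (hδ : 0 < δ) (hδ1 : δ ≤ 1) (hσ : σ ≤ 1 / 20) :
    ((W.child i).chi / W.lam i) ^ (9/10 : ℝ) * t ^ (1/10 : ℝ) ≤
      16 * W.chi * δ ^ σ * (i.2:ℝ) ^ (-(5/4) : ℝ) := by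
  have hχ := one_le_chi (W := W)
  have hχ' := one_le_chi (W := W.child i)
  have hk := one_le_k hi
  have hl := lam_pos hW (Act.one_le i hi).1
  have h3 : t ^ (1/10 : ℝ) ≤ δ ^ σ :=
    (Real.rpow_le_rpow ht0 htδ (by norm_num)).trans
      (Real.rpow_le_rpow_of_exponent_ge hδ hδ1 (by linarith))
  have h4 : ((W.child i).chi / W.lam i) ^ (9/10 : ℝ) ≤ 16 * W.chi * (i.2:ℝ) ^ (-(5/4) : ℝ) := by
    refine (Real.rpow_le_rpow (by positivity) (ratio_le hW hi) (by norm_num)).trans ?_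
    rw [Real.mul_rpow (by positivity) (by positivity), ← Real.rpow_mul (by positivity)]
    gcongr
    · calc (16 * W.chi) ^ (9/10 : ℝ) ≤ (16 * W.chi) ^ (1:ℝ) :=
          Real.rpow_le_rpow_of_exponent_le (by linarith) (by norm_num)
        _ = _ := Real.rpow_one _
    · norm_num
  calc _ ≤ (16 * W.chi * (i.2:ℝ) ^ (-(5/4) : ℝ)) * δ ^ σ := by gcongr
    _ = _ := by ring

end Seg

variable {f : ℕ → ℝ → ℝ → ℝ} {M c α : ℝ} {g : ℕ → ℝ} {W W' : Seg} {i : Br} {m : ℕ}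

lemma Dyn.integral_sub_const (hf : Dyn f M c α) (m : ℕ) (W : Seg) (r u v : ℝ) :
    ∫ y in u..v, (f m (W.h y) y - r) = (∫ y in u..v, f m (W.h y) y) - (v - u) * r := by
  rw [intervalIntegral.integral_sub (hf.integrable m W u v) (by simp),
    intervalIntegral.integral_const, smul_eq_mul]

lemma Dyn.integral_sub_A (hf : Dyn f M c α) (m : ℕ) (W : Seg) (r : ℝ) {u v : ℝ} (huv : u < v) :
    ∫ y in u..v, (f m (W.h y) y - r) = (v - u) * (A f m (W.sub u v) - r) := by
  rw [hf.integral_sub_const, A]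
  change _ = (v - u) * ((∫ y in u..v, f m (W.h y) y) / (v - u) - r)
  have : 0 < v - u := sub_pos.2 huv
  field_simp

/-- Change of variables along a piece, for the deviation from a constant. -/
lemma Dyn.integral_piece_sub (hf : Dyn f M c α) (hW : W.Valid) (hi : W.Act i) (hm : tau i ≤ m)
    (r : ℝ) {u v : ℝ} (hu : W.pl i ≤ u) (huv : u ≤ v) (hv : v ≤ W.ph i) :
    ∫ y in u..v, (f m (W.h y) y - r) = (1 / W.lam i) *
      ∫ Y in (W.Y i u)..(W.Y i v), (f (m - tau i) ((W.child i).h Y) Y - r) := by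
  have hl := Seg.lam_pos hW (Seg.Act.one_le i hi).1
  rw [hf.integral_sub_const, hf.integral_sub_const, hf.integral_piece_one hW hi hm hu huv hv,
    Seg.Y_sub]
  field_simp

lemma Dyn.piece_sub (hf : Dyn f M c α) (hW : W.Valid) (hi : W.Act i) (hm : tau i ≤ m) {r E : ℝ}
    (hg : 0 ≤ g (m - tau i))
    (hfar : ∀ W' : Seg, W'.Valid → |A f (m - tau i) W' - r| ≤ (W'.V + E) * g (m - tau i))
    {u v : ℝ} (hu : W.pl i ≤ u) (huv : u ≤ v) (hv : v ≤ W.ph i) :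
    |∫ y in u..v, (f m (W.h y) y - r)| ≤ (((W.child i).chi / W.lam i) ^ (9/10 : ℝ) *
      (v - u) ^ (1/10 : ℝ) + (v - u) * E) * g (m - tau i) := by
  rcases huv.eq_or_lt with rfl | huv'
  · simp
  have hl := Seg.lam_pos hW (Seg.Act.one_le i hi).1
  have ht : 0 < v - u := sub_pos.2 huv'
  have hY := Seg.Y_sub (W := W) i u v
  have hcv := Seg.child_valid hW hi
  have hY1 : (W.child i).lo ≤ W.Y i u := by
    have := Seg.Y_sub (W := W) i (W.pl i) u
    have : 0 ≤ W.lam i * (u - W.pl i) := mul_nonneg hl.le (by linarith)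
    change W.Y i (W.pl i) ≤ _
    linarith
  have hY2 : W.Y i v ≤ (W.child i).hi := by
    have := Seg.Y_sub (W := W) i v (W.ph i)
    have : 0 ≤ W.lam i * (W.ph i - v) := mul_nonneg hl.le (by linarith)
    change _ ≤ W.Y i (W.ph i)
    linarith
  have hYlt : W.Y i u < W.Y i v := by
    have : 0 < W.lam i * (v - u) := by positivity
    linarith
  have hsv := Seg.sub_valid hcv hY1 hYlt hY2
  have h1 := hfar _ hsv
  set C := (W.child i).sub (W.Y i u) (W.Y i v)
  have hCl : C.len = W.lam i * (v - u) := hY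
  have hCχ : C.chi ≤ (W.child i).chi := Seg.sub_chi_le hcv hY1 hY2
  have h0 := Seg.one_le_chi (W := C)
  have h00 := Seg.one_le_chi (W := W.child i)
  rw [hf.integral_piece_sub hW hi hm r hu huv hv, hf.integral_sub_A _ _ _ hYlt, hY, ← mul_assoc,
    ← mul_assoc, one_div, inv_mul_cancel₀ hl.ne', one_mul, abs_mul, abs_of_pos ht]
  have h2 : (v - u) * C.V ≤ ((W.child i).chi / W.lam i) ^ (9/10 : ℝ) * (v - u) ^ (1/10 : ℝ) := by
    have h3 : C.V ≤ ((W.child i).chi / W.lam i / (v - u)) ^ (9/10 : ℝ) := by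
      unfold Seg.V Seg.D
      rw [hCl, div_div]
      gcongr
    have h4 : (v - u) = (v - u) ^ (9/10 : ℝ) * (v - u) ^ (1/10 : ℝ) := by
      rw [← Real.rpow_add ht]; norm_num
    calc (v - u) * C.V ≤ (v - u) * ((W.child i).chi / W.lam i / (v - u)) ^ (9/10 : ℝ) := by gcongr
      _ = _ := by
        rw [Real.div_rpow (by positivity) ht.le]
        have : 0 < (v - u) ^ (9/10 : ℝ) := by positivity
        nth_rw 1 [h4]
        field_simp
  calc (v - u) * |A f (m - tau i) C - r| ≤ (v - u) * ((C.V + E) * g (m - tau i)) := by gcongr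
    _ = ((v - u) * C.V + (v - u) * E) * g (m - tau i) := by ring
    _ ≤ _ := by gcongr

/-- The bound used for unmatched parts of pieces. -/
def bd (CD K δ σ : ℝ) (W : Seg) (i : Br) : ℝ :=
  (16 + 42 * (3 + 2 * CD)) * (1 + K) * δ ^ σ * W.chi * (i.2:ℝ) ^ (-(5/4) : ℝ)

lemma bd_nonneg {CD K δ σ : ℝ} (hCD : 0 ≤ CD) (hK : 0 ≤ K) (hδ : 0 ≤ δ) : 0 ≤ bd CD K δ σ W i := by
  have := Seg.one_le_chi (W := W)
  unfold bd; positivity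

lemma Dyn.piece_short (hf : Dyn f M c α) (hW : W.Valid) (hk : 1 ≤ i.2) (hm : tau i ≤ m)
    {r CD K δ σ : ℝ} (hCD : 0 ≤ CD) (hK : 0 ≤ K) (hg : 0 ≤ g (m - tau i))
    (hfar : ∀ W' : Seg, W'.Valid →
      |A f (m - tau i) W' - r| ≤ (W'.V + (3 + K + CD * tau i)) * g (m - tau i))
    (hδ : 0 < δ) (hδ1 : δ ≤ 1) (hσ : σ ≤ 1 / 20)
    {u v : ℝ} (hu : W.pl i ≤ u) (huv : u ≤ v) (hv : v ≤ W.ph i) (hvδ : v - u ≤ δ) :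
    |∫ y in u..v, (f m (W.h y) y - r)| ≤ bd CD K δ σ W i * g (m - tau i) := by
  by_cases hi : W.Act i
  swap
  · have h1 : v = u := by have := Seg.not_act hW hi; linarith
    rw [h1, intervalIntegral.integral_same, abs_zero]
    exact mul_nonneg (bd_nonneg hCD hK hδ.le) hg
  refine (hf.piece_sub hW hi hm hg hfar hu huv hv).trans (mul_le_mul_of_nonneg_right ?_ hg)
  have hk' := Seg.one_le_k hi
  have hχ := Seg.one_le_chi (W := W)
  have ht : 0 ≤ v - u := sub_nonneg.2 huv
  have h1 := Seg.ratio_short_le hW hi ht hvδ hδ hδ1 hσ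
  have h2 := Seg.short_le hW hk ht (by unfold Seg.plen; linarith) hvδ hδ hδ1 hσ
  have h3 : 3 + K + CD * tau i ≤ (3 + 2 * CD) * (1 + K) * i.2 := by
    have h4 := tau_le i
    have : CD * tau i ≤ CD * (2 * i.2) := by gcongr
    have : (3 + K) * 1 ≤ (3 + K) * i.2 := by gcongr
    have : 0 ≤ K * i.2 := by positivity
    have : 0 ≤ CD * K * i.2 := by positivity
    nlinarith
  have h5 : (i.2:ℝ) ^ (-(5/4) : ℝ) = (i.2:ℝ) ^ (-(9/4) : ℝ) * i.2 := by
    nth_rw 3 [← Real.rpow_one (i.2:ℝ)]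
    rw [← Real.rpow_add (by linarith)]
    norm_num
  have h6 : (v - u) * (3 + K + CD * tau i) ≤
      42 * (3 + 2 * CD) * (1 + K) * δ ^ σ * W.chi * (i.2:ℝ) ^ (-(5/4) : ℝ) := by
    calc _ ≤ 42 * W.chi * δ ^ σ * (i.2:ℝ) ^ (-(9/4) : ℝ) * ((3 + 2 * CD) * (1 + K) * i.2) := by
          gcongr
      _ = _ := by rw [h5]; ring
  have h7 : 0 ≤ 16 * K * δ ^ σ * W.chi * (i.2:ℝ) ^ (-(5/4) : ℝ) := by positivity
  unfold bd
  linarith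

end LTM

namespace LTM

variable {f : ℕ → ℝ → ℝ → ℝ} {M c α : ℝ} {g : ℕ → ℝ} {W W' : Seg} {i : Br} {m : ℕ}

namespace Seg

lemma Y_child_h (hW : W.Valid) (hk : 1 ≤ i.2) (u : ℝ) : W.Y i ((W.child i).h u) = u := by
  have h1 := child_h_Y hW hk (i := i)
  have h2 := lam_pos hW hk
  have h3 : W.h ((W.child i).h u) + 2 * i.2 * (W.child i).h u = W.a + W.lam i * (W.child i).h u := by
    unfold h lam; ring
  rw [Y, h3]
  simp only [child, h]
  field_simp
  ring

/-- The quantity controlled by the drift inequality. -/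
def rho (W : Seg) (i : Br) : ℝ := by
  classical exact if W.Act i then (W.child i).chi / W.lam i else 0

lemma rho_act (hi : W.Act i) : W.rho i = (W.child i).chi / W.lam i := if_pos hi

lemma rho_not (hi : ¬ W.Act i) : W.rho i = 0 := if_neg hi

lemma rho_nonneg (hW : W.Valid) (i : Br) : 0 ≤ W.rho i := by
  by_cases hi : W.Act i
  · rw [rho_act hi]
    have := lam_pos hW (Act.one_le i hi).1
    have := one_le_chi (W := W.child i)
    positivity
  · rw [rho_not hi]

lemma child_h_lo (hW : W.Valid) (hk : 1 ≤ i.2) : (W.child i).h (W.child i).lo = W.pl i :=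
  child_h_Y hW hk _

lemma child_h_hi (hW : W.Valid) (hk : 1 ≤ i.2) : (W.child i).h (W.child i).hi = W.ph i :=
  child_h_Y hW hk _

end Seg

open Seg

/-- Pieces of nearby segments with disjoint images are short. -/
lemma Near.short {δ : ℝ} (hW : W.Valid) (hW' : W'.Valid) (hd : Near W W' δ) (hi : W.Act i)
    (hi' : W'.Act i) (h : (W.child i).hi ≤ (W'.child i).lo) : W.plen i ≤ δ ∧ W'.plen i ≤ δ := by
  have hk := (Act.one_le i hi).1
  have h1 := abs_le.1 (hd.pl hW hW' i)
  have h2 := abs_le.1 (hd.ph hW hW' i)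
  have hv := child_valid hW hi
  have hv' := child_valid hW' hi'
  have h3 := abs_le.1 (hd.symm.child_h hW' hW hi (u := (W.child i).hi) hv.lt.le le_rfl)
  have h4 := h_mono hv' h
  rw [child_h_hi hW hk] at h3
  rw [child_h_lo hW' hk] at h4
  unfold plen
  constructor <;> linarith

lemma Near.short_of_not {δ : ℝ} (hW : W.Valid) (hW' : W'.Valid) (hd : Near W W' δ)
    (hi : ¬ W.Act i) : W.plen i ≤ δ ∧ W'.plen i ≤ δ := by
  have h1 := abs_le.1 (hd.pl hW hW' i)
  have h2 := abs_le.1 (hd.ph hW hW' i)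
  have h3 := not_act hW hi
  have := hd.nonneg
  unfold plen
  constructor <;> linarith

lemma Near.end_lo {δ : ℝ} (hW : W.Valid) (hW' : W'.Valid) (hd : Near W W' δ) (hi : W.Act i)
    (hi' : W'.Act i) {u : ℝ} (hu : u = max (W.child i).lo (W'.child i).lo)
    (hu' : u ≤ (W'.child i).hi) : W.pl i ≤ (W.child i).h u ∧ (W.child i).h u - W.pl i ≤ δ := by
  have hk := (Act.one_le i hi).1
  have hv := child_valid hW hi
  have h0 : (W.child i).lo ≤ u := hu ▸ le_max_left _ _
  refine ⟨?_, ?_⟩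
  · rw [← child_h_lo hW hk]
    exact h_mono hv h0
  rcases le_total (W'.child i).lo (W.child i).lo with h | h
  · rw [max_eq_left h] at hu
    rw [hu, child_h_lo hW hk, sub_self]
    exact hd.nonneg
  · rw [max_eq_right h] at hu
    have h1 := abs_le.1 (hd.pl hW hW' i)
    have h2 := abs_le.1 (hd.child_h hW hW' hi' hu.ge hu')
    have h3 : (W'.child i).h u = W'.pl i := by rw [hu, child_h_lo hW' hk]
    linarith

lemma Near.end_hi {δ : ℝ} (hW : W.Valid) (hW' : W'.Valid) (hd : Near W W' δ) (hi : W.Act i)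
    (hi' : W'.Act i) {u : ℝ} (hu : u = min (W.child i).hi (W'.child i).hi)
    (hu' : (W'.child i).lo ≤ u) : (W.child i).h u ≤ W.ph i ∧ W.ph i - (W.child i).h u ≤ δ := by
  have hk := (Act.one_le i hi).1
  have hv := child_valid hW hi
  have h0 : u ≤ (W.child i).hi := hu ▸ min_le_left _ _
  refine ⟨?_, ?_⟩
  · rw [← child_h_hi hW hk]
    exact h_mono hv h0
  rcases le_total (W.child i).hi (W'.child i).hi with h | h
  · rw [min_eq_left h] at hu
    rw [hu, child_h_hi hW hk, sub_self]
    exact hd.nonneg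
  · rw [min_eq_right h] at hu
    have h1 := abs_le.1 (hd.ph hW hW' i)
    have h2 := abs_le.1 (hd.child_h hW hW' hi' hu' hu.le)
    have h3 : (W'.child i).h u = W'.ph i := by rw [hu, child_h_hi hW' hk]
    linarith

/-- Contribution of a pair of unresolved pieces. -/
lemma Dyn.close_unres (hf : Dyn f M c α) (hc : 0 ≤ c) (hW : W.Valid) (hW' : W'.Valid) {δ σ : ℝ}
    (hd : Near W W' δ) (hδ : 0 < δ) (hδ1 : δ ≤ 1) (hσ : σ ≤ 1 / 20) (hσα : σ ≤ α)
    (hσ0 : 0 ≤ σ)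
    (hk : 1 ≤ i.2) (hm : m < tau i) {r : ℝ} (hr : |r| ≤ M) :
    |(∫ y in W.pl i..W.ph i, (f m (W.h y) y - r)) - ∫ y in W'.pl i..W'.ph i, (f m (W'.h y) y - r)|
      ≤ 42 * (c + 4 * M) * δ ^ σ * (W.chi + W'.chi) * (i.2:ℝ) ^ (-(9/4) : ℝ) := by
  have hM := hf.M_nonneg
  have hpl := abs_le.1 (hd.pl hW hW' i)
  have hph := abs_le.1 (hd.ph hW hW' i)
  have hχ := one_le_chi (W := W)
  have hχ' := one_le_chi (W := W')
  have hle := pl_le_ph hW i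
  have hle' := pl_le_ph hW' i
  have hbd : ∀ (X : Seg) (y : ℝ), |f m (X.h y) y - r| ≤ 2 * M := fun X y =>
    (abs_sub _ _).trans (by linarith [hf.bdd m (X.h y) y])
  have hI : ∀ (X : Seg) (a b : ℝ), IntervalIntegrable (fun y => f m (X.h y) y - r) volume a b :=
    fun X a b => (hf.integrable m X a b).sub (by simp)
  have sh : ∀ X : Seg, X.Valid → ∀ u v, X.pl i ≤ u → u ≤ v → v ≤ X.ph i → v - u ≤ δ →
      |∫ y in u..v, (f m (X.h y) y - r)| ≤
        2 * M * (42 * X.chi * δ ^ σ * (i.2:ℝ) ^ (-(9/4) : ℝ)) := by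
    intro X hX u v h1 h2 h3 h4
    refine (abs_integral_le (hbd X) h2).trans ?_
    have := short_le hX hk (sub_nonneg.2 h2) (by unfold plen; linarith) h4 hδ hδ1 hσ
    gcongr
  set k := (i.2:ℝ) ^ (-(9/4) : ℝ)
  have hk0 : 0 ≤ k := by positivity
  have hδσ : 0 < δ ^ σ := by positivity
  rcases lt_or_ge (max (W.pl i) (W'.pl i)) (min (W.ph i) (W'.ph i)) with h | h
  swap
  · have h1 : W.plen i ≤ δ ∧ W'.plen i ≤ δ := by
      unfold plen
      rcases le_total (W.pl i) (W'.pl i) with a1 | a1 <;>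
      rcases le_total (W.ph i) (W'.ph i) with a2 | a2 <;>
      simp only [max_eq_left, max_eq_right, min_eq_left, min_eq_right, a1, a2] at h <;>
      constructor <;> linarith
    have e1 := sh W hW _ _ le_rfl hle le_rfl h1.1
    have e2 := sh W' hW' _ _ le_rfl hle' le_rfl h1.2
    refine (abs_sub _ _).trans ?_
    have : 0 ≤ c * (42 * (W.chi + W'.chi) * δ ^ σ * k) := by positivity
    have : 0 ≤ M * (42 * (W.chi + W'.chi) * δ ^ σ * k) := by positivity
    linarith
  set p := max (W.pl i) (W'.pl i)
  set q := min (W.ph i) (W'.ph i)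
  have hp1 : W.pl i ≤ p := le_max_left _ _
  have hp2 : W'.pl i ≤ p := le_max_right _ _
  have hq1 : q ≤ W.ph i := min_le_left _ _
  have hq2 : q ≤ W'.ph i := min_le_right _ _
  have hp3 : p ≤ W.pl i + δ / 2 := max_le (by linarith) (by linarith)
  have hp4 : p ≤ W'.pl i + δ / 2 := max_le (by linarith) (by linarith)
  have hq3 : W.ph i - δ / 2 ≤ q := le_min (by linarith) (by linarith)
  have hq4 : W'.ph i - δ / 2 ≤ q := le_min (by linarith) (by linarith)
  have spl : ∀ X : Seg, ∫ y in X.pl i..X.ph i, (f m (X.h y) y - r) =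
      (∫ y in X.pl i..p, (f m (X.h y) y - r)) + (∫ y in p..q, (f m (X.h y) y - r)) +
        ∫ y in q..X.ph i, (f m (X.h y) y - r) := fun X => by
    rw [intervalIntegral.integral_add_adjacent_intervals (hI X _ _) (hI X _ _),
      intervalIntegral.integral_add_adjacent_intervals (hI X _ _) (hI X _ _)]
  have e1 := sh W hW _ _ le_rfl hp1 (h.le.trans hq1) (by linarith)
  have e2 := sh W' hW' _ _ le_rfl hp2 (h.le.trans hq2) (by linarith)
  have e3 := sh W hW _ _ (hp1.trans h.le) hq1 le_rfl (by linarith)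
  have e4 := sh W' hW' _ _ (hp2.trans h.le) hq2 le_rfl (by linarith)
  have e5 : |(∫ y in p..q, (f m (W.h y) y - r)) - ∫ y in p..q, (f m (W'.h y) y - r)| ≤
      c * δ ^ σ * (42 * W.chi * k) := by
    rw [← intervalIntegral.integral_sub (hI W _ _) (hI W' _ _)]
    have h1 : ∀ᵐ y : ℝ, y ∈ Set.uIoc p q →
        ‖(f m (W.h y) y - r) - (f m (W'.h y) y - r)‖ ≤ c * δ ^ σ := by
      filter_upwards [Measure.ae_ne volume q] with y hy hy2
      rw [Set.uIoc_of_le h.le] at hy2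
      have hyq := lt_of_le_of_ne hy2.2 hy
      rw [sub_sub_sub_cancel_right, Real.norm_eq_abs]
      refine (hf.unres W W' hW hW' i m y (by linarith [hy2.1]) (by linarith) (by linarith [hy2.1])
        (by linarith) hm).trans ?_
      have a1 := lo_le_pl (W := W) i
      have a2 := ph_le_hi hW i
      have a3 := hd.h_le hW (y := y) (by linarith [hy2.1]) (by linarith)
      refine mul_le_mul_of_nonneg_left ?_ hc
      exact (Real.rpow_le_rpow (abs_nonneg _) a3 (by linarith)).trans
        (Real.rpow_le_rpow_of_exponent_ge hδ hδ1 hσα)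
    have h2 := intervalIntegral.norm_integral_le_of_norm_le_const_ae h1
    refine h2.trans ?_
    rw [abs_of_pos (sub_pos.2 h)]
    have h3 := short_le hW hk (t := q - p) (sub_nonneg.2 h.le) (by unfold plen; linarith)
      (δ := 1) (by
        have := hW.lo0; have := hW.hi1; have := lo_le_pl (W := W) i; have := ph_le_hi hW i
        linarith) one_pos le_rfl hσ
    rw [Real.one_rpow, mul_one] at h3
    gcongr
  rw [spl W, spl W']
  have e6 : 0 ≤ c * δ ^ σ * (42 * W'.chi * k) := by positivity
  have f1 := abs_le.1 e1
  have f2 := abs_le.1 e2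
  have f3 := abs_le.1 e3
  have f4 := abs_le.1 e4
  have f5 := abs_le.1 e5
  rw [abs_le]
  constructor <;> linarith

lemma Near.ratio {δ σ : ℝ} (hW : W.Valid) (hd : Near W W' δ) (hδ : 0 < δ) (hδ1 : δ ≤ 1)
    (hσ : σ ≤ 1 / 20) (hδl : δ ≤ W.len ^ 2) (hs : W'.s ≤ W.s) (hk : 1 ≤ i.2) :
    |W'.lam i / W.lam i - 1| ≤ δ ^ σ := by
  have hl := lam_pos hW hk
  have hll : W'.lam i ≤ W.lam i := by unfold lam; linarith
  have hlen := len_pos hW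
  have q3 := hd.slope_le
  have q4 : 2 ≤ W.lam i := by
    have := hW.s0
    have : (1:ℝ) ≤ i.2 := by exact_mod_cast hk
    unfold lam; linarith
  have q5 : 1 - W'.lam i / W.lam i = (W.s - W'.s) / W.lam i := by
    have q6 : W.lam i - W'.lam i = W.s - W'.s := by unfold lam; ring
    rw [← q6]
    field_simp
  have q6 : W.s - W'.s ≤ 2 * δ / W.len := by rwa [le_div_iff₀ hlen]
  have q7 : δ / W.len ≤ √δ := by
    rw [div_le_iff₀ hlen]
    calc δ = √δ * √δ := (Real.mul_self_sqrt hδ.le).symm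
      _ ≤ √δ * W.len := mul_le_mul_of_nonneg_left (Real.sqrt_le_iff.2 ⟨hlen.le, hδl⟩)
          (Real.sqrt_nonneg δ)
  have q8 : √δ ≤ δ ^ σ := by
    rw [Real.sqrt_eq_rpow]
    exact Real.rpow_le_rpow_of_exponent_ge hδ hδ1 (by linarith)
  have q9 : (W.s - W'.s) / W.lam i ≤ (W.s - W'.s) / 2 :=
    div_le_div_of_nonneg_left (by linarith) two_pos q4
  have q10 : 2 * δ / W.len = 2 * (δ / W.len) := by ring
  rw [abs_sub_comm, abs_of_nonneg (by rw [sub_nonneg, div_le_one hl]; exact hll), q5]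
  linarith

set_option maxHeartbeats 1000000 in
/-- Contribution of a pair of resolved pieces. -/
lemma Dyn.close_res (hf : Dyn f M c α) (hW : W.Valid) (hW' : W'.Valid) {δ σ CD K K2 K3 r : ℝ}
    (hd : Near W W' δ) (hδ : 0 < δ) (hδ1 : δ ≤ 1) (hσ : σ ≤ 1 / 20)
    (hδl : δ ≤ W.len ^ 2) (hs : W'.s ≤ W.s) (hCD : 0 ≤ CD) (hK : 0 ≤ K) (hK2 : 0 ≤ K2)
    (hK3 : 0 ≤ K3) (hk : 1 ≤ i.2) (hm : tau i ≤ m) (hg : 0 ≤ g (m - tau i))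
    (hfar : ∀ W' : Seg, W'.Valid →
      |A f (m - tau i) W' - r| ≤ (W'.V + (3 + K + CD * tau i)) * g (m - tau i))
    (hcl : ∀ X X' : Seg, X.Valid → X'.Valid → CloseAt f g σ K2 K3 X X' (m - tau i)) :
    |(∫ y in W.pl i..W.ph i, (f m (W.h y) y - r)) - ∫ y in W'.pl i..W'.ph i, (f m (W'.h y) y - r)|
      ≤ (K2 * (δ / 2) ^ σ * (W.rho i + W'.rho i + K3 * W.plen i) +
        3 * (bd CD K δ σ W i + bd CD K δ σ W' i)) * g (m - tau i) := by
  have sh : ∀ X : Seg, X.Valid → ∀ u v, X.pl i ≤ u → u ≤ v → v ≤ X.ph i → v - u ≤ δ →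
      |∫ y in u..v, (f m (X.h y) y - r)| ≤ bd CD K δ σ X i * g (m - tau i) :=
    fun X hX u v h1 h2 h3 h4 => hf.piece_short hX hk hm hCD hK hg hfar hδ hδ1 hσ h1 h2 h3 h4
  have hb := bd_nonneg (W := W) (i := i) (σ := σ) hCD hK hδ.le
  have hb' := bd_nonneg (W := W') (i := i) (σ := σ) hCD hK hδ.le
  have hρ := rho_nonneg hW i
  have hρ' := rho_nonneg hW' i
  have hp := plen_nonneg hW i
  have hmain : 0 ≤ K2 * (δ / 2) ^ σ * (W.rho i + W'.rho i + K3 * W.plen i) := by positivity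
  have hshort : W.plen i ≤ δ ∧ W'.plen i ≤ δ →
      |(∫ y in W.pl i..W.ph i, (f m (W.h y) y - r)) - ∫ y in W'.pl i..W'.ph i, (f m (W'.h y) y - r)|
      ≤ (K2 * (δ / 2) ^ σ * (W.rho i + W'.rho i + K3 * W.plen i) +
        3 * (bd CD K δ σ W i + bd CD K δ σ W' i)) * g (m - tau i) := by
    intro h
    have e1 := sh W hW _ _ le_rfl (pl_le_ph hW i) le_rfl h.1
    have e2 := sh W' hW' _ _ le_rfl (pl_le_ph hW' i) le_rfl h.2
    refine (abs_sub _ _).trans ((add_le_add e1 e2).trans ?_)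
    rw [← add_mul]
    refine mul_le_mul_of_nonneg_right ?_ hg
    linarith
  by_cases hi : W.Act i
  swap
  · exact hshort (hd.short_of_not hW hW' hi)
  by_cases hi' : W'.Act i
  swap
  · exact hshort (hd.symm.short_of_not hW' hW hi').symm
  have hv := child_valid hW hi
  have hv' := child_valid hW' hi'
  rcases lt_or_ge (max (W.child i).lo (W'.child i).lo) (min (W.child i).hi (W'.child i).hi)
    with h | h
  swap
  · rcases le_max_iff.1 h with h | h <;> rcases min_le_iff.1 h with h | h
    · exact absurd h (not_le.2 hv.lt)
    · exact hshort (hd.symm.short hW' hW hi' hi h).symm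
    · exact hshort (hd.short hW hW' hi hi' h)
    · exact absurd h (not_le.2 hv'.lt)
  obtain ⟨u, hu⟩ : ∃ u, u = max (W.child i).lo (W'.child i).lo := ⟨_, rfl⟩
  obtain ⟨v, hv0⟩ : ∃ v, v = min (W.child i).hi (W'.child i).hi := ⟨_, rfl⟩
  rw [← hu, ← hv0] at h
  have hu1 : (W.child i).lo ≤ u := hu ▸ le_max_left _ _
  have hu2 : (W'.child i).lo ≤ u := hu ▸ le_max_right _ _
  have hv1 : v ≤ (W.child i).hi := hv0 ▸ min_le_left _ _
  have hv2 : v ≤ (W'.child i).hi := hv0 ▸ min_le_right _ _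
  obtain ⟨a1, a2⟩ := hd.end_lo hW hW' hi hi' hu (h.le.trans hv2)
  obtain ⟨a3, a4⟩ := hd.end_hi hW hW' hi hi' hv0 (hu2.trans h.le)
  obtain ⟨b1, b2⟩ := hd.symm.end_lo hW' hW hi' hi (hu.trans (max_comm _ _)) (h.le.trans hv1)
  obtain ⟨b3, b4⟩ := hd.symm.end_hi hW' hW hi' hi (hv0.trans (min_comm _ _)) (hu1.trans h.le)
  have auv := h_mono hv h.le
  have buv := h_mono hv' h.le
  have hI : ∀ (X : Seg) (a b : ℝ), IntervalIntegrable (fun y => f m (X.h y) y - r) volume a b :=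
    fun X a b => (hf.integrable m X a b).sub (by simp)
  have spl : ∀ X : Seg, ∫ y in X.pl i..X.ph i, (f m (X.h y) y - r) =
      (∫ y in X.pl i..(X.child i).h u, (f m (X.h y) y - r)) +
      (∫ y in (X.child i).h u..(X.child i).h v, (f m (X.h y) y - r)) +
        ∫ y in (X.child i).h v..X.ph i, (f m (X.h y) y - r) := fun X => by
    rw [intervalIntegral.integral_add_adjacent_intervals (hI X _ _) (hI X _ _),
      intervalIntegral.integral_add_adjacent_intervals (hI X _ _) (hI X _ _)]
  have e1 := sh W hW _ _ le_rfl a1 (auv.trans a3) a2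
  have e2 := sh W' hW' _ _ le_rfl b1 (buv.trans b3) b2
  have e3 := sh W hW _ _ (a1.trans auv) a3 le_rfl a4
  have e4 := sh W' hW' _ _ (b1.trans buv) b3 le_rfl b4
  have hl := lam_pos hW hk
  have hl' := lam_pos hW' hk
  have hvu : 0 < v - u := sub_pos.2 h
  have hCv := sub_valid hv hu1 h hv1
  have hCv' := sub_valid hv' hu2 h hv2
  have m1 : ∫ y in (W.child i).h u..(W.child i).h v, (f m (W.h y) y - r) =
      1 / W.lam i * ((v - u) * (A f (m - tau i) ((W.child i).sub u v) - r)) := by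
    rw [hf.integral_piece_sub hW hi hm r a1 auv a3, Y_child_h hW hk, Y_child_h hW hk,
      hf.integral_sub_A _ _ _ h]
  have m2 : ∫ y in (W'.child i).h u..(W'.child i).h v, (f m (W'.h y) y - r) =
      1 / W'.lam i * ((v - u) * (A f (m - tau i) ((W'.child i).sub u v) - r)) := by
    rw [hf.integral_piece_sub hW' hi' hm r b1 buv b3, Y_child_h hW' hk, Y_child_h hW' hk,
      hf.integral_sub_A _ _ _ h]
  have hnear : Near ((W.child i).sub u v) ((W'.child i).sub u v) (δ / 2) :=
    ⟨rfl, rfl, hd.child_h hW hW' hi' hu2 (h.le.trans hv2),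
      hd.child_h hW hW' hi' (hu2.trans h.le) hv2⟩
  have c1 := hcl _ _ hCv hCv' (δ / 2) (by positivity) (by linarith) hnear
  have d1 : ((W.child i).sub u v).D ≤ (W.child i).chi / (v - u) :=
    div_le_div_of_nonneg_right (sub_chi_le hv hu1 hv1) hvu.le
  have d2 : ((W'.child i).sub u v).D ≤ (W'.child i).chi / (v - u) :=
    div_le_div_of_nonneg_right (sub_chi_le hv' hu2 hv2) hvu.le
  have hχ := one_le_chi (W := W.child i)
  have hχ' := one_le_chi (W := W'.child i)
  have hll : W'.lam i ≤ W.lam i := by unfold lam; linarith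
  have d3 : (v - u) / W.lam i ≤ W.plen i := by
    rw [div_le_iff₀ hl, mul_comm, ← child_len]
    unfold len; linarith
  have main : |1 / W.lam i * ((v - u) * (A f (m - tau i) ((W.child i).sub u v) -
      A f (m - tau i) ((W'.child i).sub u v)))| ≤
      K2 * (δ / 2) ^ σ * (W.rho i + W'.rho i + K3 * W.plen i) * g (m - tau i) := by
    rw [← mul_assoc, abs_mul, abs_of_nonneg (by positivity)]
    calc _ ≤ 1 / W.lam i * (v - u) * (K2 * (δ / 2) ^ σ * ((W.child i).chi / (v - u) +
          (W'.child i).chi / (v - u) + K3) * g (m - tau i)) := by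
          refine mul_le_mul_of_nonneg_left (c1.trans ?_) (by positivity)
          refine mul_le_mul_of_nonneg_right (mul_le_mul_of_nonneg_left ?_ (by positivity)) hg
          linarith
      _ = K2 * (δ / 2) ^ σ * ((W.child i).chi / W.lam i + (W'.child i).chi / W.lam i +
          K3 * ((v - u) / W.lam i)) * g (m - tau i) := by
          field_simp
      _ ≤ _ := by
          rw [rho_act hi, rho_act hi']
          gcongr
  have e5 : |(W'.lam i / W.lam i - 1) * ∫ y in (W'.child i).h u..(W'.child i).h v,
      (f m (W'.h y) y - r)| ≤ bd CD K δ σ W' i * g (m - tau i) := by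
    have q1 := hf.piece_short hW' hk hm hCD hK hg hfar one_pos le_rfl hσ b1 buv b3 (by
        have := hW'.lo0; have := hW'.hi1; have := lo_le_pl (W := W') i; have := ph_le_hi hW' i
        linarith)
    have q2 := hd.ratio hW hδ hδ1 hσ hδl hs hk
    rw [abs_mul]
    calc _ ≤ δ ^ σ * (bd CD K 1 σ W' i * g (m - tau i)) := by gcongr
      _ = _ := by unfold bd; rw [Real.one_rpow]; ring
  have m3 : (∫ y in (W.child i).h u..(W.child i).h v, (f m (W.h y) y - r)) -
      (∫ y in (W'.child i).h u..(W'.child i).h v, (f m (W'.h y) y - r)) =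
      1 / W.lam i * ((v - u) * (A f (m - tau i) ((W.child i).sub u v) -
      A f (m - tau i) ((W'.child i).sub u v))) + (W'.lam i / W.lam i - 1) *
      ∫ y in (W'.child i).h u..(W'.child i).h v, (f m (W'.h y) y - r) := by
    rw [m1, m2]
    field_simp
    ring
  rw [spl W, spl W']
  have f1 := abs_le.1 e1
  have f2 := abs_le.1 e2
  have f3 := abs_le.1 e3
  have f4 := abs_le.1 e4
  have f5 := abs_le.1 e5
  have f6 := abs_le.1 main
  have z := mul_nonneg hb hg
  have z' := mul_nonneg hb' hg
  rw [abs_le]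
  constructor <;> linarith

end LTM

namespace LTM

variable {f : ℕ → ℝ → ℝ → ℝ} {M c α : ℝ} {g : ℕ → ℝ} {W W' : Seg} {m : ℕ}

/-- The reference segment. -/
def Seg.ref : Seg := ⟨1 / 2, 0, 0, 1⟩

open Seg

lemma Seg.ref_full : ref.Full := by
  constructor <;> norm_num [ref, Seg.h]

lemma Seg.ref_valid : ref.Valid := by
  constructor <;> norm_num [ref, Seg.h, Seg.L1, Seg.L2]

lemma Seg.ref_V : ref.V ≤ 3 := Full.V_le ref_valid ref_full

lemma Seg.exists_union (hW : W.Valid) (hW' : W'.Valid) : ∃ U : Finset Br,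
    (∀ i ∈ U, 1 ≤ i.2) ∧ W.pcs ⊆ U ∧ W'.pcs ⊆ U := by
  classical
  refine ⟨W.pcs ∪ W'.pcs, fun i hi => ?_, Finset.subset_union_left, Finset.subset_union_right⟩
  rcases Finset.mem_union.1 hi with hi | hi
  · exact (Act.one_le i ((mem_pcs hW).1 hi)).1
  · exact (Act.one_le i ((mem_pcs hW').1 hi)).1

lemma Seg.sum_pcs_subset (hW : W.Valid) {U : Finset Br} (hU : W.pcs ⊆ U) {u : Br → ℝ}
    (h : ∀ i, ¬ W.Act i → u i = 0) : ∑ i ∈ U, u i = ∑ i ∈ W.pcs, u i :=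
  (Finset.sum_subset hU fun i _ hi => h i (fun h' => hi ((mem_pcs hW).2 h'))).symm

lemma Seg.sum_rho_le {CD : ℝ} (hCD : Drift CD) (hW : W.Valid) {U : Finset Br} (hU : W.pcs ⊆ U) :
    ∑ i ∈ U, W.rho i ≤ 49 / 50 * W.chi + CD * W.len := by
  rw [sum_pcs_subset hW hU fun i hi => rho_not hi]
  refine (Finset.sum_congr rfl fun i hi => rho_act ((mem_pcs hW).1 hi)).trans_le ?_
  exact hCD W hW _

lemma Seg.sum_plen_le (hW : W.Valid) {U : Finset Br} (hU : W.pcs ⊆ U) :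
    ∑ i ∈ U, W.plen i ≤ W.len := by
  rw [sum_pcs_subset hW hU fun i hi => by rw [plen, not_act hW hi, sub_self]]
  exact (sum_pcs hW id).le

lemma Seg.rho_le (hW : W.Valid) {i : Br} (hk : 1 ≤ i.2) :
    W.rho i ≤ 16 * W.chi * (i.2:ℝ) ^ (-(5/4) : ℝ) := by
  have hχ := one_le_chi (W := W)
  by_cases hi : W.Act i
  · rw [rho_act hi]
    refine (ratio_le hW hi).trans ?_
    have : (1:ℝ) ≤ i.2 := by exact_mod_cast hk
    have h1 : (i.2:ℝ) ^ (-(3/2) : ℝ) ≤ (i.2:ℝ) ^ (-(5/4) : ℝ) :=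
      Real.rpow_le_rpow_of_exponent_le this (by norm_num)
    gcongr
  · rw [rho_not hi]; positivity

lemma Seg.plen_le_rpow (hW : W.Valid) {i : Br} (hk : 1 ≤ i.2) :
    W.plen i ≤ 42 * W.chi * (i.2:ℝ) ^ (-(5/4) : ℝ) := by
  have hχ := one_le_chi (W := W)
  have h := short_le hW hk (plen_nonneg hW i) le_rfl ((plen_le_len hW i).trans (len_le hW))
    one_pos le_rfl (σ := 0) (by norm_num)
  rw [Real.one_rpow, mul_one] at h
  refine h.trans ?_
  have : (1:ℝ) ≤ i.2 := by exact_mod_cast hk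
  gcongr
  norm_num

lemma Dyn.sub_eq_sum (hf : Dyn f M c α) (hW : W.Valid) (m : ℕ) (r : ℝ) {U : Finset Br}
    (hU : W.pcs ⊆ U) :
    W.len * (A f m W - r) = ∑ i ∈ U, ∫ y in W.pl i..W.ph i, (f m (W.h y) y - r) := by
  rw [sum_pcs_subset hW hU fun i hi => by rw [not_act hW hi, intervalIntegral.integral_same],
    ← integral_eq_sum (fun a b => (hf.integrable m W a b).sub (by simp)) hW, hf.integral_sub_const]
  change W.len * _ = _ - W.len * r
  have := (len_pos hW).ne'
  rw [A]
  field_simp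

lemma Near.len {δ : ℝ} (hd : Near W W' δ) : W'.len = W.len := by
  unfold Seg.len; rw [hd.lo, hd.hi]

/-- Nearby segments whose distance is not small compared with their length. -/
lemma close_far {σ K2 K3 CD K δ : ℝ} (hW : W.Valid) (hW' : W'.Valid) (hd : Near W W' δ)
    (hδ : 0 < δ) (hσ0 : 0 < σ) (hσ : σ ≤ 1 / 20) (hK : 1 ≤ K) (hK2 : 1 + K ≤ K2) (hK3 : 0 ≤ K3)
    (hg : 0 < g m) (hδl : W.len ^ 2 < δ) (h : FarAt f g CD K W m W' m) :
    |A f m W - A f m W'| ≤ K2 * δ ^ σ * (W.D + W'.D + K3) * g m := by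
  unfold FarAt at h
  rw [sub_self, abs_zero, mul_zero, add_zero, min_self] at h
  have hl := len_pos hW
  have key : ∀ X : Seg, X.Valid → X.len = W.len → X.V ≤ δ ^ σ * X.D := by
    intro X hX hXl
    have h1 : X.len ^ (1/10 : ℝ) ≤ δ ^ σ := by
      rw [hXl]
      calc W.len ^ (1/10 : ℝ) ≤ W.len ^ (2 * σ) :=
            Real.rpow_le_rpow_of_exponent_ge hl (len_le hW) (by linarith)
        _ = (W.len ^ 2) ^ σ := by
            rw [← Real.rpow_natCast, ← Real.rpow_mul hl.le]; norm_num
        _ ≤ δ ^ σ := Real.rpow_le_rpow (by positivity) hδl.le hσ0.le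
    have hD := one_le_D hX
    have hχ := one_le_chi (W := X)
    have hXl' := len_pos hX
    have h2 : X.D = X.V * X.D ^ (1/10 : ℝ) := by
      unfold V
      rw [← Real.rpow_add (by linarith)]
      norm_num
    have h3 : 1 ≤ X.len ^ (1/10 : ℝ) * X.D ^ (1/10 : ℝ) := by
      rw [← Real.mul_rpow hXl'.le (by linarith)]
      refine Real.one_le_rpow ?_ (by norm_num)
      unfold D
      rw [mul_div_cancel₀ _ hXl'.ne']
      exact hχ
    have hV := one_le_V hX
    have hD0 : 0 < X.D ^ (1/10 : ℝ) := Real.rpow_pos_of_pos (by linarith) _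
    calc X.V = X.V * 1 := (mul_one _).symm
      _ ≤ X.V * (X.len ^ (1/10 : ℝ) * X.D ^ (1/10 : ℝ)) := by gcongr
      _ ≤ X.V * (δ ^ σ * X.D ^ (1/10 : ℝ)) := by gcongr
      _ = _ := by nth_rw 2 [h2]; ring
  have h1 := key W hW rfl
  have h2 := key W' hW' hd.len
  have h3 := one_le_V hW
  have h4 := one_le_V hW'
  have h5 : K ≤ K * (δ ^ σ * W.D) := by nlinarith
  have hD := one_le_D hW
  have hD' := one_le_D hW'
  have hδσ : 0 < δ ^ σ := by positivity
  have h6 : 0 ≤ K * (δ ^ σ * W'.D) := by positivity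
  calc |A f m W - A f m W'| ≤ (W.V + W'.V + K) * g m := by linarith
    _ ≤ ((1 + K) * (δ ^ σ * (W.D + W'.D))) * g m := by
        refine mul_le_mul_of_nonneg_right ?_ hg.le
        linarith
    _ ≤ (K2 * (δ ^ σ * (W.D + W'.D + K3))) * g m := by
        have h7 : W.D + W'.D ≤ W.D + W'.D + K3 := by linarith
        have h8 : 0 ≤ δ ^ σ * (W.D + W'.D + K3) := by positivity
        exact mul_le_mul_of_nonneg_right (mul_le_mul hK2 (mul_le_mul_of_nonneg_left h7 hδσ.le)
          (by positivity) (by linarith)) hg.le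
    _ = _ := by ring

/-- Total contribution of unresolved pieces. -/
lemma Dyn.close_sum_unres (hf : Dyn f M c α) (hM : 1 ≤ M) (hc : 0 ≤ c) {ζ : ℝ}
    (hg : Slow g ζ (2 * M)) (hζ : ζ ≤ 1) (hW : W.Valid) (hW' : W'.Valid)
    {δ σ : ℝ} (hd : Near W W' δ) (hδ : 0 < δ) (hδ1 : δ ≤ 1) (hσ : σ ≤ 1 / 20) (hσα : σ ≤ α)
    (hσ0 : 0 ≤ σ) {r : ℝ} (hr : |r| ≤ M) {U : Finset Br} (hU : ∀ i ∈ U, 1 ≤ i.2 ∧ m < tau i) :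
    ∑ i ∈ U, |(∫ y in W.pl i..W.ph i, (f m (W.h y) y - r)) -
      ∫ y in W'.pl i..W'.ph i, (f m (W'.h y) y - r)| ≤
      42 * (c + 4 * M) * δ ^ σ * (W.chi + W'.chi) * g m := by
  have hχ := one_le_chi (W := W)
  have hχ' := one_le_chi (W := W')
  have hgm := hg.pos m
  have hX : 0 ≤ 42 * (c + 4 * M) * δ ^ σ * (W.chi + W'.chi) := by positivity
  have h := hg.unres U m _ _ hX fun i hi => ⟨(hU i hi).1, (hU i hi).2,
    hf.close_unres hc hW hW' hd hδ hδ1 hσ hσα hσ0 (hU i hi).1 (hU i hi).2 hr⟩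
  have h0 := Finset.sum_nonneg fun i (_ : i ∈ U) => abs_nonneg
    ((∫ y in W.pl i..W.ph i, (f m (W.h y) y - r)) - ∫ y in W'.pl i..W'.ph i, (f m (W'.h y) y - r))
  have h1 : ζ * (42 * (c + 4 * M) * δ ^ σ * (W.chi + W'.chi)) * g m ≤
      1 * (42 * (c + 4 * M) * δ ^ σ * (W.chi + W'.chi)) * g m := by gcongr
  nlinarith

/-- Total contribution of resolved pieces. -/
lemma Dyn.close_sum_res (hf : Dyn f M c α) {ζ : ℝ} (hg : Slow g ζ (2 * M)) (hζ1 : ζ ≤ 1)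
    (hW : W.Valid) (hW' : W'.Valid) {δ σ CD K K2 K3 r : ℝ} (hd : Near W W' δ)
    (hδ : 0 < δ) (hδ1 : δ ≤ 1) (hσ : σ ≤ 1 / 20) (hδl : δ ≤ W.len ^ 2) (hs : W'.s ≤ W.s)
    (hCD1 : 1 ≤ CD) (hCD : Drift CD) (hK : 0 ≤ K) (hK2 : 0 ≤ K2) (hK3 : 0 ≤ K3)
    (hζ3 : ζ * (16 + 42 * K3) ≤ 1 / 1000)
    {U V : Finset Br} (hU : ∀ i ∈ U, 1 ≤ i.2 ∧ tau i ≤ m) (hUV : U ⊆ V) (hV : W.pcs ⊆ V)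
    (hV' : W'.pcs ⊆ V)
    (hfar : ∀ i, 1 ≤ i.2 → tau i ≤ m → ∀ X : Seg, X.Valid →
      |A f (m - tau i) X - r| ≤ (X.V + (3 + K + CD * tau i)) * g (m - tau i))
    (hcl : ∀ i, 1 ≤ i.2 → tau i ≤ m → ∀ X X' : Seg, X.Valid → X'.Valid →
      CloseAt f g σ K2 K3 X X' (m - tau i)) :
    ∑ i ∈ U, |(∫ y in W.pl i..W.ph i, (f m (W.h y) y - r)) -
      ∫ y in W'.pl i..W'.ph i, (f m (W'.h y) y - r)| ≤
      (K2 * (δ / 2) ^ σ * (981 / 1000 * (W.chi + W'.chi) + (2 * CD + K3) * W.len) +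
        3 * (16 + 42 * (3 + 2 * CD)) * (2 * ∑' k : ℕ, (k:ℝ) ^ (-(5/4) : ℝ) + 1) *
        (1 + K) * δ ^ σ * (W.chi + W'.chi)) * g m := by
  have hχ := one_le_chi (W := W)
  have hχ' := one_le_chi (W := W')
  have hgm := hg.pos m
  have hδσ : 0 < δ ^ σ := by positivity
  set q := K2 * (δ / 2) ^ σ
  have hq : 0 ≤ q := by positivity
  set B := 3 * (16 + 42 * (3 + 2 * CD)) * (1 + K) * δ ^ σ * (W.chi + W'.chi)
  have hB : 0 ≤ B := by positivity
  have hterm : ∀ i ∈ U, |(∫ y in W.pl i..W.ph i, (f m (W.h y) y - r)) -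
      ∫ y in W'.pl i..W'.ph i, (f m (W'.h y) y - r)| ≤
      q * ((W.rho i + W'.rho i + K3 * W.plen i) * g (m - tau i)) +
        (B * (i.2:ℝ) ^ (-(5/4) : ℝ)) * g (m - tau i) := by
    intro i hi
    obtain ⟨h1, h2⟩ := hU i hi
    refine (hf.close_res hW hW' hd hδ hδ1 hσ hδl hs (by linarith) hK hK2 hK3 h1 h2 (hg.pos _).le
      (hfar i h1 h2) (hcl i h1 h2)).trans (le_of_eq ?_)
    simp only [bd, B, q]
    ring
  refine (Finset.sum_le_sum hterm).trans ?_
  rw [Finset.sum_add_distrib, ← Finset.mul_sum]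
  have h1 := hg.star U m (fun i => W.rho i + W'.rho i + K3 * W.plen i)
    ((16 + 42 * K3) * (W.chi + W'.chi)) (by positivity) fun i hi => by
      obtain ⟨h1, h2⟩ := hU i hi
      have a1 := rho_nonneg hW i
      have a2 := rho_nonneg hW' i
      have a3 := plen_nonneg hW i
      refine ⟨h1, h2, by positivity, ?_⟩
      have b1 := rho_le hW h1
      have b2 := rho_le hW' h1
      have b3 := mul_le_mul_of_nonneg_left (plen_le_rpow hW h1) hK3
      have b4 : 0 ≤ K3 * (42 * W'.chi * (i.2:ℝ) ^ (-(5/4) : ℝ)) := by positivity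
      linarith
  have h2 := hg.star U m (fun i => B * (i.2:ℝ) ^ (-(5/4) : ℝ)) B hB fun i hi =>
    ⟨(hU i hi).1, (hU i hi).2, by positivity, le_rfl⟩
  have h3 : ∑ i ∈ U, (W.rho i + W'.rho i + K3 * W.plen i) ≤
      49 / 50 * (W.chi + W'.chi) + (2 * CD + K3) * W.len := by
    refine (Finset.sum_le_sum_of_subset_of_nonneg hUV fun i hi _ => ?_).trans ?_
    · have a1 := rho_nonneg hW i
      have a2 := rho_nonneg hW' i
      have a3 := plen_nonneg hW i
      positivity
    · rw [Finset.sum_add_distrib, Finset.sum_add_distrib, ← Finset.mul_sum]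
      have a1 := sum_rho_le hCD hW hV
      have a2 := sum_rho_le hCD hW' hV'
      have a3 := mul_le_mul_of_nonneg_left (sum_plen_le hW hV) hK3
      rw [hd.len] at a2
      linarith
  have h4 : ∑ i ∈ U, B * (i.2:ℝ) ^ (-(5/4) : ℝ) ≤ B * (2 * ∑' k : ℕ, (k:ℝ) ^ (-(5/4) : ℝ)) := by
    rw [← Finset.mul_sum]
    exact mul_le_mul_of_nonneg_left (sum_rpow_le (by norm_num) U) hB
  have h5 : ζ * ((16 + 42 * K3) * (W.chi + W'.chi)) ≤ 1 / 1000 * (W.chi + W'.chi) := by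
    rw [← mul_assoc]; gcongr
  have h6 : ζ * B ≤ 1 * B := by gcongr
  have h7 : ∑ i ∈ U, (W.rho i + W'.rho i + K3 * W.plen i) * g (m - tau i) ≤
      (981 / 1000 * (W.chi + W'.chi) + (2 * CD + K3) * W.len) * g m := by
    refine h1.trans ?_
    rw [← add_mul]
    refine mul_le_mul_of_nonneg_right ?_ hgm.le
    linarith
  have h8 : ∑ i ∈ U, B * (i.2:ℝ) ^ (-(5/4) : ℝ) * g (m - tau i) ≤
      B * (2 * ∑' k : ℕ, (k:ℝ) ^ (-(5/4) : ℝ) + 1) * g m := by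
    refine h2.trans ?_
    rw [← add_mul]
    refine mul_le_mul_of_nonneg_right ?_ hgm.le
    linarith
  refine (add_le_add (mul_le_mul_of_nonneg_left h7 hq) h8).trans (le_of_eq ?_)
  simp only [B]
  ring

set_option maxHeartbeats 800000 in
/-- The inductive step for the comparison of nearby segments. -/
lemma exists_close_step (hf : Dyn f M c α) (hM : 1 ≤ M) (hc : 0 ≤ c) {CD σ : ℝ} (hCD1 : 1 ≤ CD)
    (hCD : Drift CD) (hσ0 : 0 < σ) (hσ : σ ≤ 1 / 20) (hσα : σ ≤ α) :
    ∃ c6 K3 : ℝ, 0 ≤ c6 ∧ 0 ≤ K3 ∧ ∀ (g : ℕ → ℝ) (ζ K : ℝ), 1 ≤ K → 0 < ζ → ζ ≤ 1 →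
      ζ * (16 + 42 * K3) ≤ 1 / 1000 → Slow g ζ (2 * M) → ∀ N, FarLt f g CD K (N + 1) →
      CloseLt f g σ (c6 * (1 + K)) K3 N → CloseLt f g σ (c6 * (1 + K)) K3 (N + 1) := by
  set q : ℝ := (1 / 2) ^ σ
  have hq0 : 0 < q := by positivity
  have hq1 : q < 1 := Real.rpow_lt_one (by norm_num) (by norm_num) hσ0
  set K3 := 2 * CD * q / (1 - q)
  have hK3 : 0 ≤ K3 := div_nonneg (by positivity) (by linarith)
  have hK3q : q * (2 * CD + K3) = K3 := by
    simp only [K3]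
    have : 1 - q ≠ 0 := by linarith
    field_simp
    ring
  set S := 2 * ∑' k : ℕ, (k:ℝ) ^ (-(5/4) : ℝ) + 1
  have hS : 1 ≤ S := by
    have : 0 ≤ ∑' k : ℕ, (k:ℝ) ^ (-(5/4) : ℝ) := tsum_nonneg fun k => by positivity
    simp only [S]; linarith
  set C1 := 3 * (16 + 42 * (3 + 2 * CD)) * S
  set C2 := 42 * (c + 4 * M)
  have hC1 : 1 ≤ C1 := by
    simp only [C1]
    nlinarith
  have hC2 : 0 ≤ C2 := by positivity
  refine ⟨100 * (C1 + C2), K3, by positivity, hK3, fun g ζ K hK hζ hζ1 hζ3 hg N hfar hclose => ?_⟩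
  set K2 := 100 * (C1 + C2) * (1 + K)
  have hK2 : 0 ≤ K2 := by positivity
  have hmain : ∀ W W' : Seg, W.Valid → W'.Valid → ∀ m, 2 * m < N + 1 → W'.s ≤ W.s →
      CloseAt f g σ K2 K3 W W' m := by
    intro W W' hW hW' m hm hs δ hδ hδ1 hd
    have hgm := hg.pos m
    rcases lt_or_ge (W.len ^ 2) δ with hδl | hδl
    · refine close_far hW hW' hd hδ hσ0 hσ hK ?_ hK3 hgm hδl (hfar W W' hW hW' m m (by omega))
      simp only [K2]
      nlinarith
    obtain ⟨V, hV1, hV, hV'⟩ := exists_union hW hW'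
    set r := A f m ref
    have hr : |r| ≤ M := hf.A_le m ref_valid
    have hχ := one_le_chi (W := W)
    have hχ' := one_le_chi (W := W')
    have hδσ : 0 < δ ^ σ := by positivity
    have hl := len_pos hW
    have e1 := hf.close_sum_unres hM hc hg hζ1 hW hW' hd hδ hδ1 hσ hσα hσ0.le hr
      (U := V.filter fun i => ¬ tau i ≤ m) (fun i hi => by
        rw [Finset.mem_filter, not_le] at hi
        exact ⟨hV1 i hi.1, hi.2⟩)
    have e2 := hf.close_sum_res hg hζ1 hW hW' hd hδ hδ1 hσ hδl hs hCD1 hCD (K := K) (by linarith) hK2 hK3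
      hζ3 (U := V.filter fun i => tau i ≤ m) (fun i hi => by
        rw [Finset.mem_filter] at hi
        exact ⟨hV1 i hi.1, hi.2⟩) (Finset.filter_subset _ _) hV hV' (r := r)
      (fun i h1 h2 X hX => by
        have h3 := one_le_tau h1
        have h4 := hfar X ref hX ref_valid (m - tau i) m (by omega)
        unfold FarAt at h4
        have h5 := ref_V
        have h6 := hg.anti (Nat.sub_le m (tau i))
        have h7 := hg.pos m
        rw [min_eq_left (Nat.sub_le _ _), Nat.cast_sub h2, sub_sub_cancel_left,
          abs_neg, Nat.abs_cast] at h4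
        have h8 : ref.V * g m ≤ 3 * g (m - tau i) := by gcongr
        linarith)
      (fun i h1 h2 X X' hX hX' => hclose X X' hX hX' _ (by
        have h3 := one_le_tau h1
        omega))
    have e3 : W.len * (A f m W - A f m W') = ∑ i ∈ V, ((∫ y in W.pl i..W.ph i, (f m (W.h y) y - r)) -
        ∫ y in W'.pl i..W'.ph i, (f m (W'.h y) y - r)) := by
      rw [Finset.sum_sub_distrib, ← hf.sub_eq_sum hW m r hV, ← hf.sub_eq_sum hW' m r hV', hd.len]
      ring
    have e4 : W.len * |A f m W - A f m W'| ≤ ∑ i ∈ V, |(∫ y in W.pl i..W.ph i, (f m (W.h y) y - r)) -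
        ∫ y in W'.pl i..W'.ph i, (f m (W'.h y) y - r)| := by
      rw [show W.len * |A f m W - A f m W'| = |W.len * (A f m W - A f m W')| by
        rw [abs_mul, abs_of_pos hl], e3]
      exact Finset.abs_sum_le_sum_abs _ _
    rw [← Finset.sum_filter_add_sum_filter_not V (fun i => tau i ≤ m)] at e4
    have e5 : (δ / 2) ^ σ = δ ^ σ * q := by
      rw [div_eq_mul_one_div, Real.mul_rpow hδ.le (by norm_num)]
    rw [e5] at e2
    have e6 : W.len * |A f m W - A f m W'| ≤
        (K2 * δ ^ σ * ((W.chi + W'.chi) + K3 * W.len)) * g m := by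
      refine (e4.trans (add_le_add e2 e1)).trans ?_
      rw [← add_mul]
      refine mul_le_mul_of_nonneg_right ?_ hgm.le
      have s1 : K2 * (δ ^ σ * q) * (981 / 1000 * (W.chi + W'.chi) + (2 * CD + K3) * W.len) ≤
          K2 * δ ^ σ * (981 / 1000 * (W.chi + W'.chi) + K3 * W.len) := by
        have : K2 * (δ ^ σ * q) * (981 / 1000 * (W.chi + W'.chi) + (2 * CD + K3) * W.len) =
          K2 * δ ^ σ * (q * (981 / 1000 * (W.chi + W'.chi)) + q * (2 * CD + K3) * W.len) := by ring
        rw [this, hK3q]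
        exact mul_le_mul_of_nonneg_left
          (add_le_add (mul_le_of_le_one_left (by positivity) hq1.le) le_rfl) (by positivity)
      have s2 : C2 * δ ^ σ * (W.chi + W'.chi) ≤ C2 * (1 + K) * δ ^ σ * (W.chi + W'.chi) := by
        gcongr
        exact le_mul_of_one_le_right hC2 (by linarith)
      have s3 : (C1 + C2) * (1 + K) * δ ^ σ * (W.chi + W'.chi) =
          1 / 100 * (K2 * δ ^ σ * (W.chi + W'.chi)) := by simp only [K2]; ring
      have s4 : 0 ≤ K2 * δ ^ σ * (W.chi + W'.chi) := by positivity
      change _ + C1 * (1 + K) * δ ^ σ * (W.chi + W'.chi) + C2 * δ ^ σ * (W.chi + W'.chi) ≤ _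
      linarith
    have e7 : W'.D = W'.chi / W.len := by unfold D; rw [hd.len]
    rw [e7]
    unfold D
    rw [mul_comm, ← le_div_iff₀ hl] at e6
    refine e6.trans (le_of_eq ?_)
    field_simp
  intro W W' hW hW' m hm
  rcases le_total W'.s W.s with hs | hs
  · exact hmain W W' hW hW' m hm hs
  · intro δ hδ hδ1 hd
    rw [abs_sub_comm, add_comm W.D]
    exact hmain W' W hW' hW m hm hs δ hδ hδ1 hd.symm

end LTM

namespace LTM

variable {f : ℕ → ℝ → ℝ → ℝ} {M c α : ℝ}

/-- Averages over any two segments agree up to a summable error. -/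
lemma exists_far (hf : Dyn f M c α) (hM : 1 ≤ M) (hc : 0 ≤ c) (hα : 0 < α)
    {CD : ℝ} (hCD1 : 1 ≤ CD) (hCD : Drift CD) {Z : ℝ} (hZ : 0 ≤ Z) :
    ∃ (K ζ : ℝ) (g : ℕ → ℝ) (Kg : ℝ), 1 ≤ K ∧ 0 < ζ ∧ ζ * Z ≤ 1 ∧
      ζ * (84 * (2 + K + CD)) ≤ 1 / 400 ∧ Slow g ζ (2 * M) ∧
      0 < Kg ∧ (∀ m : ℕ, g m ≤ Kg * ((m:ℝ) + 1) ^ (-(6/5) : ℝ)) ∧ ∀ N, FarLt f g CD K N := by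
  set σ := min α (1 / 20)
  have hσ0 : 0 < σ := lt_min hα (by norm_num)
  obtain ⟨n0, hn0⟩ := exists_tail (ρ := 1 / (400 * CD)) (by positivity)
  set R0 := max n0 1
  have hR0 : ∀ W : Seg, W.Valid → ∀ s ⊆ W.pcs, (∀ i ∈ s, R0 < tau i) →
      ∑ i ∈ s, W.w i * tau i ≤ 1 / (400 * CD) * W.V := fun W hW s hs h =>
    hn0 W hW s hs fun i hi => (le_max_left _ _).trans_lt (h i hi)
  have hR01 : 1 ≤ R0 := le_max_right _ _
  obtain ⟨L, hL, hLs⟩ := exists_sum_tau (ρ := 1 / (400 * CD * 2 ^ R0)) (by positivity)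
  set V0 : ℝ := 400 * (CD + CD * (R0 + L) * 2 ^ R0)
  have hV0 : 0 < V0 := by positivity
  obtain ⟨c6, K3, hc6, hK3, hstep⟩ := exists_close_step hf hM hc hCD1 hCD hσ0
    (min_le_right _ _) (min_le_left _ _)
  obtain ⟨C, β, hC, hβ, hβ1, hgood⟩ := Good.bounded (σ := σ) (c6 := c6) (K3 := K3) hf hCD1 hCD
    hσ0 hc6 hV0 R0
  set K := max 1 (C / β)
  have hK : 1 ≤ K := le_max_left _ _
  have hCK : C ≤ β * K := by
    have : C / β ≤ K := le_max_right _ _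
    rw [div_le_iff₀ hβ] at this
    linarith
  set B : ℝ := 1 + K + 400 * (84 * (2 + K + CD * (R0 + 1))) + 1000 * (16 + 42 * K3) + Z with hB
  have hB0 : 0 < B := by positivity
  have hRn : (0:ℝ) ≤ R0 := by positivity
  have hb : ∀ x y : ℝ, 0 ≤ y → y * x ≤ B → 0 < y → 1 / B * x ≤ 1 / y := fun x y _ h1 h2 => by
    rw [one_div_mul_eq_div, div_le_div_iff₀ hB0 h2]
    linarith
  have hζK : 1 / B * K ≤ 1 := by
    have := hb K 1 zero_le_one (by rw [hB, one_mul]; nlinarith [mul_nonneg (by linarith : 0 ≤ CD) hRn]) one_pos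
    simpa using this
  have hζZ : 1 / B * Z ≤ 1 := by
    have := hb Z 1 zero_le_one (by rw [hB, one_mul]; nlinarith [mul_nonneg (by linarith : 0 ≤ CD) hRn]) one_pos
    simpa using this
  have hζ1 : 1 / B ≤ 1 := by
    have := hb 1 1 zero_le_one (by rw [hB, one_mul]; nlinarith [mul_nonneg (by linarith : 0 ≤ CD) hRn]) one_pos
    simpa using this
  have hζ2 : 1 / B * (84 * (2 + K + CD * (R0 + 1))) ≤ 1 / 400 :=
    hb _ 400 (by norm_num) (by rw [hB]; nlinarith [mul_nonneg (by linarith : 0 ≤ CD) hRn]) (by norm_num)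
  have hζ3 : 1 / B * (16 + 42 * K3) ≤ 1 / 1000 :=
    hb _ 1000 (by norm_num) (by rw [hB]; nlinarith [mul_nonneg (by linarith : 0 ≤ CD) hRn]) (by norm_num)
  have hζ0 : 0 < 1 / B := by positivity
  have hζ4 : 1 / B * (84 * (2 + K + CD)) ≤ 1 / 400 := by
    refine le_trans ?_ hζ2
    refine mul_le_mul_of_nonneg_left ?_ hζ0.le
    nlinarith [mul_nonneg (by linarith : 0 ≤ CD) hRn]
  obtain ⟨g, hg, Kg, hKg, hgK⟩ := exists_slow hζ0 (by linarith : 0 ≤ 2 * M)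
  refine ⟨K, 1 / B, g, Kg, hK, hζ0, hζZ, hζ4, hg, hKg, hgK, ?_⟩
  suffices h : ∀ N, FarLt f g CD K N ∧ CloseLt f g σ (c6 * (1 + K)) K3 N from fun N => (h N).1
  intro N
  induction N with
  | zero => exact ⟨fun W W' _ _ m m' h => by omega, fun W W' _ _ m h => by omega⟩
  | succ N ih =>
    obtain ⟨ihf, ihc⟩ := ih
    have h1 : FarLt f g CD K (N + 1) := by
      intro W W' hW hW' m m' hm
      rcases Nat.lt_or_ge (m + m') N with h | h
      · exact ihf W W' hW hW' m m' h
      have e : m + m' = N := by omega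
      have e' : m' + m = N := by omega
      by_cases d1 : m' + R0 ≤ m
      · exact far_ahead hf hg hCD1 hCD hK hζ4 hR0 hW hW' d1 (by omega) (e ▸ ihf)
      by_cases d2 : m + R0 ≤ m'
      · exact (far_ahead hf hg hCD1 hCD hK hζ4 hR0 hW' hW d2 (by omega) (e' ▸ ihf)).symm
      by_cases v1 : V0 ≤ W.V
      · exact far_bad hf hg hCD1 hCD hK hL hζ2 hLs le_rfl hW hW' (by omega) (by omega) v1 (e ▸ ihf)
      by_cases v2 : V0 ≤ W'.V
      · exact (far_bad hf hg hCD1 hCD hK hL hζ2 hLs le_rfl hW' hW (by omega) (by omega) v2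
          (e' ▸ ihf)).symm
      push Not at v1 v2
      have h2 := hgood g (1 / B) K hK hζ0 hζK hg N ihf ihc W W' hW hW' m m'
        ⟨v1.le, v2.le, abs_le.2 ⟨by omega, by omega⟩⟩ (by omega)
      have hG := hg.pos (min m m')
      have p1 : 0 ≤ W.V * g m := mul_nonneg (by linarith [Seg.one_le_V hW]) (hg.pos m).le
      have p2 : 0 ≤ W'.V * g m' := mul_nonneg (by linarith [Seg.one_le_V hW']) (hg.pos m').le
      have p3 : 0 ≤ CD * |(m:ℝ) - m'| := by positivity
      have p4 : (C + (1 - β) * K) * g (min m m') ≤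
          (K + CD * |(m:ℝ) - m'|) * g (min m m') := by
        refine mul_le_mul_of_nonneg_right ?_ hG.le
        linarith
      unfold FarAt
      linarith
    exact ⟨h1, hstep g (1 / B) K hK hζ0 hζ1 hζ3 hg N h1 ihc⟩

end LTM

namespace LTM

/-- Normalised Hölder test functions. -/
structure Test (α : ℝ) (ψ : ℝ → ℝ) : Prop where
  cont : Continuous ψ
  le : ∀ y, 0 ≤ y → y ≤ 1 → |ψ y| ≤ 1
  hold : ∀ y z, |ψ y - ψ z| ≤ |y - z| ^ α

variable {f : ℕ → ℝ → ℝ → ℝ} {M c α : ℝ} {g : ℕ → ℝ} {ζ CD K : ℝ}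

lemma dyn_one (α : ℝ) : Dyn (fun _ _ _ => 1) 1 0 α where
  bdd := by simp
  meas := fun _ => measurable_const
  step := by simp
  unres := by simp

lemma Dyn.integrable_mul (hf : Dyn f M c α) {ψ : ℝ → ℝ} (hψ : Continuous ψ) (m : ℕ) (W : Seg)
    (a b : ℝ) : IntervalIntegrable (fun y => ψ y * f m (W.h y) y) volume a b := by
  simp only [mul_comm (ψ _)]
  exact (hf.integrable m W a b).mul_continuousOn hψ.continuousOn

lemma Test.child {ψ : ℝ → ℝ} (hα : 0 < α) (hψ : Test α ψ) {W : Seg} (hW : W.Valid) {i : Br}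
    (hi : W.Act i) : ∃ η : ℝ → ℝ, Test α η ∧
      ∀ y, ψ y = ψ (W.pl i) + (1 / 2) ^ α * η (W.Y i y) := by
  have hk := (Seg.Act.one_le i hi).1
  have hk1 : (1:ℝ) ≤ i.2 := by exact_mod_cast hk
  have hl := Seg.lam_pos hW hk
  have hl2 : 2 ≤ W.lam i := by unfold Seg.lam; linarith [hW.s0]
  have hρ : (0:ℝ) < (1 / 2) ^ α := by positivity
  have hl0 := hl.ne'
  have e : ∀ y, W.Y i y = W.lam i * y + (W.a - 2 * jj i) := fun y => by
    unfold Seg.Y Seg.lam Seg.h; ring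
  have e1 : ∀ Y Z : ℝ, |(Y - (W.a - 2 * jj i)) / W.lam i - (Z - (W.a - 2 * jj i)) / W.lam i| ^ α ≤
      (1 / 2) ^ α * |Y - Z| ^ α := fun Y Z => by
    rw [← Real.mul_rpow (by norm_num) (abs_nonneg _)]
    refine Real.rpow_le_rpow (abs_nonneg _) ?_ hα.le
    rw [← sub_div, sub_sub_sub_cancel_right, abs_div, abs_of_pos hl, div_eq_inv_mul]
    gcongr
    rw [one_div]
    exact inv_anti₀ two_pos hl2
  refine ⟨fun Y => (ψ ((Y - (W.a - 2 * jj i)) / W.lam i) - ψ (W.pl i)) / (1 / 2) ^ α,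
    ⟨?_, fun Y h0 h1 => ?_, fun Y Z => ?_⟩, fun y => ?_⟩
  · have := hψ.cont
    fun_prop
  · have e2 : W.pl i = (W.Y i (W.pl i) - (W.a - 2 * jj i)) / W.lam i := by rw [e]; field_simp; ring
    rw [abs_div, abs_of_pos hρ, div_le_one hρ]
    refine (hψ.hold _ _).trans ?_
    nth_rw 1 [e2]
    refine (e1 _ _).trans (mul_le_of_le_one_right hρ.le ?_)
    refine Real.rpow_le_one (abs_nonneg _) ?_ hα.le
    obtain ⟨h2, h3⟩ := Seg.Y_bounds hW hi le_rfl hi.le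
    exact abs_le.2 ⟨by linarith, by linarith⟩
  · rw [← sub_div, abs_div, abs_of_pos hρ, div_le_iff₀ hρ, sub_sub_sub_cancel_right]
    refine (hψ.hold _ _).trans ((e1 _ _).trans (mul_comm _ _).le)
  · have : (W.Y i y - (W.a - 2 * jj i)) / W.lam i = y := by rw [e]; field_simp; ring
    simp only [this]
    field_simp
    ring

lemma Test.abs_integral_le {ψ : ℝ → ℝ} (hψ : Test α ψ) {a b : ℝ} (ha : 0 ≤ a) (hab : a ≤ b)
    (hb : b ≤ 1) {u : ℝ → ℝ} {B : ℝ} (hu : ∀ y, |u y| ≤ B) :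
    |∫ y in a..b, ψ y * u y| ≤ B * (b - a) := by
  have := intervalIntegral.norm_integral_le_of_norm_le_const (a := a) (b := b)
    (f := fun y => ψ y * u y) (C := B) (fun x hx => by
      rw [Set.uIoc_of_le hab] at hx
      rw [Real.norm_eq_abs, abs_mul]
      have h1 := hψ.le x (by linarith [hx.1]) (by linarith [hx.2])
      have h2 := hu x
      calc |ψ x| * |u x| ≤ 1 * B := by gcongr
        _ = B := one_mul B)
  rwa [abs_of_nonneg (sub_nonneg.2 hab)] at this

lemma Dyn.test_piece (hf : Dyn f M c α) (hα : 0 < α) {ψ : ℝ → ℝ} (hψ : Test α ψ) {W : Seg}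
    (hW : W.Valid) {i : Br} (hi : W.Act i) {m : ℕ} (hm : tau i ≤ m) {r r' B1 B2 B3 : ℝ}
    (h1 : |A f (m - tau i) (W.child i) - r| ≤ B1) (h2 : |r' - r| ≤ B2)
    (h3 : ∀ η, Test α η → |∫ y in (W.child i).lo..(W.child i).hi,
      η y * (f (m - tau i) ((W.child i).h y) y - r')| ≤ B3 * (W.child i).len) :
    |∫ y in W.pl i..W.ph i, ψ y * (f m (W.h y) y - r)| ≤
      W.plen i * (B1 + (1 / 2) ^ α * (B3 + B2)) := by
  obtain ⟨η, hη, hψη⟩ := hψ.child hα hW hi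
  have hl := Seg.lam_pos hW (Seg.Act.one_le i hi).1
  have hX := Seg.child_valid hW hi
  have hp := hi.plen_pos
  set ρ : ℝ := (1 / 2) ^ α
  have hρ : 0 < ρ := by positivity
  set X := W.child i
  have hXl : X.len = W.lam i * W.plen i := Seg.child_len i
  set v := ψ (W.pl i)
  have hv : |v| ≤ 1 := by
    obtain ⟨q1, q2⟩ := Seg.pl_mem hW i
    exact hψ.le _ (hW.lo0.trans q1) (q2.trans hW.hi1)
  have hYc : Continuous fun y => η (W.Y i y) := by
    have := hη.cont
    unfold Seg.Y Seg.h
    fun_prop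
  have e1 : ∫ y in W.pl i..W.ph i, ψ y * (f m (W.h y) y - r) =
      v * ((∫ y in W.pl i..W.ph i, f m (W.h y) y) - r * W.plen i) +
      ρ * ((∫ y in W.pl i..W.ph i, η (W.Y i y) * f m (W.h y) y) -
        r * ∫ y in W.pl i..W.ph i, η (W.Y i y)) := by
    have i1 := hf.integrable m W (W.pl i) (W.ph i)
    have i2 := hf.integrable_mul hYc m W (W.pl i) (W.ph i)
    have i3 := hYc.intervalIntegrable (μ := volume) (W.pl i) (W.ph i)
    have : ∀ y, ψ y * (f m (W.h y) y - r) = v * (f m (W.h y) y - r) +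
        ρ * (η (W.Y i y) * f m (W.h y) y - r * η (W.Y i y)) := fun y => by
      rw [hψη y]; ring
    simp only [this]
    rw [intervalIntegral.integral_add
        ((i1.sub intervalIntegrable_const).const_mul v) ((i2.sub (i3.const_mul r)).const_mul ρ),
      intervalIntegral.integral_const_mul, intervalIntegral.integral_const_mul,
      intervalIntegral.integral_sub i1 intervalIntegrable_const,
      intervalIntegral.integral_sub i2 (i3.const_mul r), intervalIntegral.integral_const_mul,
      intervalIntegral.integral_const, smul_eq_mul, mul_comm r (W.plen i)]
    rfl
  have e2 := hf.integral_piece_one hW hi hm le_rfl hi.le le_rfl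
  have e3 := hf.integral_piece hW hi hm le_rfl hi.le le_rfl η
  have e4 := (dyn_one α).integral_piece hW hi hm le_rfl hi.le le_rfl η
  simp only [mul_one] at e4
  have e5 : ∫ y in X.lo..X.hi, f (m - tau i) (X.h y) y = A f (m - tau i) X * X.len := by
    unfold A
    have := Seg.len_pos hX
    field_simp
  have e6 : ∫ y in X.lo..X.hi, η y * (f (m - tau i) (X.h y) y - r') =
      (∫ y in X.lo..X.hi, η y * f (m - tau i) (X.h y) y) - r' * ∫ y in X.lo..X.hi, η y := by
    simp only [mul_sub]
    rw [intervalIntegral.integral_sub (hf.integrable_mul hη.cont _ _ _ _)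
      ((by have := hη.cont
           fun_prop : Continuous fun y => η y * r').intervalIntegrable _ _),
      intervalIntegral.integral_mul_const, mul_comm r']
  change _ = (1 / W.lam i) * ∫ y in X.lo..X.hi, f (m - tau i) (X.h y) y at e2
  change _ = (1 / W.lam i) * ∫ y in X.lo..X.hi, η y * f (m - tau i) (X.h y) y at e3
  change _ = (1 / W.lam i) * ∫ y in X.lo..X.hi, η y at e4
  have e7 := h3 η hη
  have e8 : |∫ y in X.lo..X.hi, η y| ≤ X.len := by
    have := hη.abs_integral_le hX.lo0 hX.lt.le hX.hi1 (u := fun _ => 1) (B := 1) (by simp)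
    simpa [Seg.len] using this
  rw [e1, e2, e3, e4, e5]
  set I1 := ∫ y in X.lo..X.hi, η y * f (m - tau i) (X.h y) y
  set I0 := ∫ y in X.lo..X.hi, η y
  rw [e6] at e7
  have e9 : v * (1 / W.lam i * (A f (m - tau i) X * X.len) - r * W.plen i) +
      ρ * (1 / W.lam i * I1 - r * (1 / W.lam i * I0)) =
      W.plen i * (v * (A f (m - tau i) X - r)) +
      ρ / W.lam i * ((I1 - r' * I0) + (r' - r) * I0) := by
    rw [hXl]; field_simp; ring
  rw [e9]
  refine (abs_add_le _ _).trans ?_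
  rw [abs_mul, abs_mul (ρ / _), abs_of_pos hp, abs_of_pos (div_pos hρ hl), abs_mul v]
  have t1 : |v| * |A f (m - tau i) X - r| ≤ 1 * B1 := by gcongr
  have t2 : |(I1 - r' * I0) + (r' - r) * I0| ≤ B3 * X.len + B2 * X.len := by
    refine (abs_add_le _ _).trans (add_le_add e7 ?_)
    rw [abs_mul]
    gcongr
    exact (abs_nonneg _).trans h2
  calc W.plen i * (|v| * |A f (m - tau i) X - r|) +
        ρ / W.lam i * |(I1 - r' * I0) + (r' - r) * I0|
      ≤ W.plen i * (1 * B1) + ρ / W.lam i * (B3 * X.len + B2 * X.len) := by gcongr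
    _ = _ := by rw [hXl]; field_simp

end LTM

namespace LTM

variable {f : ℕ → ℝ → ℝ → ℝ} {M c α : ℝ} {g : ℕ → ℝ} {ζ CD K : ℝ}

/-- The bookkeeping behind `Dyn.test`. -/
lemma test_arith {V ρ u L K5 K6 : ℝ} (hV : 1 ≤ V) (hρ0 : 0 < ρ) (hρ1 : ρ < 1) (hu : 0 ≤ u)
    (hCD1 : 1 ≤ CD) (hK : 1 ≤ K) (hu1 : u * (1 + K5) ≤ 1 / 100)
    (hu2 : u * (2 + K + CD) ≤ 1 / 400) (hK5 : K5 * (1 - ρ) = 2 + CD)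
    (h1 : 4 + 3 * CD ≤ K6 * (1 - ρ)) (h2 : CD + 9 + 2 * K + 2 * CD * L ≤ K6) :
    (1 + ρ * K6) * (99 / 100 * V + CD + u * V) + (9 + 2 * K + ρ * (K6 * K5)) * (1 + u * V) +
      2 * CD * (L + V + u * V) + u * V ≤ K6 * (V + K5) := by
  have hK6 : 0 < K6 := by nlinarith
  have hK50 : 0 < K5 := by
    by_contra! h
    nlinarith
  have a1 : ρ * K6 * (u * (1 + K5)) * V ≤ ρ * K6 * (1 / 100) * V := by gcongr
  have a2 : u * (2 + K + CD) * V ≤ 1 / 400 * V := by gcongr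
  have a3 : (4 + 3 * CD) * V ≤ K6 * (1 - ρ) * V := by gcongr
  have a4 : ρ * (K6 * CD) ≤ 1 * (K6 * CD) := by gcongr
  have a5 : K6 * (K5 * (1 - ρ)) = K6 * (2 + CD) := by rw [hK5]
  have a6 : 0 ≤ u * V := by positivity
  have a7 : 0 ≤ u * V * K := by positivity
  have a8 : 0 ≤ u * V * CD := by positivity
  have a9 : 0 ≤ CD * V := by positivity
  nlinarith

lemma Dyn.test (hf : Dyn f M c α) (hα : 0 < α) (hg : Slow g ζ (2 * M)) (hCD1 : 1 ≤ CD)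
    (hCD : Drift CD) (hK : 1 ≤ K) (hζ0 : 0 < ζ) (hζ : ζ * (84 * (2 + K + CD)) ≤ 1 / 400)
    (hfar : ∀ N, FarLt f g CD K N) {L K5 K6 : ℝ} (hL : 0 ≤ L)
    (hLs : ∀ W : Seg, W.Valid → ∀ s ⊆ W.pcs, ∑ i ∈ s, W.w i * tau i ≤ L + 1 * W.V)
    (hK5 : K5 * (1 - (1 / 2) ^ α) = 2 + CD) (hu1 : 84 * ζ * (1 + K5) ≤ 1 / 100)
    (h1 : 4 + 3 * CD ≤ K6 * (1 - (1 / 2) ^ α)) (h2 : CD + 9 + 2 * K + 2 * CD * L ≤ K6)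
    (m : ℕ) : ∀ W : Seg, W.Valid → ∀ ψ, Test α ψ →
      |∫ y in W.lo..W.hi, ψ y * (f m (W.h y) y - A f m Seg.ref)| ≤ K6 * (W.V + K5) * g m * W.len := by
  induction m using Nat.strong_induction_on with
  | _ m IH =>
  intro W hW ψ hψ
  set ρ : ℝ := (1 / 2) ^ α
  have hρ0 : 0 < ρ := by positivity
  have hρ1 : ρ < 1 := Real.rpow_lt_one (by norm_num) (by norm_num) hα
  set r := A f m Seg.ref
  have hr : |r| ≤ M := hf.A_le m Seg.ref_valid
  have hV := Seg.one_le_V hW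
  have hgm := hg.pos m
  have hl := Seg.len_pos hW
  have hrV := Seg.ref_V
  have hint : ∀ a b, IntervalIntegrable (fun y => ψ y * (f m (W.h y) y - r)) volume a b := by
    intro a b
    simp only [mul_sub]
    exact (hf.integrable_mul hψ.cont _ _ _ _).sub
      ((by have := hψ.cont
           fun_prop : Continuous fun y => ψ y * r).intervalIntegrable _ _)
  rw [integral_eq_sum hint hW, ← Seg.sum_res_add W m]
  have b1 : ∀ i ∈ W.res m, |∫ y in W.pl i..W.ph i, ψ y * (f m (W.h y) y - r)| ≤
      W.len * ((1 + ρ * K6) * (W.w i * ((W.child i).V * g (m - tau i))) +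
      (9 + 2 * K + ρ * (K6 * K5)) * (W.w i * g (m - tau i)) +
      2 * CD * (W.w i * tau i * g (m - tau i))) := by
    intro i hi
    obtain ⟨hi, hm⟩ := (Seg.mem_res hW).1 hi
    have hX := Seg.child_valid hW hi
    have ht := one_le_tau (Seg.Act.one_le i hi).1
    have q1 := hfar (2 * m) (W.child i) Seg.ref hX Seg.ref_valid (m - tau i) m (by omega)
    have q2 := hfar (2 * m) Seg.ref Seg.ref Seg.ref_valid Seg.ref_valid (m - tau i) m (by omega)
    unfold FarAt at q1 q2
    rw [min_eq_left (Nat.sub_le _ _), Nat.cast_sub hm, sub_sub_cancel_left, abs_neg,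
      Nat.abs_cast] at q1 q2
    have q3 := hg.anti (Nat.sub_le m (tau i))
    have q4 := hg.pos (m - tau i)
    have q5 : Seg.ref.V * g m ≤ 3 * g (m - tau i) := by gcongr
    have q6 : Seg.ref.V * g (m - tau i) ≤ 3 * g (m - tau i) := by gcongr
    have q7 := hf.test_piece hα hψ hW hi hm q1 q2 (B3 := K6 * ((W.child i).V + K5) * g (m - tau i))
      (fun η hη => IH (m - tau i) (by omega) _ hX η hη)
    refine q7.trans ?_
    have q8 : W.plen i = W.len * W.w i := by unfold Seg.w; field_simp
    rw [q8, mul_assoc]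
    refine mul_le_mul_of_nonneg_left ?_ hl.le
    have q9 : (W.child i).V * g (m - tau i) + Seg.ref.V * g m + (K + CD * tau i) * g (m - tau i) +
        ρ * (K6 * ((W.child i).V + K5) * g (m - tau i) +
        (Seg.ref.V * g (m - tau i) + Seg.ref.V * g m + (K + CD * tau i) * g (m - tau i))) ≤
        (1 + ρ * K6) * ((W.child i).V * g (m - tau i)) +
        (9 + 2 * K + ρ * (K6 * K5)) * g (m - tau i) + 2 * CD * (tau i * g (m - tau i)) := by
      have : ρ * (Seg.ref.V * g (m - tau i) + Seg.ref.V * g m + (K + CD * tau i) * g (m - tau i)) ≤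
          1 * (3 * g (m - tau i) + 3 * g (m - tau i) + (K + CD * tau i) * g (m - tau i)) := by
        have : 0 ≤ Seg.ref.V := by linarith [Seg.one_le_V Seg.ref_valid]
        refine mul_le_mul hρ1.le (by linarith) (by positivity) zero_le_one
      linarith
    have := mul_le_mul_of_nonneg_left q9 (Seg.w_nonneg hW i)
    linarith
  have b2 : ∀ i ∈ W.unr m, |∫ y in W.pl i..W.ph i, ψ y * (f m (W.h y) y - r)| ≤
      W.len * (2 * M * W.w i) := by
    intro i hi
    obtain ⟨hi, hm⟩ := (Seg.mem_unr hW).1 hi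
    obtain ⟨p1, -⟩ := Seg.pl_mem hW i
    obtain ⟨-, p2⟩ := Seg.ph_mem hW i
    have p3 := hψ.abs_integral_le (hW.lo0.trans p1) hi.le (p2.trans hW.hi1)
      (u := fun y => f m (W.h y) y - r) (B := 2 * M) (fun y => by
        have := abs_sub (f m (W.h y) y) r
        linarith [hf.bdd m (W.h y) y])
    have p4 : W.ph i - W.pl i = W.len * W.w i := by unfold Seg.w Seg.plen; field_simp
    rw [p4] at p3
    linarith
  refine (abs_add_le _ _).trans ((add_le_add
    ((Finset.abs_sum_le_sum_abs _ _).trans (Finset.sum_le_sum b1))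
    ((Finset.abs_sum_le_sum_abs _ _).trans (Finset.sum_le_sum b2))).trans ?_)
  rw [← Finset.mul_sum, ← Finset.mul_sum, ← mul_add, mul_comm _ W.len, ← Finset.mul_sum,
    Finset.sum_add_distrib, Finset.sum_add_distrib, ← Finset.mul_sum, ← Finset.mul_sum,
    ← Finset.mul_sum]
  refine mul_le_mul_of_nonneg_left ?_ hl.le
  have s1 := hg.sum_V hCD1 hCD hW m
  have s2 := hg.sum_star hW (subset_refl (W.res m)) W.w (fun i hi => ⟨Seg.w_nonneg hW i,
    Seg.w_le'' hW ((Seg.mem_res hW).1 hi).1⟩)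
  have s3 := hg.sum_star hW (subset_refl (W.res m)) (fun i => W.w i * tau i) (fun i hi =>
    ⟨mul_nonneg (Seg.w_nonneg hW i) (by positivity),
      Seg.w_mul_tau_le hW ((Seg.mem_res hW).1 hi).1⟩)
  have s4 := hg.sum_unr hW m
  have s5 := sum_w_res_le hW m
  have s6 := hLs W hW _ (W.res_subset m)
  have hK6 : 0 < K6 := by nlinarith
  have hK50 : 0 < K5 := by
    by_contra! h
    nlinarith
  have t2 : ∑ i ∈ W.res m, W.w i * g (m - tau i) ≤ (1 + 84 * ζ * W.V) * g m := by
    nlinarith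
  have t3 : ∑ i ∈ W.res m, W.w i * tau i * g (m - tau i) ≤
      (L + W.V + 84 * ζ * W.V) * g m := by nlinarith
  have ar := test_arith hV hρ0 hρ1 (u := 84 * ζ) (by positivity) hCD1 hK hu1 (by linarith) hK5
    h1 h2
  calc _ ≤ (1 + ρ * K6) * ((99/100 * W.V + CD + ζ * (84 * W.V)) * g m) +
        (9 + 2 * K + ρ * (K6 * K5)) * ((1 + 84 * ζ * W.V) * g m) +
        2 * CD * ((L + W.V + 84 * ζ * W.V) * g m) + ζ * (84 * W.V) * g m := by gcongr
    _ = ((1 + ρ * K6) * (99 / 100 * W.V + CD + 84 * ζ * W.V) +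
        (9 + 2 * K + ρ * (K6 * K5)) * (1 + 84 * ζ * W.V) +
        2 * CD * (L + W.V + 84 * ζ * W.V) + 84 * ζ * W.V) * g m := by ring
    _ ≤ _ := by gcongr

/-- Decay of correlations along segments. -/
lemma exists_decay (hf : Dyn f M c α) (hM : 1 ≤ M) (hc : 0 ≤ c) (hα : 0 < α) :
    ∃ (g : ℕ → ℝ) (C : ℝ), 0 < C ∧ Antitone g ∧ (∀ m, 0 < g m) ∧
      (∀ m : ℕ, g m ≤ C * ((m:ℝ) + 1) ^ (-(6/5) : ℝ)) ∧
      (∀ m, ∀ W : Seg, W.Valid → ∀ ψ, Test α ψ →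
      |∫ y in W.lo..W.hi, ψ y * (f m (W.h y) y - A f m Seg.ref)| ≤ W.chi * g m) ∧
      ∀ m m' : ℕ, m ≤ m' →
      |A f m Seg.ref - A f m' Seg.ref| ≤ (1 + ((m':ℝ) - m)) * g m := by
  obtain ⟨CD, hCD1, hCD⟩ := Seg.exists_drift
  replace hCD : Drift CD := hCD
  have hρ1 : ((1:ℝ) / 2) ^ α < 1 := Real.rpow_lt_one (by norm_num) (by norm_num) hα
  have hρ2 : 0 < 1 - ((1:ℝ) / 2) ^ α := by linarith
  obtain ⟨L, hL, hLs⟩ := exists_sum_tau one_pos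
  set K5 := (2 + CD) / (1 - ((1:ℝ) / 2) ^ α)
  have hK50 : 0 < K5 := div_pos (by linarith) hρ2
  obtain ⟨K, ζ, g, Kg, hK, hζ0, hζZ, hζ, hg, hKg, hgK, hfar⟩ := exists_far hf hM hc hα hCD1 hCD
    (Z := 8400 * (1 + K5)) (by positivity)
  set K6 := (4 + 3 * CD) / (1 - ((1:ℝ) / 2) ^ α) + (CD + 9 + 2 * K + 2 * CD * L)
  have hK61 : 0 < (4 + 3 * CD) / (1 - ((1:ℝ) / 2) ^ α) := div_pos (by linarith) hρ2
  have hK60 : 0 < K6 := by positivity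
  have key := hf.test hα hg hCD1 hCD hK hζ0 hζ hfar hL hLs (K5 := K5) (K6 := K6)
    (div_mul_cancel₀ _ hρ2.ne') (by linarith)
    (by
      have h1 : (4 + 3 * CD) / (1 - ((1:ℝ) / 2) ^ α) * (1 - (1 / 2) ^ α) = 4 + 3 * CD :=
        div_mul_cancel₀ _ hρ2.ne'
      have h2 : 0 ≤ (CD + 9 + 2 * K + 2 * CD * L) * (1 - ((1:ℝ) / 2) ^ α) := by positivity
      simp only [K6, add_mul _ _ (1 - ((1:ℝ) / 2) ^ α)]
      linarith)
    (by simp only [K6]; linarith)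
  set K7 := 6 + K + CD
  set B := K6 * (1 + K5) + K7
  have hB1 : K6 * (1 + K5) ≤ B := by simp only [B, K7]; linarith
  have hB2 : K7 ≤ B := by
    have : 0 < K6 * (1 + K5) := by positivity
    simp only [B]; linarith
  have hB : 0 < B := by positivity
  refine ⟨fun m => B * g m, B * Kg, by positivity,
    fun a b hab => ?_, fun m => mul_pos hB (hg.pos m), fun m => ?_, fun m W hW ψ hψ =>
    (key m W hW ψ hψ).trans ?_, fun m m' hm => ?_⟩
  · exact mul_le_mul_of_nonneg_left (hg.anti hab) hB.le
  · rw [mul_assoc _ Kg]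
    exact mul_le_mul_of_nonneg_left (hgK m) hB.le
  · have hV := Seg.one_le_V hW
    have hl := Seg.len_pos hW
    have hgm := hg.pos m
    have hchi : 0 ≤ W.chi := by unfold Seg.chi; positivity
    have h1 : W.V * W.len ≤ W.chi := by
      have h2 : W.V ≤ W.D := by
        unfold Seg.V
        exact (Real.rpow_le_rpow_of_exponent_le (Seg.one_le_D hW) (by norm_num)).trans
          (Real.rpow_one _).le
      rw [← le_div_iff₀ hl]
      exact h2
    calc K6 * (W.V + K5) * g m * W.len ≤ K6 * (W.V + K5 * W.V) * g m * W.len := by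
          gcongr
          exact le_mul_of_one_le_right hK50.le hV
      _ = W.V * W.len * (K6 * (1 + K5) * g m) := by ring
      _ ≤ W.chi * (B * g m) := by gcongr
  · have q := hfar (m + m' + 1) Seg.ref Seg.ref Seg.ref_valid Seg.ref_valid m m' (by omega)
    unfold FarAt at q
    have hm' : (m:ℝ) ≤ m' := by exact_mod_cast hm
    rw [min_eq_left hm, abs_of_nonpos (a := (m:ℝ) - m') (by linarith), neg_sub] at q
    have hgm := hg.pos m
    have q1 : Seg.ref.V * g m ≤ 3 * g m := mul_le_mul_of_nonneg_right Seg.ref_V hgm.le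
    have q2 : Seg.ref.V * g m' ≤ 3 * g m :=
      mul_le_mul Seg.ref_V (hg.anti hm) (hg.pos _).le (by norm_num)
    calc _ ≤ (6 + K + CD * ((m':ℝ) - m)) * g m := by linarith
      _ ≤ (K7 * (1 + ((m':ℝ) - m))) * g m := by
          refine mul_le_mul_of_nonneg_right ?_ hgm.le
          have : 0 ≤ ((m':ℝ) - m) * (6 + K) := mul_nonneg (by linarith) (by linarith)
          simp only [K7]
          linarith
      _ ≤ (B * (1 + ((m':ℝ) - m))) * g m := by
          refine mul_le_mul_of_nonneg_right (mul_le_mul_of_nonneg_right hB2 (by linarith)) hgm.le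
      _ = _ := by ring

end LTM

namespace LTM

/-- A square root of the linked-twist map. -/
def Vm (z : 𝕋) : 𝕋 := ((F z).2, (F z).1)

lemma theta_coe {y : ℝ} (h0 : 0 ≤ y) (h2 : y < 2) : θ (y : AddCircle (2:ℝ)) = y := by
  unfold θ
  rw [AddCircle.equivIco_coe_of_mem (p := 2) (a := 0) (by constructor <;> linarith)]

lemma Vm_of_le (x : AddCircle (2:ℝ)) {y : ℝ} (h0 : 0 ≤ y) (h1 : y ≤ 1) :
    Vm (x, (y : AddCircle (2:ℝ))) = ((y : AddCircle (2:ℝ)), x + ((2 * y : ℝ) : AddCircle (2:ℝ))) := by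
  have := theta_coe h0 (by linarith)
  simp [Vm, F, this, h1]

lemma Vm_of_lt (x : AddCircle (2:ℝ)) {y : ℝ} (h1 : 1 < y) (h2 : y < 2) :
    Vm (x, (y : AddCircle (2:ℝ))) = ((y : AddCircle (2:ℝ)), x) := by
  have := theta_coe (by linarith) h2
  simp [Vm, F, this, not_le.2 h1]

lemma coe_sub_two_mul (y : ℝ) (r : ℕ) :
    ((y - 2 * r : ℝ) : AddCircle (2:ℝ)) = (y : AddCircle (2:ℝ)) := by
  have : ((2 * r : ℝ) : AddCircle (2:ℝ)) = 0 :=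
    (AddCircle.coe_eq_zero_iff 2).2 ⟨r, by simp [mul_comm]⟩
  rw [AddCircle.coe_sub, this, sub_zero]

lemma Vm_Vm : Vm ∘ Vm = H := by
  funext z
  simp only [Vm, H, G, F, Function.comp]
  split_ifs <;> rfl

lemma H_iterate (n : ℕ) : H^[n] = Vm^[2 * n] := by
  rw [Function.iterate_mul, ← Vm_Vm]
  rfl

lemma measurable_theta : Measurable θ :=
  measurable_subtype_coe.comp (AddCircle.measurableEquivIco 2 0).measurable

lemma measurable_Vm : Measurable Vm := by
  have h1 : Measurable F := by
    unfold F
    refine Measurable.ite ?_ ?_ measurable_id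
    · exact measurableSet_le (measurable_theta.comp measurable_snd) measurable_const
    · have h2 : Measurable fun x : ℝ => (x : AddCircle (2:ℝ)) := AddCircle.measurable_mk'
      have h3 := measurable_theta
      fun_prop
  exact h1.snd.prodMk h1.fst

/-- The horizontal coordinate leaves the square, modulo `2`, at the times `1, …, k - 1`. -/
def Escapes (k : ℕ) (x y : ℝ) : Prop :=
  ∀ l, 1 ≤ l → l < k → ∃ r : ℕ, 1 < x + 2 * l * y - 2 * r ∧ x + 2 * l * y - 2 * r < 2

lemma iterate_even {k : ℕ} {x y : ℝ} (h0 : 0 ≤ y) (h1 : y ≤ 1) (hk : Escapes k x y) {j : ℕ}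
    (hj : j < k) : Vm^[2 * j] ((x : AddCircle (2:ℝ)), (y : AddCircle (2:ℝ))) =
      (((x + 2 * j * y : ℝ) : AddCircle (2:ℝ)), (y : AddCircle (2:ℝ))) := by
  induction j with
  | zero => simp
  | succ j ih =>
    rw [show 2 * (j + 1) = 2 * j + 1 + 1 by ring, Function.iterate_succ_apply',
      Function.iterate_succ_apply', ih (by omega), Vm_of_le _ h0 h1, ← AddCircle.coe_add]
    obtain ⟨r, hr1, hr2⟩ := hk (j + 1) (by omega) hj
    have e : x + 2 * j * y + 2 * y = x + 2 * ((j + 1 : ℕ) : ℝ) * y := by push_cast; ring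
    rw [e, ← coe_sub_two_mul (x + _) r, Vm_of_lt _ hr1 hr2]

lemma iterate_odd {k : ℕ} {x y : ℝ} (h0 : 0 ≤ y) (h1 : y ≤ 1) (hk : Escapes k x y) {j : ℕ}
    (hj : j < k) : Vm^[2 * j + 1] ((x : AddCircle (2:ℝ)), (y : AddCircle (2:ℝ))) =
      ((y : AddCircle (2:ℝ)), ((x + 2 * (j + 1) * y : ℝ) : AddCircle (2:ℝ))) := by
  rw [Function.iterate_succ_apply', iterate_even h0 h1 hk hj, Vm_of_le _ h0 h1,
    ← AddCircle.coe_add]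
  congr 2
  ring

lemma Seg.escapes {W : Seg} (hW : W.Valid) : ∀ {i : Br} {y : ℝ}, W.pl i < y → y < W.ph i →
    Escapes i.2 (W.h y) y := by
  intro i y hp hq l hl hlk
  have hi : W.Act i := hp.trans hq
  have h1 := Seg.inPiece_of_act hW hi le_rfl hi.le
  have h2 := Seg.inPiece_of_act hW hi hi.le le_rfl
  obtain ⟨p1, p2⟩ := Seg.pl_mem hW i
  obtain ⟨q1, q2⟩ := Seg.ph_mem hW i
  have hp0 : 0 ≤ W.pl i := hW.lo0.trans p1
  have hq1 : W.ph i ≤ 1 := q2.trans hW.hi1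
  have hl1 : (1:ℝ) ≤ l := by exact_mod_cast hl
  have m1 : W.h (W.pl i) + 2 * l * W.pl i < W.h y + 2 * l * y := by
    have := Seg.h_mono hW hp.le
    have : (l:ℝ) * W.pl i < l * y := by gcongr
    linarith
  have m2 : W.h y + 2 * l * y < W.h (W.ph i) + 2 * l * W.ph i := by
    have := Seg.h_mono hW hq.le
    have : (l:ℝ) * y < l * W.ph i := by gcongr
    linarith
  generalize W.pl i = p at *
  generalize W.ph i = q at *
  have hq0 : 0 ≤ q := by linarith
  have hp1 : p ≤ 1 := by linarith
  match i, h1, h2, hlk with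
  | (b, 0), _, _, hlk => exact absurd hlk (by simp)
  | (b, 1), _, _, hlk =>
    have : l < 1 := hlk
    omega
  | (false, 2), h1, h2, hlk =>
    have : l < 2 := hlk
    obtain rfl : l = 1 := by omega
    simp only [InPiece] at h1 h2
    refine ⟨0, ?_, ?_⟩ <;> push_cast at * <;> linarith [h1.1, h2.2.1]
  | (false, k + 3), h1, h2, hlk =>
    have : l < k + 3 := hlk
    have hk : (l:ℝ) ≤ k + 2 := by exact_mod_cast (by omega : l ≤ k + 2)
    simp only [InPiece] at h1 h2
    have e1 : 0 ≤ ((l:ℝ) - 1) * p := mul_nonneg (by linarith) hp0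
    have e2 : 0 ≤ ((k:ℝ) + 2 - l) * q := mul_nonneg (by linarith) hq0
    refine ⟨0, ?_, ?_⟩ <;> push_cast <;> linarith [h1.1, h2.2.1]
  | (true, 2), h1, _, _ => exact absurd h1 (by simp [InPiece])
  | (true, k + 3), h1, h2, hlk =>
    have : l < k + 3 := hlk
    have hk : (l:ℝ) ≤ k + 2 := by exact_mod_cast (by omega : l ≤ k + 2)
    simp only [InPiece] at h1 h2
    have e1 : 0 ≤ ((l:ℝ) - 1) * (1 - q) := mul_nonneg (by linarith) (by linarith)
    have e2 : 0 ≤ ((k:ℝ) + 2 - l) * (1 - p) := mul_nonneg (by linarith) (by linarith)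
    refine ⟨l - 1, ?_, ?_⟩ <;> rw [Nat.cast_sub hl] <;> push_cast <;> linarith [h1.2.1, h2.1]

/-- An observable along the orbits of `Vm`, in coordinates. -/
def obs (φ : 𝕋 → ℝ) (m : ℕ) (x y : ℝ) : ℝ :=
  φ (Vm^[m] ((x : AddCircle (2:ℝ)), (y : AddCircle (2:ℝ))))

lemma obs_even (φ : 𝕋 → ℝ) {k : ℕ} {x y : ℝ} (h0 : 0 ≤ y) (h1 : y ≤ 1) (hk : Escapes k x y)
    {j : ℕ} (hj : j < k) : obs φ (2 * j) x y = obs φ 0 (x + 2 * j * y) y := by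
  rw [obs, iterate_even h0 h1 hk hj]; rfl

lemma obs_odd (φ : 𝕋 → ℝ) {k : ℕ} {x y : ℝ} (h0 : 0 ≤ y) (h1 : y ≤ 1) (hk : Escapes k x y)
    {j : ℕ} (hj : j < k) (m : ℕ) (hm : 2 * j + 1 ≤ m) (r : ℕ) :
    obs φ m x y = obs φ (m - (2 * j + 1)) y (x + 2 * (j + 1) * y - 2 * r) := by
  rw [obs, obs, coe_sub_two_mul, ← iterate_odd h0 h1 hk hj, ← Function.iterate_add_apply,
    Nat.sub_add_cancel hm]

lemma dist_coe_le (x y : ℝ) : dist (x : AddCircle (2:ℝ)) (y : AddCircle (2:ℝ)) ≤ |x - y| := by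
  rw [dist_eq_norm, ← AddCircle.coe_sub]
  exact QuotientAddGroup.norm_mk_le_norm

variable {α Cφ : ℝ≥0} {φ : 𝕋 → ℝ}

lemma abs_obs_zero_sub_le (hφ : HolderWith Cφ α φ) (x x' y y' : ℝ) :
    |obs φ 0 x y - obs φ 0 x' y'| ≤ Cφ * (max |x - x'| |y - y'|) ^ (α:ℝ) := by
  rw [← Real.dist_eq]
  refine hφ.dist_le_of_le ?_
  rw [Prod.dist_eq]
  exact max_le_max (dist_coe_le _ _) (dist_coe_le _ _)

lemma measurable_obs (hφ : Continuous φ) (m : ℕ) :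
    Measurable fun p : ℝ × ℝ => obs φ m p.1 p.2 := by
  have h2 : Measurable fun x : ℝ => (x : AddCircle (2:ℝ)) := AddCircle.measurable_mk'
  have h3 : Measurable fun p : ℝ × ℝ => ((p.1 : AddCircle (2:ℝ)), (p.2 : AddCircle (2:ℝ))) := by
    fun_prop
  exact hφ.measurable.comp ((measurable_Vm.iterate m).comp h3)

lemma dyn_obs (hα : 0 < α) (hφ : HolderWith Cφ α φ) {M : ℝ} (hM : ∀ z, |φ z| ≤ M) :
    Dyn (obs φ) M Cφ α where
  bdd := fun _ _ _ => hM _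
  meas := measurable_obs (hφ.continuous hα)
  step := by
    intro W hW i m y hp hq hm
    have hk := (Seg.Act.one_le i (hp.trans hq)).1
    have e := Seg.escapes hW hp hq
    have y0 : 0 ≤ y := (hW.lo0.trans (Seg.pl_mem hW i).1).trans hp.le
    have y1 : y ≤ 1 := hq.le.trans ((Seg.ph_mem hW i).2.trans hW.hi1)
    have ht : tau i = 2 * (i.2 - 1) + 1 := by unfold tau; omega
    rw [ht] at hm ⊢
    rw [obs_odd φ y0 y1 e (j := i.2 - 1) (by omega) m hm (jj i), Nat.cast_sub hk]
    congr 1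
    simp only [Seg.Y]
    push_cast
    ring
  unres := by
    intro W W' hW hW' i m y hp hq hp' hq' hm
    have e := Seg.escapes hW hp hq
    have e' := Seg.escapes hW' hp' hq'
    have y0 : 0 ≤ y := (hW.lo0.trans (Seg.pl_mem hW i).1).trans hp.le
    have y1 : y ≤ 1 := hq.le.trans ((Seg.ph_mem hW i).2.trans hW.hi1)
    unfold tau at hm
    obtain ⟨j, rfl | rfl⟩ := m.even_or_odd'
    · rw [obs_even φ y0 y1 e (j := j) (by omega), obs_even φ y0 y1 e' (j := j) (by omega)]
      refine (abs_obs_zero_sub_le hφ _ _ _ _).trans (le_of_eq ?_)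
      rw [add_sub_add_right_eq_sub, sub_self, abs_zero, max_eq_left (abs_nonneg _)]
    · rw [obs_odd φ y0 y1 e (j := j) (by omega) _ le_rfl 0,
        obs_odd φ y0 y1 e' (j := j) (by omega) _ le_rfl 0, Nat.sub_self]
      refine (abs_obs_zero_sub_le hφ _ _ _ _).trans (le_of_eq ?_)
      rw [sub_sub_sub_cancel_right, add_sub_add_right_eq_sub, sub_self, abs_zero,
        max_eq_right (abs_nonneg _)]

end LTM

namespace LTM

/-- Rate of decay of correlations along segments. -/
structure Decay (f : ℕ → ℝ → ℝ → ℝ) (α C : ℝ) (g : ℕ → ℝ) : Prop where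
  pos : ∀ m, 0 < g m
  le : ∀ m : ℕ, g m ≤ C * ((m:ℝ) + 1) ^ (-(6/5) : ℝ)
  test : ∀ m, ∀ W : Seg, W.Valid → ∀ ψ, Test α ψ →
    |∫ y in W.lo..W.hi, ψ y * (f m (W.h y) y - A f m Seg.ref)| ≤ W.chi * g m
  drift : ∀ m m' : ℕ, m ≤ m' → |A f m Seg.ref - A f m' Seg.ref| ≤ (1 + ((m':ℝ) - m)) * g m

lemma Decay.exists_of_dyn {f : ℕ → ℝ → ℝ → ℝ} {M c α : ℝ} (hf : Dyn f M c α) (hM : 1 ≤ M)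
    (hc : 0 ≤ c) (hα : 0 < α) : ∃ C g, 0 < C ∧ Decay f α C g := by
  obtain ⟨g, C, hC, -, h2, h3, h4, h5⟩ := exists_decay hf hM hc hα
  exact ⟨C, g, hC, h2, h3, h4, h5⟩

lemma inv_sqrt_anti {a b : ℝ} (ha : 0 < a) (hab : a ≤ b) : 1 / √b ≤ 1 / √a :=
  one_div_le_one_div_of_le (Real.sqrt_pos.2 ha) (Real.sqrt_le_sqrt hab)

lemma Decay.square {f : ℕ → ℝ → ℝ → ℝ} {α C : ℝ} {g : ℕ → ℝ} (hd : Decay f α C g) {x : ℝ}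
    (hx0 : 0 < x) (hx1 : x < 1) (m : ℕ) {ψ : ℝ → ℝ} (hψ : Test α ψ) :
    |∫ y in (0:ℝ)..1, ψ y * (f m x y - A f m Seg.ref)| ≤
      (1 + 1 / √x + 1 / √(1 - x)) * g m := by
  have hh : ∀ y, (⟨x, 0, 0, 1⟩ : Seg).h y = x := by simp [Seg.h]
  have hW : (⟨x, 0, 0, 1⟩ : Seg).Valid := by
    constructor <;> simp only [Seg.L1, Seg.L2, hh] <;> norm_num <;> linarith
  have h1 := hd.test m _ hW ψ hψ
  simp only [hh] at h1
  refine h1.trans (mul_le_mul_of_nonneg_right ?_ (hd.pos m).le)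
  have p1 : 0 ≤ 1 / √x := by positivity
  have p2 : 0 ≤ 1 / √(1 - x) := by positivity
  have key : 1 / √((⟨x, 0, 0, 1⟩ : Seg).eps) ≤ 1 / √x + 1 / √(1 - x) := by
    simp only [Seg.eps, Seg.L1, Seg.L2, hh]
    rcases min_choice (2 * (1 - x) + 0) (2 * x + 1 - 1) with h | h <;> rw [h]
    · have := inv_sqrt_anti (a := 1 - x) (b := 2 * (1 - x) + 0) (by linarith) (by linarith)
      linarith
    · have := inv_sqrt_anti (a := x) (b := 2 * x + 1 - 1) (by linarith) (by linarith)
      linarith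
  have : 0 ≤ 1 / √((⟨x, 0, 0, 1⟩ : Seg).eps) := by positivity
  have e : (1 / 10) / √((⟨x, 0, 0, 1⟩ : Seg).eps) = (1/10) * (1 / √((⟨x, 0, 0, 1⟩ : Seg).eps)) := by
    ring
  unfold Seg.chi
  rw [e]
  linarith

variable {α Cφ : ℝ≥0} {φ : 𝕋 → ℝ} {C M : ℝ} {g : ℕ → ℝ}

lemma Decay.strip_piece (hd : Decay (obs φ) α C g) (hf : Dyn (obs φ) M Cφ α) {x v : ℝ} (hx1 : 1 < x) (hx2 : x < 2)
    {N k : ℕ} (hk : 1 ≤ k) (hN : 2 * k - 1 ≤ N) (hv1 : v ≤ 1 / 2)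
    (hv2 : 2 * ((k:ℝ) - 1) * v ≤ 2 - x) (hv3 : 2 - x < 2 * k * v) {ψ : ℝ → ℝ} (hψ : Test α ψ) :
    |∫ y in ((2 - x) / (2 * k))..v, ψ y * (obs φ N x y - A (obs φ) N Seg.ref)| ≤
      3 / k * g (N - (2 * k - 1)) := by
  have hk1 : (1:ℝ) ≤ k := by exact_mod_cast hk
  have hk0 : (0:ℝ) < k := by linarith
  have hv0 : 0 < v := by
    by_contra! h
    nlinarith
  have hu : (2 - x) / (2 * k) < v := by
    rw [div_lt_iff₀ (by positivity)]; linarith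
  have hu0 : 0 < (2 - x) / (2 * k) := div_pos (by linarith) (by positivity)
  set N' := N - (2 * k - 1)
  set Hi := 2 * k * v + (x - 2)
  have hH0 : 0 < Hi := by simp only [Hi]; linarith
  have hH2 : Hi ≤ 2 * v := by simp only [Hi]; linarith
  have hkH : k * Hi ≤ 2 := by
    rcases hk.eq_or_lt with rfl | h2
    · push_cast; linarith
    · have h2' : (2:ℝ) ≤ k := by exact_mod_cast h2
      have : k * Hi ≤ k * (2 * v) := by gcongr
      linarith
  set W : Seg := ⟨(2 - x) / (2 * k), 1 / (2 * k), 0, Hi⟩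
  have hh : ∀ Y, W.h Y = (Y + (2 - x)) / (2 * k) := fun Y => by
    simp only [W, Seg.h]; field_simp; ring
  have hhy : ∀ y, W.h (2 * k * y + (x - 2)) = y := fun y => by
    rw [hh]; field_simp; ring
  have hh0 : W.h 0 ≤ 1 / 2 := by
    rw [hh, div_le_iff₀ (by positivity)]; nlinarith
  have hL1 : 1 ≤ W.L1 := by
    have : W.L1 = 2 * (1 - W.h 0) + 0 := rfl
    linarith
  have hL2 : 1 ≤ W.L2 := by
    have : W.L2 = 2 * W.h Hi + 1 - Hi := rfl
    rw [this, hhy]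
    linarith
  have hs : 1 / (2 * (k:ℝ)) ≤ 1 / 2 := by gcongr; linarith
  have hW : W.Valid := by
    refine ⟨by positivity, hs, hH0, le_rfl, ?_, ?_, ?_, by linarith, by linarith⟩
    · change Hi ≤ 1
      linarith
    · change 0 ≤ W.h 0
      rw [hh]
      exact div_nonneg (by linarith) (by positivity)
    · change W.h Hi ≤ 1
      rw [hhy]
      linarith
  have hchi : W.chi ≤ 11 / 10 := by
    have h1 : 1 ≤ √W.eps := Real.one_le_sqrt.2 (le_min hL1 hL2)
    have : (1 / 10) / √W.eps ≤ 1 / 10 := div_le_self (by norm_num) h1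
    unfold Seg.chi
    linarith
  have hψ' : Test α fun Y => ψ (W.h Y) := by
    refine ⟨?_, fun y h0 h1 => ?_, fun y z => ?_⟩
    · have := hψ.cont
      simp only [hh]
      fun_prop
    · refine hψ.le _ ?_ ?_ <;> rw [hh]
      · exact div_nonneg (by linarith) (by positivity)
      · rw [div_le_iff₀ (by positivity)]
        linarith
    · refine (hψ.hold _ _).trans (Real.rpow_le_rpow (abs_nonneg _) ?_ α.2)
      rw [hh, hh, ← sub_div, add_sub_add_right_eq_sub, abs_div,
        abs_of_pos (show (0:ℝ) < 2 * k by positivity)]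
      exact div_le_self (abs_nonneg _) (by linarith)
  have hsub : ∫ y in ((2 - x) / (2 * k))..v, ψ y * (obs φ N x y - A (obs φ) N Seg.ref) =
      (2 * (k:ℝ))⁻¹ * ∫ Y in (0:ℝ)..Hi,
        ψ (W.h Y) * (obs φ N' (W.h Y) Y - A (obs φ) N Seg.ref) := by
    have h1 := intervalIntegral.integral_comp_mul_add (a := (2 - x) / (2 * k)) (b := v)
      (fun Y => ψ (W.h Y) * (obs φ N' (W.h Y) Y - A (obs φ) N Seg.ref))
      (c := 2 * (k:ℝ)) (by positivity) (x - 2)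
    have h2 : 2 * (k:ℝ) * ((2 - x) / (2 * k)) + (x - 2) = 0 := by field_simp; ring
    rw [h2] at h1
    refine Eq.trans ?_ h1
    refine intervalIntegral.integral_congr_Ioo_of_le hu.le fun y hy => ?_
    have hE : Escapes k x y := by
      intro l hl hlk
      have hl1 : (1:ℝ) ≤ l := by exact_mod_cast hl
      have hlk' : (l:ℝ) ≤ k - 1 := by
        have : (l:ℝ) + 1 ≤ k := by exact_mod_cast hlk
        linarith
      have hy0 : 0 < y := hu0.trans hy.1
      have hl0 : (0:ℝ) < l := by linarith
      have e1 : 0 < (l:ℝ) * y := by positivity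
      have e2 : (l:ℝ) * y < l * v := mul_lt_mul_of_pos_left hy.2 hl0
      have e3 : (l:ℝ) * v ≤ (k - 1) * v := by gcongr
      refine ⟨0, ?_, ?_⟩ <;> push_cast <;> linarith
    have e := obs_odd φ (hu0.trans hy.1).le (hy.2.le.trans (by linarith)) hE (j := k - 1) (by omega) N
      (by omega) 1
    simp only [hhy]
    rw [e, Nat.cast_sub hk, show 2 * (k - 1) + 1 = 2 * k - 1 by omega]
    congr 3
    push_cast
    ring
  have hdr := hd.drift N' N (Nat.sub_le _ _)
  have hcast : (N:ℝ) - N' = 2 * k - 1 := by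
    simp only [N']
    rw [Nat.cast_sub hN, Nat.cast_sub (by omega)]
    push_cast
    ring
  rw [hcast] at hdr
  have hsplit : ∫ Y in (0:ℝ)..Hi, ψ (W.h Y) * (obs φ N' (W.h Y) Y - A (obs φ) N Seg.ref) =
      (∫ Y in (0:ℝ)..Hi, ψ (W.h Y) * (obs φ N' (W.h Y) Y - A (obs φ) N' Seg.ref)) +
      (A (obs φ) N' Seg.ref - A (obs φ) N Seg.ref) * ∫ Y in (0:ℝ)..Hi, ψ (W.h Y) * 1 := by
    rw [← intervalIntegral.integral_const_mul, ← intervalIntegral.integral_add]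
    · congr 1 with Y
      ring
    · simp only [mul_sub]
      exact (hf.integrable_mul hψ'.cont _ _ _ _).sub
        ((hψ'.cont.mul continuous_const).intervalIntegrable _ _)
    · exact (continuous_const.mul (hψ'.cont.mul continuous_const)).intervalIntegrable _ _
  have b1 := hd.test N' W hW _ hψ'
  have b2 := hψ'.abs_integral_le le_rfl hH0.le (by linarith) (u := fun _ => 1) (B := 1) (by simp)
  rw [sub_zero, one_mul] at b2
  have hg := hd.pos N'
  have b3 : |∫ Y in (0:ℝ)..Hi, ψ (W.h Y) * (obs φ N' (W.h Y) Y - A (obs φ) N Seg.ref)| ≤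
      6 * g N' := by
    have hdr0 : 0 ≤ (1 + (2 * (k:ℝ) - 1)) * g N' := mul_nonneg (by linarith) hg.le
    rw [hsplit]
    refine (abs_add_le _ _).trans ?_
    rw [abs_mul]
    calc _ ≤ W.chi * g N' + ((1 + (2 * k - 1)) * g N') * Hi := by gcongr
      _ = W.chi * g N' + 2 * (k * Hi) * g N' := by ring
      _ ≤ 11 / 10 * g N' + 2 * 2 * g N' := by gcongr
      _ ≤ 6 * g N' := by linarith
  rw [hsub, abs_mul, abs_of_pos (by positivity)]
  calc _ ≤ (2 * (k:ℝ))⁻¹ * (6 * g N') := by gcongr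
    _ = _ := by field_simp; ring

end LTM

namespace LTM

lemma inv_mul_rpow_le {k N : ℝ} (hk : 0 < k) (hkN : k ≤ N) :
    1 / k * (N / 2) ^ (-(6/5) : ℝ) ≤ 4 * k ^ (-(6/5) : ℝ) / N := by
  have hN : 0 < N := hk.trans_le hkN
  have e1 : N ^ (-(6/5) : ℝ) = N ^ (-1 : ℝ) * (N ^ (1/5 : ℝ))⁻¹ := by
    rw [← Real.rpow_neg hN.le, ← Real.rpow_add hN]; norm_num
  have e2 : k ^ (-(6/5) : ℝ) = k ^ (-1 : ℝ) * (k ^ (1/5 : ℝ))⁻¹ := by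
    rw [← Real.rpow_neg hk.le, ← Real.rpow_add hk]; norm_num
  have e3 : (k ^ (1/5 : ℝ)) ≤ N ^ (1/5 : ℝ) := Real.rpow_le_rpow hk.le hkN (by norm_num)
  have e4 : (2:ℝ) ^ (6/5 : ℝ) ≤ 4 := by
    have := Real.rpow_le_rpow_of_exponent_le (x := 2) (by norm_num) (show (6/5:ℝ) ≤ 2 by norm_num)
    norm_num at this ⊢
    exact this
  have p := Real.rpow_pos_of_pos hk (1/5)
  have q := Real.rpow_pos_of_pos hN (1/5)
  have e5 : ((2:ℝ) ^ (-(6/5) : ℝ)) = (2 ^ (6/5 : ℝ))⁻¹ := Real.rpow_neg (by norm_num) _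
  rw [Real.div_rpow hN.le (by norm_num), e5, div_inv_eq_mul, e1, e2, Real.rpow_neg_one,
    Real.rpow_neg_one]
  have e6 : (N ^ (1/5 : ℝ))⁻¹ ≤ (k ^ (1/5 : ℝ))⁻¹ := inv_anti₀ p e3
  calc 1 / k * (N⁻¹ * (N ^ (1/5 : ℝ))⁻¹ * 2 ^ (6/5 : ℝ))
      ≤ 1 / k * (N⁻¹ * (k ^ (1/5 : ℝ))⁻¹ * 4) := by gcongr
    _ = _ := by field_simp

/-- The vertical coordinates at which the number of turns in the strip changes. -/
def brk (x : ℝ) (k : ℕ) : ℝ := if k = 0 then 1 / 2 else (2 - x) / (2 * k)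

lemma brk_succ (x : ℝ) (k : ℕ) : brk x (k + 1) = (2 - x) / (2 * ((k + 1 : ℕ) : ℝ)) := by
  simp [brk]

lemma brk_props {x : ℝ} (hx1 : 1 < x) (hx2 : x < 2) (k : ℕ) : 0 < brk x k ∧ brk x k ≤ 1 / 2 ∧
    2 * (k:ℝ) * brk x k ≤ 2 - x ∧ 2 - x < 2 * ((k:ℝ) + 1) * brk x k := by
  rcases Nat.eq_zero_or_pos k with rfl | hk
  · simp only [brk, if_true]
    push_cast
    refine ⟨?_, ?_, ?_, ?_⟩ <;> linarith
  · have hk1 : (1:ℝ) ≤ k := by exact_mod_cast hk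
    have hk0 : (0:ℝ) < k := by linarith
    have e : 2 * (k:ℝ) * brk x k = 2 - x := by
      simp only [brk, hk.ne', if_false]; field_simp
    have h0 : 0 < brk x k := by
      simp only [brk, hk.ne', if_false]; exact div_pos (by linarith) (by positivity)
    refine ⟨h0, ?_, e.le, by linarith⟩
    nlinarith

variable {α Cφ : ℝ≥0} {φ : 𝕋 → ℝ} {C M : ℝ} {g : ℕ → ℝ}

lemma summable_succ_rpow : Summable fun k : ℕ => ((k:ℝ) + 1) ^ (-(6/5) : ℝ) := by
  have := (summable_nat_add_iff 1).2 (Real.summable_nat_rpow (p := -(6/5)) |>.2 (by norm_num))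
  simpa using this

lemma Decay.strip_low (hd : Decay (obs φ) α C g) (hf : Dyn (obs φ) M Cφ α) (hC : 0 < C) :
    ∃ B, 0 ≤ B ∧ ∀ N : ℕ, 1 ≤ N → ∀ x, 1 < x → x < 2 → ∀ ψ, Test α ψ →
      |∫ y in (0:ℝ)..(1/2), ψ y * (obs φ N x y - A (obs φ) N Seg.ref)| ≤ B / N := by
  set s := ∑' k : ℕ, ((k:ℝ) + 1) ^ (-(6/5) : ℝ)
  have hs : 0 ≤ s := tsum_nonneg fun k => by positivity
  have hM : 0 ≤ M := hf.M_nonneg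
  refine ⟨12 * C * s + 8 * M, by positivity, fun N hN x hx1 hx2 ψ hψ => ?_⟩
  have hN0 : (0:ℝ) < N := by exact_mod_cast hN
  set u := fun y => ψ y * (obs φ N x y - A (obs φ) N Seg.ref)
  have hmeas : Measurable fun y => obs φ N x y :=
    (hf.meas N).comp (measurable_const.prodMk measurable_id)
  have hu : ∀ a b, IntervalIntegrable u volume a b := fun a b => by
    have h1 : Measurable fun y => obs φ N x y - A (obs φ) N Seg.ref := hmeas.sub measurable_const
    have h2 : ∀ y, |obs φ N x y - A (obs φ) N Seg.ref| ≤ 2 * M := fun y => by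
      have := abs_sub (obs φ N x y) (A (obs φ) N Seg.ref)
      linarith [hf.bdd N x y, hf.A_le N Seg.ref_valid]
    have h3 := intervalIntegrable_of_bdd h1 h2 a b
    exact h3.continuousOn_mul hψ.cont.continuousOn
  set K := N / 4
  have hb := brk_props hx1 hx2
  have hsum := intervalIntegral.sum_integral_adjacent_intervals (f := u) (μ := volume)
    (a := brk x) (n := K) (fun k _ => hu _ _)
  have hsplit : ∫ y in (0:ℝ)..(1/2), u y = (∫ y in (0:ℝ)..(brk x K), u y) -
      ∑ k ∈ Finset.range K, ∫ y in brk x k..brk x (k + 1), u y := by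
    rw [hsum, show brk x 0 = 1 / 2 by simp [brk], intervalIntegral.integral_symm (brk x K) (1/2),
      sub_neg_eq_add, intervalIntegral.integral_add_adjacent_intervals (hu _ _) (hu _ _)]
  have b1 : |∫ y in (0:ℝ)..(brk x K), u y| ≤ 8 * M / N := by
    have h1 := hψ.abs_integral_le (a := 0) (b := brk x K) le_rfl (hb K).1.le
      (by linarith [(hb K).2.1]) (u := fun y => obs φ N x y - A (obs φ) N Seg.ref) (B := 2 * M)
      (fun y => by
        have := abs_sub (obs φ N x y) (A (obs φ) N Seg.ref)
        linarith [hf.bdd N x y, hf.A_le N Seg.ref_valid])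
    refine h1.trans ?_
    have h2 : brk x K ≤ 4 / N := by
      rw [le_div_iff₀ hN0]
      have h3 : (N:ℝ) ≤ 4 * K + 3 := by
        have : N ≤ 4 * (N / 4) + 3 := by omega
        exact_mod_cast this
      have h4 := (hb K).2.2.1
      have h5 := (hb K).2.1
      have h6 := mul_le_mul_of_nonneg_left h3 (hb K).1.le
      linarith
    calc 2 * M * (brk x K - 0) ≤ 2 * M * (4 / N) := by rw [sub_zero]; gcongr
      _ = _ := by ring
  have b2 : ∀ k ∈ Finset.range K, |∫ y in brk x k..brk x (k + 1), u y| ≤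
      12 * C / N * ((k:ℝ) + 1) ^ (-(6/5) : ℝ) := by
    intro k hk
    have hk' : k < N / 4 := Finset.mem_range.1 hk
    obtain ⟨-, h2, h3, h4⟩ := hb k
    have h5 := hd.strip_piece hf hx1 hx2 (N := N) (k := k + 1) (v := brk x k) (by omega)
      (by omega) h2 (by push_cast; linarith) (by push_cast; linarith) hψ
    rw [intervalIntegral.integral_symm, abs_neg, brk_succ]
    refine h5.trans ?_
    have hkN : (k:ℝ) + 1 ≤ N := by exact_mod_cast (by omega : k + 1 ≤ N)
    have h6 : g (N - (2 * (k + 1) - 1)) ≤ C * ((N:ℝ) / 2) ^ (-(6/5) : ℝ) := by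
      refine (hd.le _).trans ?_
      gcongr C * ?_
      refine Real.rpow_le_rpow_of_nonpos (by positivity) ?_ (by norm_num)
      have : (N:ℝ) ≤ 2 * (((N - (2 * (k + 1) - 1) : ℕ) : ℝ) + 1) := by
        exact_mod_cast (by omega : N ≤ 2 * (N - (2 * (k + 1) - 1) + 1))
      linarith
    have h7 := inv_mul_rpow_le (by positivity : (0:ℝ) < (k:ℝ) + 1) hkN
    push_cast
    calc 3 / ((k:ℝ) + 1) * g (N - (2 * (k + 1) - 1))
        ≤ 3 / ((k:ℝ) + 1) * (C * ((N:ℝ) / 2) ^ (-(6/5) : ℝ)) := by gcongr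
      _ = 3 * C * (1 / ((k:ℝ) + 1) * ((N:ℝ) / 2) ^ (-(6/5) : ℝ)) := by ring
      _ ≤ 3 * C * (4 * ((k:ℝ) + 1) ^ (-(6/5) : ℝ) / N) := by gcongr
      _ = _ := by ring
  have b3 : ∑ k ∈ Finset.range K, ((k:ℝ) + 1) ^ (-(6/5) : ℝ) ≤ s :=
    summable_succ_rpow.sum_le_tsum _ fun k _ => by positivity
  rw [hsplit]
  calc _ ≤ 8 * M / N + ∑ k ∈ Finset.range K, 12 * C / N * ((k:ℝ) + 1) ^ (-(6/5) : ℝ) :=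
        (abs_sub _ _).trans (add_le_add b1
          ((Finset.abs_sum_le_sum_abs _ _).trans (Finset.sum_le_sum b2)))
    _ = 8 * M / N + 12 * C / N * ∑ k ∈ Finset.range K, ((k:ℝ) + 1) ^ (-(6/5) : ℝ) := by
        rw [Finset.mul_sum]
    _ ≤ 8 * M / N + 12 * C / N * s := by gcongr
    _ = _ := by ring

/-- The central symmetry of the torus that preserves the unit square. -/
def cen (z : 𝕋) : 𝕋 := (((1:ℝ) : AddCircle (2:ℝ)) - z.1, ((1:ℝ) : AddCircle (2:ℝ)) - z.2)

lemma theta_mem (z : AddCircle (2:ℝ)) : 0 ≤ θ z ∧ θ z < 2 ∧ ((θ z : ℝ) : AddCircle (2:ℝ)) = z := by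
  have h := (AddCircle.equivIco 2 0 z).2
  refine ⟨h.1, by simpa [θ] using h.2, ?_⟩
  exact (AddCircle.equivIco (2:ℝ) 0).symm_apply_apply z

lemma Vm_cen (z : 𝕋) : Vm (cen z) = cen (Vm z) := by
  obtain ⟨x, y⟩ := z
  obtain ⟨h0, h2, h⟩ := theta_mem y
  obtain ⟨v, rfl⟩ : ∃ v : ℝ, v = θ y := ⟨_, rfl⟩
  generalize θ y = v at *
  subst h
  simp only [cen]
  rw [← AddCircle.coe_sub]
  rcases le_or_gt v 1 with h1 | h1
  · rw [Vm_of_le _ (by linarith) (by linarith), Vm_of_le _ h0 h1, AddCircle.coe_sub]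
    have h3 := coe_sub_two_mul (2 - 2 * v) 1
    simp only [AddCircle.coe_sub, mul_sub, mul_one, Nat.cast_one] at h3 ⊢
    rw [Prod.mk.injEq]
    refine ⟨rfl, ?_⟩
    rw [← h3]
    abel
  · have h3 := coe_sub_two_mul (3 - v) 1
    rw [show (3 - v - 2 * ((1:ℕ):ℝ)) = 1 - v by push_cast; ring] at h3
    rw [h3, Vm_of_lt _ (by linarith) (by linarith), Vm_of_lt _ h1 h2, ← h3, AddCircle.coe_sub]

lemma obs_cen (φ : 𝕋 → ℝ) (m : ℕ) (x y : ℝ) (r : ℕ) :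
    obs (φ ∘ cen) m x y = obs φ m (1 + 2 * r - x) (1 - y) := by
  have h : Function.Semiconj cen Vm Vm := fun z => (Vm_cen z).symm
  simp only [obs, Function.comp]
  rw [(h.iterate_right m).eq, ← coe_sub_two_mul (1 + 2 * r - x) r,
    show 1 + 2 * (r:ℝ) - x - 2 * r = 1 - x by ring]
  simp only [cen, AddCircle.coe_sub]

lemma A_cen (φ : 𝕋 → ℝ) (m : ℕ) : A (obs (φ ∘ cen)) m Seg.ref = A (obs φ) m Seg.ref := by
  have h : ∀ y, Seg.ref.h y = 1 / 2 := fun y => by simp [Seg.ref, Seg.h]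
  simp only [A, h]
  congr 1
  have h1 := intervalIntegral.integral_comp_sub_left (a := 0) (b := 1)
    (fun y => obs φ m (1/2) y) 1
  simp only [sub_zero, sub_self] at h1
  change ∫ y in (0:ℝ)..1, _ = ∫ y in (0:ℝ)..1, _
  rw [← h1]
  congr 1 with y
  rw [obs_cen φ m _ y 0]
  norm_num

lemma holder_cen (hφ : HolderWith Cφ α φ) : HolderWith Cφ α (φ ∘ cen) := by
  intro x y
  have : edist (cen x) (cen y) = edist x y := by
    simp only [cen, Prod.edist_eq, edist_sub_left]
  simpa [this] using hφ (cen x) (cen y)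

lemma exists_strip (hα : 0 < α) (hφ : HolderWith Cφ α φ) (hM1 : 1 ≤ M) (hM : ∀ z, |φ z| ≤ M) :
    ∃ B, 0 ≤ B ∧ ∀ N : ℕ, 1 ≤ N → ∀ x, 1 < x → x < 2 → ∀ ψ, Test α ψ →
      |∫ y in (0:ℝ)..1, ψ y * (obs φ N x y - A (obs φ) N Seg.ref)| ≤ B / N := by
  have hα' : (0:ℝ) < α := hα
  have hf := dyn_obs hα hφ hM
  have hf' := dyn_obs hα (holder_cen hφ) (M := M) (fun z => hM _)
  obtain ⟨C, g, hC, hd⟩ := Decay.exists_of_dyn hf hM1 Cφ.2 hα'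
  obtain ⟨C', g', hC', hd'⟩ := Decay.exists_of_dyn hf' hM1 Cφ.2 hα'
  obtain ⟨B, hB, h⟩ := hd.strip_low hf hC
  obtain ⟨B', hB', h'⟩ := hd'.strip_low hf' hC'
  refine ⟨B + B', by positivity, fun N hN x hx1 hx2 ψ hψ => ?_⟩
  have hψ' : Test α fun y => ψ (1 - y) := by
    refine ⟨?_, fun y h0 h1 => hψ.le _ (by linarith) (by linarith), fun y z => ?_⟩
    · have := hψ.cont
      fun_prop
    · refine (hψ.hold _ _).trans (le_of_eq ?_)
      rw [sub_sub_sub_cancel_left, abs_sub_comm]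
  have hu : ∀ a b, IntervalIntegrable (fun y => ψ y * (obs φ N x y - A (obs φ) N Seg.ref))
      volume a b := fun a b => by
    have h1 : Measurable fun y => obs φ N x y - A (obs φ) N Seg.ref :=
      ((hf.meas N).comp (measurable_const.prodMk measurable_id)).sub measurable_const
    have h2 : ∀ y, |obs φ N x y - A (obs φ) N Seg.ref| ≤ 2 * M := fun y => by
      have := abs_sub (obs φ N x y) (A (obs φ) N Seg.ref)
      linarith [hf.bdd N x y, hf.A_le N Seg.ref_valid]
    exact (intervalIntegrable_of_bdd h1 h2 a b).continuousOn_mul hψ.cont.continuousOn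
  have e := intervalIntegral.integral_comp_sub_left (a := 0) (b := 1 / 2)
    (fun y => ψ y * (obs φ N x y - A (obs φ) N Seg.ref)) 1
  rw [show (1:ℝ) - 1 / 2 = 1 / 2 by norm_num, sub_zero] at e
  rw [← intervalIntegral.integral_add_adjacent_intervals (hu 0 (1/2)) (hu (1/2) 1), ← e]
  have q1 := h N hN x hx1 hx2 ψ hψ
  have q2 := h' N hN (3 - x) (by linarith) (by linarith) _ hψ'
  rw [A_cen] at q2
  have q3 : ∀ y, obs (φ ∘ cen) N (3 - x) y = obs φ N x (1 - y) := fun y => by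
    rw [obs_cen φ N _ y 1]
    congr 1
    push_cast
    ring
  simp only [q3] at q2
  rw [add_div]
  exact (abs_add_le _ _).trans (add_le_add q1 q2)

end LTM

namespace LTM

/-- The covering map of the torus. -/
def cov (p : ℝ × ℝ) : 𝕋 := ((p.1 : AddCircle (2:ℝ)), (p.2 : AddCircle (2:ℝ)))

lemma measurable_cov : Measurable cov := by
  have h2 : Measurable fun x : ℝ => (x : AddCircle (2:ℝ)) := AddCircle.measurable_mk'
  unfold cov
  fun_prop

lemma measurableSet_R : MeasurableSet R := by
  have h := measurable_theta
  exact (measurableSet_le (h.comp measurable_snd) measurable_const).union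
    (measurableSet_le (h.comp measurable_fst) measurable_const)

lemma measurable_inner {v : ℝ × ℝ → ℝ} (hv : Measurable v) (a b : ℝ) :
    Measurable fun x => ∫ y in a..b, v (x, y) := by
  simp only [intervalIntegral]
  exact (hv.stronglyMeasurable.integral_prod_right'.measurable).sub
    (hv.stronglyMeasurable.integral_prod_right'.measurable)

lemma intervalIntegrable_inner {v : ℝ × ℝ → ℝ} (hv : Measurable v) {B : ℝ} (hB : ∀ p, |v p| ≤ B)
    {a b : ℝ} (hab : a ≤ b) (c d : ℝ) :
    IntervalIntegrable (fun x => ∫ y in a..b, v (x, y)) volume c d :=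
  intervalIntegrable_of_bdd (measurable_inner hv a b) (M := B * (b - a))
    (fun x => abs_integral_le (fun y => hB (x, y)) hab) c d

lemma integral_torus {w : 𝕋 → ℝ} (hw : Measurable w) {B : ℝ} (hB : ∀ z, |w z| ≤ B) :
    ∫ z, w z ∂(volume : Measure 𝕋) = ∫ x in (0:ℝ)..2, ∫ y in (0:ℝ)..2, w (cov (x, y)) := by
  have h1 := AddCircle.measurePreserving_mk (2:ℝ) 0
  have h2 := h1.prod h1
  have h3 : Prod.map (fun x : ℝ => (x : AddCircle (2:ℝ))) (fun x : ℝ => (x : AddCircle (2:ℝ))) = cov := rfl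
  rw [h3] at h2
  rw [zero_add] at h2
  rw [Measure.volume_eq_prod, ← h2.map_eq,
    integral_map measurable_cov.aemeasurable hw.aestronglyMeasurable, integral_prod]
  · simp only [intervalIntegral.integral_of_le (zero_le_two : (0:ℝ) ≤ 2)]
  · exact Integrable.of_bound (hw.comp measurable_cov).aestronglyMeasurable B
      (Filter.Eventually.of_forall fun p => hB _)

lemma mem_R_iff {x y : ℝ} (hx0 : 0 ≤ x) (hx2 : x < 2) (hy0 : 0 ≤ y) (hy2 : y < 2) :
    cov (x, y) ∈ R ↔ y ≤ 1 ∨ x ≤ 1 := by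
  simp only [R, P, Q, cov, Set.mem_union, Set.mem_ofPred_eq, theta_coe hx0 hx2, theta_coe hy0 hy2]

lemma integral_R {u : 𝕋 → ℝ} (hu : Measurable u) {B : ℝ} (hB : ∀ z, |u z| ≤ B) :
    ∫ z in R, u z ∂(volume : Measure 𝕋) = (∫ x in (0:ℝ)..1, ∫ y in (0:ℝ)..1, u (cov (x, y))) +
      (∫ y in (1:ℝ)..2, ∫ x in (0:ℝ)..1, u (cov (x, y))) +
      ∫ x in (1:ℝ)..2, ∫ y in (0:ℝ)..1, u (cov (x, y)) := by
  have hB0 : 0 ≤ B := (abs_nonneg _).trans (hB 0)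
  set w : 𝕋 → ℝ := R.indicator u
  have hw : Measurable w := hu.indicator measurableSet_R
  have hwB : ∀ z, |w z| ≤ B := fun z => by
    simp only [w, Set.indicator]
    split_ifs
    · exact hB z
    · simpa using hB0
  have hwc : Measurable fun p => w (cov p) := hw.comp measurable_cov
  have huc : Measurable fun p => u (cov p) := hu.comp measurable_cov
  have hsec : ∀ x a b, IntervalIntegrable (fun y => w (cov (x, y))) volume a b := fun x =>
    intervalIntegrable_of_bdd (hwc.comp (measurable_const.prodMk measurable_id)) (fun y => hwB _)
  have hwR : ∀ {z}, z ∈ R → w z = u z := fun hz => Set.indicator_of_mem hz _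
  have hwR' : ∀ {z}, z ∉ R → w z = 0 := fun hz => Set.indicator_of_notMem hz _
  rw [← integral_indicator measurableSet_R, integral_torus hw hwB,
    ← intervalIntegral.integral_add_adjacent_intervals
      (intervalIntegrable_inner hwc (fun p => hwB _) zero_le_two 0 1)
      (intervalIntegrable_inner hwc (fun p => hwB _) zero_le_two 1 2)]
  have e1 : ∫ x in (0:ℝ)..1, ∫ y in (0:ℝ)..2, w (cov (x, y)) = ∫ x in (0:ℝ)..1,
      ((∫ y in (0:ℝ)..1, u (cov (x, y))) + ∫ y in (1:ℝ)..2, u (cov (x, y))) := by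
    refine intervalIntegral.integral_congr_Ioo_of_le zero_le_one fun x hx => ?_
    have hx0 := hx.1
    have hx1 := hx.2
    rw [← intervalIntegral.integral_add_adjacent_intervals (hsec x 0 1) (hsec x 1 2)]
    congr 1
    · refine intervalIntegral.integral_congr_Ioo_of_le zero_le_one fun y hy => hwR ?_
      exact (mem_R_iff hx0.le (by linarith) hy.1.le (by linarith [hy.2])).2 (Or.inr hx1.le)
    · refine intervalIntegral.integral_congr_Ioo_of_le one_le_two fun y hy => hwR ?_
      exact (mem_R_iff hx0.le (by linarith) (by linarith [hy.1]) hy.2).2 (Or.inr hx1.le)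
  have e2 : ∫ x in (1:ℝ)..2, ∫ y in (0:ℝ)..2, w (cov (x, y)) = ∫ x in (1:ℝ)..2,
      ∫ y in (0:ℝ)..1, u (cov (x, y)) := by
    refine intervalIntegral.integral_congr_Ioo_of_le one_le_two fun x hx => ?_
    have hx0 := hx.1
    have hx1 := hx.2
    rw [← intervalIntegral.integral_add_adjacent_intervals (hsec x 0 1) (hsec x 1 2)]
    have q1 : ∫ y in (0:ℝ)..1, w (cov (x, y)) = ∫ y in (0:ℝ)..1, u (cov (x, y)) := by
      refine intervalIntegral.integral_congr_Ioo_of_le zero_le_one fun y hy => hwR ?_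
      exact (mem_R_iff (by linarith) hx1 hy.1.le (by linarith [hy.2])).2 (Or.inl hy.2.le)
    have q2 : ∫ y in (1:ℝ)..2, w (cov (x, y)) = ∫ y in (1:ℝ)..2, (0:ℝ) := by
      refine intervalIntegral.integral_congr_Ioo_of_le one_le_two fun y hy => hwR' ?_
      rw [mem_R_iff (by linarith) hx1 (by linarith [hy.1]) hy.2]
      push Not
      exact ⟨hy.1, hx0⟩
    rw [q1, q2, intervalIntegral.integral_zero, add_zero]
  rw [e1, e2, intervalIntegral.integral_add
    (intervalIntegrable_inner huc (fun p => hB _) zero_le_one 0 1)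
    (intervalIntegrable_inner huc (fun p => hB _) one_le_two 0 1),
    intervalIntegral_intervalIntegral_swap (a := 0) (b := 1) (c := 1) (d := 2)]
  have : IsFiniteMeasure ((volume.restrict (Set.uIoc (0:ℝ) 1)).prod
    (volume.restrict (Set.uIoc (1:ℝ) 2))) := by
    rw [Set.uIoc_of_le zero_le_one, Set.uIoc_of_le one_le_two]
    infer_instance
  rw [IntegrableOn, Measure.volume_eq_prod, ← Measure.prod_restrict]
  exact Integrable.of_bound (C := B) huc.aestronglyMeasurable
    (Filter.Eventually.of_forall fun p => hB _)

end LTM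

namespace LTM

lemma abs_integral_le_integral {a b : ℝ} (hab : a ≤ b) {u w : ℝ → ℝ}
    (h : ∀ x, a < x → x < b → |u x| ≤ w x) (hw : IntervalIntegrable w volume a b) :
    |∫ x in a..b, u x| ≤ ∫ x in a..b, w x := by
  rw [← Real.norm_eq_abs]
  refine intervalIntegral.norm_integral_le_of_norm_le hab ?_ hw
  filter_upwards [(Set.countable_singleton b).ae_notMem volume] with x hx hx'
  exact h x hx'.1 (lt_of_le_of_ne hx'.2 hx)

lemma abs_integral_le_const {a b : ℝ} (hab : a ≤ b) {u : ℝ → ℝ} {B : ℝ}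
    (h : ∀ x, a < x → x < b → |u x| ≤ B) : |∫ x in a..b, u x| ≤ B * (b - a) := by
  refine (abs_integral_le_integral hab h intervalIntegrable_const).trans_eq ?_
  rw [intervalIntegral.integral_const, smul_eq_mul, mul_comm]

lemma intervalIntegrable_inv_sqrt :
    IntervalIntegrable (fun x : ℝ => 1 + 1 / √x + 1 / √(1 - x)) volume 0 1 := by
  have h1 : IntervalIntegrable (fun x : ℝ => 1 / √x) volume 0 1 := by
    refine (intervalIntegral.intervalIntegrable_rpow' (r := -(1 / 2)) (by norm_num)).congr
      fun x hx => ?_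
    rw [Set.uIoc_of_le zero_le_one] at hx
    simp only [Real.rpow_neg hx.1.le, Real.sqrt_eq_rpow, one_div]
  have h2 := (h1.comp_sub_left 1).symm
  rw [sub_zero, sub_self] at h2
  exact (intervalIntegrable_const.add h1).add h2

variable {α Cφ Cψ : ℝ≥0} {φ ψ : 𝕋 → ℝ}

lemma exists_bound (hα : 0 < α) (hφ : HolderWith Cφ α φ) : ∃ M, 1 ≤ M ∧ ∀ z, |φ z| ≤ M := by
  obtain ⟨M, hM⟩ := isCompact_univ.exists_bound_of_continuousOn (hφ.continuous hα).continuousOn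
  exact ⟨max 1 M, le_max_left _ _, fun z => (hM z trivial).trans (le_max_right _ _)⟩

lemma test_comp (hα : 0 < α) (hψ : HolderWith Cψ α ψ) (hC : Cψ ≤ 1) (hB : ∀ z, |ψ z| ≤ 1)
    {γ : ℝ → 𝕋} (hγ : ∀ s t, dist (γ s) (γ t) ≤ |s - t|) : Test α (fun s => ψ (γ s)) where
  cont := (hψ.continuous hα).comp (LipschitzWith.of_dist_le' (K := 1) (fun s t => by
    rw [one_mul, Real.dist_eq]; exact hγ s t)).continuous
  le := fun _ _ _ => hB _
  hold := fun s t => by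
    refine (hψ.dist_le_of_le (hγ s t)).trans (mul_le_of_le_one_left (by positivity) ?_)
    exact_mod_cast hC

lemma test_fst (hα : 0 < α) (hψ : HolderWith Cψ α ψ) (hC : Cψ ≤ 1) (hB : ∀ z, |ψ z| ≤ 1)
    (y : ℝ) : Test α (fun x => ψ (cov (x, y))) :=
  test_comp hα hψ hC hB fun s t => by
    simp only [cov, Prod.dist_eq, dist_self, sup_le_iff, abs_nonneg, and_true, dist_coe_le]

lemma test_snd (hα : 0 < α) (hψ : HolderWith Cψ α ψ) (hC : Cψ ≤ 1) (hB : ∀ z, |ψ z| ≤ 1)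
    (x : ℝ) : Test α (fun y => ψ (cov (x, y))) :=
  test_comp hα hψ hC hB fun s t => by
    simp only [cov, Prod.dist_eq, dist_self, sup_le_iff, abs_nonneg, true_and, dist_coe_le]

lemma Decay.le_div {f : ℕ → ℝ → ℝ → ℝ} {α C : ℝ} {g : ℕ → ℝ} (hd : Decay f α C g) (hC : 0 < C)
    {m n : ℕ} (hn : 1 ≤ n) (hnm : n ≤ m) : g m ≤ C / n := by
  have hn' : (1:ℝ) ≤ n := by exact_mod_cast hn
  have hnm' : (n:ℝ) ≤ m := by exact_mod_cast hnm
  refine (hd.le m).trans ?_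
  rw [div_eq_mul_inv C, ← Real.rpow_neg_one (n : ℝ)]
  refine mul_le_mul_of_nonneg_left ?_ hC.le
  calc ((m:ℝ) + 1) ^ (-(6/5) : ℝ) ≤ ((m:ℝ) + 1) ^ (-1 : ℝ) :=
        Real.rpow_le_rpow_of_exponent_le (by linarith) (by norm_num)
    _ ≤ (n:ℝ) ^ (-1 : ℝ) :=
        Real.rpow_le_rpow_of_nonpos (by linarith) (by linarith) (by norm_num)

lemma exists_decay_normalized (hα : 0 < α) (hφ : HolderWith Cφ α φ) :
    ∃ K, 0 < K ∧ ∀ (ψ : 𝕋 → ℝ) (Cψ : ℝ≥0), HolderWith Cψ α ψ → Cψ ≤ 1 → (∀ z, |ψ z| ≤ 1) →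
      ∀ n : ℕ, 1 ≤ n → ∃ a : ℝ, |∫ z in R, ψ z * (φ (H^[n] z) - a) ∂(volume : Measure 𝕋)| ≤ K / n := by
  obtain ⟨M, hM1, hM⟩ := exists_bound hα hφ
  have hα' : (0:ℝ) < α := hα
  have hf := dyn_obs hα hφ hM
  obtain ⟨C, g, hC, hd⟩ := Decay.exists_of_dyn hf hM1 Cφ.2 hα'
  obtain ⟨B, hB, hs⟩ := exists_strip hα hφ hM1 hM
  set I := ∫ x in (0:ℝ)..1, (1 + 1 / √x + 1 / √(1 - x))
  have hI : 0 ≤ I := intervalIntegral.integral_nonneg zero_le_one fun x hx => by positivity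
  refine ⟨I * C + 2 * B + 2 * C, by positivity, fun ψ Cψ hψ hCψ hψ1 n hn => ?_⟩
  have hn' : (1:ℝ) ≤ n := by exact_mod_cast hn
  set a := A (obs φ) (2 * n) Seg.ref with ha
  have ha' : |a| ≤ M := hf.A_le _ Seg.ref_valid
  refine ⟨a, ?_⟩
  have hH : ∀ x y : ℝ, φ (H^[n] (cov (x, y))) = obs φ (2 * n) x y := fun x y => by
    rw [H_iterate]; rfl
  have hmH : Measurable fun z => φ (H^[n] z) := by
    simp only [H_iterate]
    exact (hφ.continuous hα).measurable.comp (measurable_Vm.iterate _)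
  have hmU : Measurable fun z => ψ z * (φ (H^[n] z) - a) :=
    (hψ.continuous hα).measurable.mul (hmH.sub measurable_const)
  have hbU : ∀ z, |ψ z * (φ (H^[n] z) - a)| ≤ 2 * M := fun z => by
    rw [abs_mul]
    have h1 := abs_sub (φ (H^[n] z)) a
    have h2 := hM (H^[n] z)
    nlinarith [hψ1 z, abs_nonneg (ψ z), abs_nonneg (φ (H^[n] z) - a)]
  rw [integral_R hmU hbU]
  simp only [hH]
  have hg1 : g (2 * n) ≤ C / n := hd.le_div hC hn (by omega)
  have hg2 : g (2 * n - 1) ≤ C / n := hd.le_div hC hn (by omega)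
  have t1 : |∫ x in (0:ℝ)..1, ∫ y in (0:ℝ)..1, ψ (cov (x, y)) * (obs φ (2 * n) x y - a)| ≤
      I * (C / n) := by
    refine (abs_integral_le_integral zero_le_one
      (fun x hx0 hx1 => hd.square hx0 hx1 (2 * n) (test_snd hα hψ hCψ hψ1 x))
      (intervalIntegrable_inv_sqrt.mul_const _)).trans ?_
    rw [intervalIntegral.integral_mul_const]
    exact mul_le_mul_of_nonneg_left hg1 hI
  have t3 : |∫ x in (1:ℝ)..2, ∫ y in (0:ℝ)..1, ψ (cov (x, y)) * (obs φ (2 * n) x y - a)| ≤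
      B / n := by
    refine (abs_integral_le_const one_le_two fun x hx1 hx2 =>
      (hs (2 * n) (by omega) x hx1 hx2 _ (test_snd hα hψ hCψ hψ1 x))).trans ?_
    rw [show (2:ℝ) - 1 = 1 by norm_num, mul_one]
    exact div_le_div_of_nonneg_left hB (by linarith) (by push_cast; linarith)
  have t2 : |∫ y in (1:ℝ)..2, ∫ x in (0:ℝ)..1, ψ (cov (x, y)) * (obs φ (2 * n) x y - a)| ≤
      B / n + 2 * (C / n) := by
    have h : ∀ y, 1 < y → y < 2 →
        |∫ x in (0:ℝ)..1, ψ (cov (x, y)) * (obs φ (2 * n) x y - a)| ≤ B / n + 2 * (C / n) := by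
      intro y hy1 hy2
      have hT := test_fst hα hψ hCψ hψ1 y
      set a' := A (obs φ) (2 * n - 1) Seg.ref with ha'
      have hswap : ∀ x, obs φ (2 * n) x y = obs φ (2 * n - 1) y x := fun x => by
        obtain ⟨m, hm⟩ : ∃ m, 2 * n = m + 1 := ⟨2 * n - 1, by omega⟩
        rw [hm, Nat.add_sub_cancel, obs, Function.iterate_succ_apply, Vm_of_lt _ hy1 hy2, obs]
      have hi : ∀ x, ψ (cov (x, y)) * (obs φ (2 * n) x y - a) =
          ψ (cov (x, y)) * (obs φ (2 * n - 1) y x - a') + ψ (cov (x, y)) * (a' - a) := fun x => by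
        rw [hswap]; ring
      simp only [hi]
      have hmo : Measurable fun x => obs φ (2 * n - 1) y x :=
        (measurable_obs (hφ.continuous hα) _).comp (measurable_const.prodMk measurable_id)
      rw [intervalIntegral.integral_add]
      · refine (abs_add_le _ _).trans (add_le_add ?_ ?_)
        · refine (hs (2 * n - 1) (by omega) y hy1 hy2 _ hT).trans ?_
          refine div_le_div_of_nonneg_left hB (by linarith) ?_
          exact_mod_cast (by omega : n ≤ 2 * n - 1)
        · refine (hT.abs_integral_le le_rfl zero_le_one le_rfl (u := fun _ => a' - a)
            (fun _ => le_rfl)).trans ?_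
          have hdr := hd.drift (2 * n - 1) (2 * n) (by omega)
          have hc : ((2 * n - 1 : ℕ) : ℝ) = 2 * n - 1 := by
            rw [Nat.cast_sub (by omega)]; push_cast; ring
          rw [hc] at hdr
          push_cast at hdr
          rw [show (1:ℝ) + (2 * n - (2 * n - 1)) = 2 by ring] at hdr
          rw [sub_zero, mul_one]
          exact hdr.trans (by linarith)
      · refine intervalIntegrable_of_bdd (hT.cont.measurable.mul (hmo.sub measurable_const))
          (M := 1 * (M + |a'|)) (fun x => ?_) 0 1
        simp only [Pi.mul_apply, Pi.sub_apply, abs_mul]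
        refine mul_le_mul (hψ1 _) ?_ (abs_nonneg _) zero_le_one
        exact (abs_sub _ _).trans (by linarith [hf.bdd (2 * n - 1) y x])
      · exact (hT.cont.mul continuous_const).intervalIntegrable 0 1
    refine (abs_integral_le_const one_le_two h).trans_eq (by ring)
  calc _ ≤ I * (C / n) + (B / n + 2 * (C / n)) + B / n :=
        (abs_add_le _ _).trans (add_le_add ((abs_add_le _ _).trans (add_le_add t1 t2)) t3)
    _ = _ := by ring

end LTM

/-- Polynomial decay of correlations of order `1/n` for Hölder observables. -/
theorem polynomial_decay_of_correlations
    (α : ℝ≥0) (hα0 : 0 < α) (hα1 : α ≤ 1)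
    (φ ψ : 𝕋 → ℝ) (Cφ Cψ : ℝ≥0)
    (hφ : HolderWith Cφ α φ) (hψ : HolderWith Cψ α ψ)
    (hψ0 : ∫ z in R, ψ z ∂(volume : Measure 𝕋) = 0) :
    ∃ K : ℝ, 0 < K ∧ ∀ n : ℕ, 1 ≤ n →
      |∫ z in R, φ (H^[n] z) * ψ z ∂(volume : Measure 𝕋)| ≤ K / n := by
  obtain ⟨M, hM1, hM⟩ := LTM.exists_bound hα0 hψ
  obtain ⟨M', hM1', hM'⟩ := LTM.exists_bound hα0 hφ
  obtain ⟨K, hK, h⟩ := LTM.exists_decay_normalized hα0 hφ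
  have hmψ := (hψ.continuous hα0).measurable
  have hB : (0:ℝ) < M + Cψ := by positivity
  obtain ⟨b, hb⟩ : ∃ b : ℝ≥0, (b : ℝ) = (M + Cψ)⁻¹ := ⟨⟨(M + Cψ)⁻¹, by positivity⟩, rfl⟩
  have hmul : (b : ℝ) * (M + Cψ) = 1 := by rw [hb]; exact inv_mul_cancel₀ hB.ne'
  refine ⟨(M + Cψ) * K, by positivity, fun n hn => ?_⟩
  have hH : HolderWith (b * Cψ) α fun z => (b : ℝ) * ψ z := fun z w => by
    have := hψ z w
    rw [edist_dist, Real.dist_eq, ← mul_sub, abs_mul, ENNReal.ofReal_mul (abs_nonneg _),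
      ← Real.dist_eq, ← edist_dist, NNReal.abs_eq, ENNReal.ofReal_coe_nnreal, ENNReal.coe_mul,
      mul_assoc]
    gcongr
  have hb1 : b * Cψ ≤ 1 := by
    have : (b : ℝ) * Cψ ≤ 1 := by nlinarith [b.2, hM1]
    exact_mod_cast this
  have hb2 : ∀ z, |(b : ℝ) * ψ z| ≤ 1 := fun z => by
    rw [abs_mul, NNReal.abs_eq]
    nlinarith [hM z, mul_le_mul_of_nonneg_left (hM z) b.2, mul_nonneg b.2 Cψ.2]
  obtain ⟨a, ha⟩ := h _ _ hH hb1 hb2 n hn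
  have hmφ : Measurable fun z => φ (H^[n] z) := by
    simp only [LTM.H_iterate]
    exact (hφ.continuous hα0).measurable.comp (LTM.measurable_Vm.iterate _)
  have hi1 : IntegrableOn (fun z => φ (H^[n] z) * ψ z) R (volume : Measure 𝕋) := by
    refine Integrable.of_bound (C := M' * M) (hmφ.mul hmψ).aestronglyMeasurable
      (Filter.Eventually.of_forall fun z => ?_)
    rw [norm_mul]
    exact mul_le_mul (hM' _) (hM _) (norm_nonneg _) (by linarith)
  have hi2 : IntegrableOn ψ R (volume : Measure 𝕋) :=
    Integrable.of_bound (C := M) hmψ.aestronglyMeasurable (Filter.Eventually.of_forall hM)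
  have he : ∫ z in R, (b : ℝ) * ψ z * (φ (H^[n] z) - a) ∂(volume : Measure 𝕋) =
      b * ∫ z in R, φ (H^[n] z) * ψ z ∂(volume : Measure 𝕋) := by
    have : ∀ z, (b : ℝ) * ψ z * (φ (H^[n] z) - a) = b * (φ (H^[n] z) * ψ z) - (b * a) * ψ z :=
      fun z => by ring
    simp only [this]
    rw [integral_sub (hi1.const_mul _) (hi2.const_mul _), integral_const_mul, integral_const_mul,
      hψ0, mul_zero, sub_zero]
  rw [he, abs_mul, NNReal.abs_eq] at ha
  calc _ = (M + Cψ) * (b * |∫ z in R, φ (H^[n] z) * ψ z ∂(volume : Measure 𝕋)|) := by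
        rw [← mul_assoc, mul_comm (M + (Cψ:ℝ)), hmul, one_mul]
    _ ≤ (M + Cψ) * (K / n) := mul_le_mul_of_nonneg_left ha hB.le
    _ = _ := by ring
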